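/- arXiv:1901.02445 — 6 statements merged into one kernel-verified Lean document; each statement's English description precedes it below -/
import Mathlib

section
/- There exist natural numbers n and m, a real number ε > 0, and a finite system Σ(x,y) of equations and inequations in the variables x = (x₁,…,xₙ), y = (y₁,…,y_m) such that: (i) for every group G and every tuple a ∈ Gⁿ, if Σ(a,y) has a solution y in G then there is no (a,ε)-Følner subset of G; and (ii) for every existentially closed group G, the set of tuples a ∈ Gⁿ for which Σ(a,y) has a solution in G is infinite. -/
open Filter

universe u

open scoped Classical in
/-- `H` is an `(a, ε)`-Følner subset of `G` for the tuple `a = (a 1, …, a n)`: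
for each `i`, `|a i • H △ H| < ε * |H|`. -/
def IsFolnerTuple {G : Type*} [Group G] {n : ℕ} (a : Fin n → G) (ε : ℝ) (H : Finset G) : Prop :=
  ∀ i : Fin n,
    ((((H.image (fun h => a i * h)) \ H) ∪ (H \ (H.image (fun h => a i * h)))).card : ℝ)
      < ε * H.card

/-- `(a, b)` is a solution of the finite system of equations `E` and inequations `N`
(elements of the free group on `n + m` generators) in the group `G`. -/
def IsSolution {G : Type*} [Group G] {n m : ℕ}
    (E N : Finset (FreeGroup (Fin n ⊕ Fin m))) (a : Fin n → G) (b : Fin m → G) : Prop :=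
  (∀ w ∈ E, FreeGroup.lift (Sum.elim a b) w = 1) ∧
  (∀ w ∈ N, FreeGroup.lift (Sum.elim a b) w ≠ 1)

/-- `G` is an existentially closed group: any finite system of equations and inequations
with coefficients from `G` that has a solution in some extension `H` of `G` already has a
solution in `G`. -/
def IsEC (G : Type u) [Group G] : Prop :=
  ∀ (H : Type u) [Group H], ∀ i : G →* H, Function.Injective i →
    ∀ (m : ℕ) (E N : Finset (FreeGroup (G ⊕ Fin m))),
      (∃ b : Fin m → H, (∀ w ∈ E, FreeGroup.lift (Sum.elim (⇑i) b) w = 1) ∧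
        (∀ w ∈ N, FreeGroup.lift (Sum.elim (⇑i) b) w ≠ 1)) →
      ∃ c : Fin m → G, (∀ w ∈ E, FreeGroup.lift (Sum.elim id c) w = 1) ∧
        (∀ w ∈ N, FreeGroup.lift (Sum.elim id c) w ≠ 1)

open scoped Classical in
/-- If `a` freely generates a free group of rank two, no finite set is `(a, 1/2)`-Følner. -/
theorem not_isFolnerTuple_of_injective_lift {G : Type*} [Group G] (a : Fin 2 → G)
    (ha : Function.Injective (FreeGroup.lift a)) (H : Finset G) :
    ¬ IsFolnerTuple a (1 / 2) H := by
  intro hH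
  set ψ := FreeGroup.lift a with hψ
  obtain ⟨φ, hφ⟩ : ∃ φ : G → FreeGroup (Fin 2), ∀ f g, φ (ψ f * g) = f * φ g := by
    let r : G → G := fun g => (Quotient.mk (QuotientGroup.rightRel ψ.range) g).out
    have hr : ∀ g, ∃ f, ψ f = g * (r g)⁻¹ := fun g =>
      QuotientGroup.rightRel_apply.mp (Quotient.exact (Quotient.out_eq
        (Quotient.mk (QuotientGroup.rightRel ψ.range) g)))
    choose φ hφ using hr
    refine ⟨φ, fun f g => ha ?_⟩
    have hrr : r (ψ f * g) = r g := by
      refine congrArg Quotient.out (Quotient.sound ?_)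
      refine QuotientGroup.rightRel_apply.mpr ⟨f⁻¹, ?_⟩
      simp
    rw [hφ, map_mul, hφ, hrr, mul_assoc]
  let W : Fin 2 × Bool → Finset G := fun s => H.filter fun g => φ g ∈ FreeGroup.startsWith s
  have key : ∀ i : Fin 2, (H.card : ℝ) < (W (i, true)).card + (W (i, false)).card
      + 1 / 2 * H.card := by
    intro i
    set I := H.image (fun h => a i * h) with hI
    have h1 : ((H \ I).card : ℝ) < 1 / 2 * H.card :=
      lt_of_le_of_lt (Nat.cast_le.mpr (Finset.card_le_card Finset.subset_union_right)) (hH i)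
    have h2 : H ⊆ W (i, true) ∪ ((W (i, false)).image (fun h => a i * h) ∪ (H \ I)) := by
      intro h hh
      by_cases hW : φ h ∈ FreeGroup.startsWith (i, true)
      · exact Finset.mem_union_left _ (Finset.mem_filter.mpr ⟨hh, hW⟩)
      refine Finset.mem_union_right _ ?_
      by_cases hhI : h ∈ I
      · refine Finset.mem_union_left _ ?_
        obtain ⟨k, hk, rfl⟩ := Finset.mem_image.mp hhI
        refine Finset.mem_image_of_mem _ (Finset.mem_filter.mpr ⟨hk, ?_⟩)
        have h3 := FreeGroup.startsWith_mk_mul (w := (i, false)) _ hW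
        rw [← hφ] at h3
        simpa [hψ, FreeGroup.lift_mk] using h3
      · exact Finset.mem_union_right _ (Finset.mem_sdiff.mpr ⟨hh, hhI⟩)
    have h3 : H.card ≤ (W (i, true)).card + ((W (i, false)).card + (H \ I).card) :=
      (Finset.card_le_card h2).trans <| (Finset.card_union_le _ _).trans <|
        Nat.add_le_add_left ((Finset.card_union_le _ _).trans
          (Nat.add_le_add_right Finset.card_image_le _)) _
    have h4 : (H.card : ℝ) ≤ (W (i, true)).card + ((W (i, false)).card + (H \ I).card) := by
      exact_mod_cast h3
    linarith
  have total : ∑ s, (W s).card ≤ H.card := by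
    rw [← Finset.card_biUnion]
    · exact Finset.card_le_card (Finset.biUnion_subset.mpr fun s _ => Finset.filter_subset _ _)
    · intro s _ t _ hst
      refine Finset.disjoint_left.mpr fun g hs ht => ?_
      exact (FreeGroup.startsWith.disjoint_iff_ne.mpr hst).notMem_of_mem_left
        (Finset.mem_filter.mp hs).2 (Finset.mem_filter.mp ht).2
  have total' : ((W (0, true)).card : ℝ) + (W (0, false)).card
      + ((W (1, true)).card + (W (1, false)).card) ≤ H.card := by
    rw [Fintype.sum_prod_type, Fin.sum_univ_two, Fintype.sum_bool, Fintype.sum_bool] at total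
    exact_mod_cast total
  linarith [key 0, key 1]

/-- The value of the signed letter `s` under the assignment `a`. -/
def letterValue {α G : Type*} [Group G] (a : α → G) (s : α × Bool) : G :=
  cond s.2 (a s.1) (a s.1)⁻¹

/-- A ping-pong criterion for freeness: each nontrivial reduced word conjugates `z` into one of
the subgroups `P s`, all of which commute with an element not commuting with `z`. -/
theorem injective_lift_of_conj_mem {α G : Type*} [Group G] (a : α → G)
    (P : α × Bool → Subgroup G) (z z' : G)
    (hP : ∀ t s, t ≠ (s.1, !s.2) → ∀ g ∈ P s,
      letterValue a t * g * (letterValue a t)⁻¹ ∈ P t)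
    (hz : ∀ t, letterValue a t * z * (letterValue a t)⁻¹ ∈ P t)
    (hc : ∀ s, ∀ g ∈ P s, Commute z' g) (hzz : ¬ Commute z' z) :
    Function.Injective (FreeGroup.lift a) := by
  classical
  have main : ∀ (l : List (α × Bool)) (s : α × Bool), FreeGroup.IsReduced (s :: l) →
      FreeGroup.lift a (FreeGroup.mk (s :: l)) * z * (FreeGroup.lift a (FreeGroup.mk (s :: l)))⁻¹
        ∈ P s := by
    intro l
    induction l with
    | nil => intro s _; simpa [FreeGroup.lift_mk, letterValue] using hz s
    | cons t l ih =>
      intro s hs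
      rw [FreeGroup.isReduced_cons_cons] at hs
      have hst : s ≠ (t.1, !t.2) := by
        rintro rfl
        simp at hs
      have := hP s t hst _ (ih t hs.2)
      simpa [FreeGroup.lift_mk, letterValue, mul_assoc] using this
  refine (injective_iff_map_eq_one _).mpr fun w hw => ?_
  by_contra hne
  have hred : FreeGroup.IsReduced w.toWord := FreeGroup.isReduced_toWord
  have hmk : FreeGroup.mk w.toWord = w := FreeGroup.mk_toWord
  cases hword : w.toWord with
  | nil => exact hne (FreeGroup.toWord_eq_nil_iff.mp hword)
  | cons s l =>
    rw [hword] at hred hmk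
    have := main l s hred
    rw [hmk, hw] at this
    exact hzz (hc s z (by simpa using this))

theorem lift_lift {α β G : Type*} [Group G] (f : β → G) (p : α → FreeGroup β)
    (w : FreeGroup α) :
    FreeGroup.lift f (FreeGroup.lift p w) = FreeGroup.lift (fun i => FreeGroup.lift f (p i)) w := by
  have : (FreeGroup.lift f).comp (FreeGroup.lift p)
      = FreeGroup.lift (fun i => FreeGroup.lift f (p i)) := by
    ext i; simp
  exact DFunLike.congr_fun this w

theorem lift_map {α β G : Type*} [Group G] (f : β → G) (ι : α → β) (w : FreeGroup α) :
    FreeGroup.lift f (FreeGroup.map ι w) = FreeGroup.lift (f ∘ ι) w := by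
  have : (FreeGroup.lift f).comp (FreeGroup.map ι) = FreeGroup.lift (f ∘ ι) := by
    ext1 i; simp
  exact DFunLike.congr_fun this w

theorem lift_letterValue {α β G : Type*} [Group G] (f : β → G) (p : α → FreeGroup β)
    (s : α × Bool) :
    FreeGroup.lift f (letterValue p s) = letterValue (fun i => FreeGroup.lift f (p i)) s := by
  rcases s with ⟨i, _ | _⟩ <;> simp [letterValue]

/-- The relations forcing `a` to be free: `p s` lists generators of a subgroup `P s` of `G`, and
`r s i` and `r₀` are words witnessing that conjugation by letters maps these subgroups and `z`
into one another. -/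
structure PingPongRelations {α I G : Type*} [Group G] (r : α × Bool → I → FreeGroup I)
    (r₀ : FreeGroup I) (a : α → G) (p : α × Bool → I → G) (z z' : G) : Prop where
  conj_mem : ∀ t s i, t ≠ (s.1, !s.2) →
    letterValue a t * p s i * (letterValue a t)⁻¹ = FreeGroup.lift (p t) (r s i)
  conj_base : ∀ t, letterValue a t * z * (letterValue a t)⁻¹ = FreeGroup.lift (p t) r₀
  commute : ∀ s i, z' * p s i = p s i * z'
  not_commute : z' * z ≠ z * z'

theorem PingPongRelations.injective_lift {α I G : Type*} [Group G]
    {r : α × Bool → I → FreeGroup I} {r₀ : FreeGroup I} {a : α → G} {p : α × Bool → I → G}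
    {z z' : G} (h : PingPongRelations r r₀ a p z z') : Function.Injective (FreeGroup.lift a) := by
  refine injective_lift_of_conj_mem a (fun s => (FreeGroup.lift (p s)).range) z z' ?_ ?_ ?_
    h.not_commute
  · rintro t s hts _ ⟨w, rfl⟩
    refine ⟨FreeGroup.lift (r s) w, ?_⟩
    rw [lift_lift]
    have : (MulAut.conj (letterValue a t)).toMonoidHom.comp (FreeGroup.lift (p s))
        = FreeGroup.lift (fun i => FreeGroup.lift (p t) (r s i)) := by
      ext i; simp [h.conj_mem t s i hts]
    exact (DFunLike.congr_fun this w).symm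
  · exact fun t => ⟨r₀, (h.conj_base t).symm⟩
  · rintro s _ ⟨w, rfl⟩
    induction w using FreeGroup.induction_on with
    | C1 => simp
    | of i => simpa using show Commute z' (p s i) from h.commute s i
    | inv_of i hi => simpa using hi.inv_right
    | mul x y hx hy => simpa using hx.mul_right hy

theorem PingPongRelations.map {α I G K : Type*} [Group G] [Group K]
    {r : α × Bool → I → FreeGroup I} {r₀ : FreeGroup I} {a : α → G} {p : α × Bool → I → G}
    {z z' : G} (h : PingPongRelations r r₀ a p z z') (f : G →* K) (hf : Function.Injective f) :
    PingPongRelations r r₀ (fun i => f (a i)) (fun s i => f (p s i)) (f z) (f z') := by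
  have hletter : ∀ s, letterValue (fun i => f (a i)) s = f (letterValue a s) := by
    rintro ⟨i, _ | _⟩ <;> simp [letterValue]
  have hlift : ∀ s w, FreeGroup.lift (fun i => f (p s i)) w = f (FreeGroup.lift (p s) w) := by
    intro s w
    have : FreeGroup.lift (fun i => f (p s i)) = f.comp (FreeGroup.lift (p s)) := by
      ext1 i; simp
    exact DFunLike.congr_fun this w
  refine ⟨fun t s i hts => ?_, fun t => ?_, fun s i => ?_, fun hc => ?_⟩
  · simp only [hletter, hlift, ← h.conj_mem t s i hts, map_mul, map_inv]
  · simp only [hletter, hlift, ← h.conj_base t, map_mul, map_inv]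
  · simp only [← map_mul, h.commute s i]
  · exact h.not_commute (hf (by simpa only [map_mul] using hc))

/-- The ping-pong relations are expressed by a finite system of equations and inequations. -/
theorem exists_system_pingPongRelations {n : ℕ} {I : Type*} [Finite I]
    (r : Fin n × Bool → I → FreeGroup I) (r₀ : FreeGroup I) :
    ∃ (m : ℕ) (E N : Finset (FreeGroup (Fin n ⊕ Fin m))),
      ∀ {G : Type u} [Group G] (a : Fin n → G),
        (∃ b : Fin m → G, IsSolution E N a b) ↔
          ∃ (p : Fin n × Bool → I → G) (z z' : G), PingPongRelations r r₀ a p z z' := by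
  classical
  have := Fintype.ofFinite I
  obtain ⟨m, ⟨e⟩⟩ := Finite.exists_equiv_fin (((Fin n × Bool) × I) ⊕ Bool)
  let A : Fin n → FreeGroup (Fin n ⊕ Fin m) := fun i => FreeGroup.of (Sum.inl i)
  let V : ((Fin n × Bool) × I) ⊕ Bool → FreeGroup (Fin n ⊕ Fin m) :=
    fun v => FreeGroup.of (Sum.inr (e v))
  let P : Fin n × Bool → I → FreeGroup (Fin n ⊕ Fin m) := fun s i => V (Sum.inl (s, i))
  let eqn : ((Fin n × Bool) × (Fin n × Bool) × I) ⊕ (Fin n × Bool) ⊕ ((Fin n × Bool) × I) →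
      FreeGroup (Fin n ⊕ Fin m) :=
    Sum.elim
      (fun x => if x.1 = (x.2.1.1, !x.2.1.2) then 1 else
        letterValue A x.1 * P x.2.1 x.2.2 * (letterValue A x.1)⁻¹
          * (FreeGroup.lift (P x.1) (r x.2.1 x.2.2))⁻¹)
      (Sum.elim
        (fun t => letterValue A t * V (Sum.inr true) * (letterValue A t)⁻¹
          * (FreeGroup.lift (P t) r₀)⁻¹)
        (fun x => V (Sum.inr false) * P x.1 x.2 * (P x.1 x.2 * V (Sum.inr false))⁻¹))
  have eval : ∀ {G : Type u} [Group G] (a : Fin n → G) (b : Fin m → G),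
      IsSolution (Finset.univ.image eqn)
        {V (Sum.inr false) * V (Sum.inr true) * (V (Sum.inr true) * V (Sum.inr false))⁻¹} a b ↔
      PingPongRelations r r₀ a (fun s i => b (e (Sum.inl (s, i)))) (b (e (Sum.inr true)))
        (b (e (Sum.inr false))) := by
    intro G _ a b
    have hE : (∀ w ∈ Finset.univ.image eqn, FreeGroup.lift (Sum.elim a b) w = 1) ↔
        ∀ x, FreeGroup.lift (Sum.elim a b) (eqn x) = 1 := by
      simp only [Finset.mem_image, Finset.mem_univ, true_and, forall_exists_index,
        forall_apply_eq_imp_iff]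
    rw [IsSolution, hE]
    constructor
    · rintro ⟨h, h'⟩
      refine ⟨fun t s i hts => ?_, fun t => ?_, fun s i => ?_, ?_⟩
      · have := h (Sum.inl (t, s, i))
        simp only [eqn, Sum.elim_inl, if_neg hts, map_mul, map_inv, lift_letterValue,
          lift_lift, mul_inv_eq_one] at this
        simpa [A, P, V] using this
      · have := h (Sum.inr (Sum.inl t))
        simp only [eqn, Sum.elim_inl, Sum.elim_inr, map_mul, map_inv, lift_letterValue,
          lift_lift, mul_inv_eq_one] at this
        simpa [A, P, V] using this
      · have := h (Sum.inr (Sum.inr (s, i)))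
        simp only [eqn, Sum.elim_inr, map_mul, map_inv, mul_inv_eq_one] at this
        simpa [P, V] using this
      · have := h' _ (Finset.mem_singleton_self _)
        rw [map_mul, map_inv, Ne, mul_inv_eq_one] at this
        simpa [V] using this
    · intro h
      refine ⟨?_, ?_⟩
      · rintro (⟨t, s, i⟩ | t | ⟨s, i⟩)
        · by_cases hts : t = (s.1, !s.2)
          · simp [eqn, hts]
          · simp only [eqn, Sum.elim_inl, if_neg hts, map_mul, map_inv, lift_letterValue,
              lift_lift, mul_inv_eq_one]
            simpa [A, P, V] using h.conj_mem t s i hts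
        · simp only [eqn, Sum.elim_inl, Sum.elim_inr, map_mul, map_inv, lift_letterValue,
            lift_lift, mul_inv_eq_one]
          simpa [A, P, V] using h.conj_base t
        · simp only [eqn, Sum.elim_inr, map_mul, map_inv, mul_inv_eq_one]
          simpa [P, V] using h.commute s i
      · intro w hw
        rw [Finset.mem_singleton.mp hw, map_mul, map_inv, Ne, mul_inv_eq_one]
        simpa [V] using h.not_commute
  refine ⟨m, Finset.univ.image eqn, _, fun a => ⟨fun ⟨b, hb⟩ => ⟨_, _, _, (eval a b).mp hb⟩, ?_⟩⟩
  rintro ⟨p, z, z', h⟩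
  refine ⟨fun k => Sum.elim (fun x => p x.1 x.2) (fun c => cond c z z') (e.symm k),
    (eval a _).mpr ?_⟩
  simpa using h

/-- Two injections into `ℕ` with infinite co-range differ by a permutation of `ℕ`. -/
theorem exists_perm_comp_eq {Y : Type*} (f g : Y → ℕ) (hf : Function.Injective f)
    (hg : Function.Injective g) (hf' : (Set.range f)ᶜ.Infinite) (hg' : (Set.range g)ᶜ.Infinite) :
    ∃ h : Equiv.Perm ℕ, ∀ y, h (f y) = g y := by
  classical
  have := hf'.to_subtype
  have := hg'.to_subtype
  obtain ⟨d⟩ : Nonempty (((Set.range f)ᶜ : Set ℕ) ≃ ((Set.range g)ᶜ : Set ℕ)) :=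
    nonempty_equiv_of_countable
  let c := (Equiv.ofInjective f hf).symm.trans (Equiv.ofInjective g hg)
  refine ⟨(Equiv.Set.sumCompl (Set.range f)).symm.trans
    ((Equiv.sumCongr c d).trans (Equiv.Set.sumCompl (Set.range g))), fun y => ?_⟩
  have : f y ∈ Set.range f := ⟨y, rfl⟩
  rw [Equiv.trans_apply, Equiv.Set.sumCompl_symm_apply_of_mem this]
  have hy : (Equiv.ofInjective f hf).symm ⟨f y, this⟩ = y :=
    (Equiv.ofInjective f hf).symm_apply_eq.mpr rfl
  simp [c, hy]

theorem viaEmbeddingHom_trans {X Y Z : Type*} (c : X ↪ Y) (d : Y ↪ Z) (g : Equiv.Perm X) :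
    Equiv.Perm.viaEmbeddingHom d (Equiv.Perm.viaEmbeddingHom c g)
      = Equiv.Perm.viaEmbeddingHom (c.trans d) g := by
  simp only [Equiv.Perm.viaEmbeddingHom_apply]
  ext z
  by_cases hz : z ∈ Set.range d
  · obtain ⟨y, rfl⟩ := hz
    rw [Equiv.Perm.viaEmbedding_apply]
    by_cases hy : y ∈ Set.range c
    · obtain ⟨x, rfl⟩ := hy
      rw [Equiv.Perm.viaEmbedding_apply]
      exact (Equiv.Perm.viaEmbedding_apply g (c.trans d) x).symm
    · rw [Equiv.Perm.viaEmbedding_apply_of_notMem _ _ _ hy,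
        Equiv.Perm.viaEmbedding_apply_of_notMem]
      rintro ⟨x, hx⟩
      exact hy ⟨x, d.injective hx⟩
  · rw [Equiv.Perm.viaEmbedding_apply_of_notMem _ _ _ hz,
      Equiv.Perm.viaEmbedding_apply_of_notMem]
    rintro ⟨x, hx⟩
    exact hz ⟨c x, hx⟩

theorem conj_viaEmbeddingHom {X Y : Type*} (c d : X ↪ Y) (h : Equiv.Perm Y)
    (hcd : ∀ x, h (c x) = d x) (g : Equiv.Perm X) :
    h * Equiv.Perm.viaEmbeddingHom c g * h⁻¹ = Equiv.Perm.viaEmbeddingHom d g := by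
  rw [mul_inv_eq_iff_eq_mul]
  simp only [Equiv.Perm.viaEmbeddingHom_apply]
  ext y
  rw [Equiv.Perm.mul_apply, Equiv.Perm.mul_apply]
  by_cases hy : y ∈ Set.range c
  · obtain ⟨x, rfl⟩ := hy
    rw [Equiv.Perm.viaEmbedding_apply, hcd, hcd, Equiv.Perm.viaEmbedding_apply]
  · rw [Equiv.Perm.viaEmbedding_apply_of_notMem _ _ _ hy,
      Equiv.Perm.viaEmbedding_apply_of_notMem]
    rintro ⟨x, hx⟩
    exact hy ⟨x, h.injective (by rw [hcd, hx])⟩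

theorem commute_viaEmbeddingHom {X Y : Type*} (c d : X ↪ Y)
    (hcd : Disjoint (Set.range c) (Set.range d)) (g g' : Equiv.Perm X) :
    Commute (Equiv.Perm.viaEmbeddingHom c g) (Equiv.Perm.viaEmbeddingHom d g') := by
  simp only [Equiv.Perm.viaEmbeddingHom_apply]
  refine Equiv.Perm.Disjoint.commute fun y => ?_
  by_cases hy : y ∈ Set.range c
  · exact Or.inr (Equiv.Perm.viaEmbedding_apply_of_notMem _ _ _ (hcd.notMem_of_mem_left hy))
  · exact Or.inl (Equiv.Perm.viaEmbedding_apply_of_notMem _ _ _ hy)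

/-- The `k`-th of countably many disjoint copies of `ℕ` inside `ℕ`. -/
def cone (k : ℕ) : ℕ ↪ ℕ := ⟨Nat.pair k, fun _ _ h => (Nat.pair_eq_pair.mp h).2⟩

theorem cone_eq_cone {k l x y : ℕ} : cone k x = cone l y ↔ k = l ∧ x = y := Nat.pair_eq_pair

theorem infinite_compl_of_forall_cone_ne {s : Set ℕ} (k : ℕ) (h : ∀ x, cone k x ∉ s) :
    sᶜ.Infinite :=
  (Set.infinite_range_of_injective (cone k).injective).mono (by rintro _ ⟨x, rfl⟩; exact h x)

/-- A finitely generated group of permutations of `ℕ` that contains `g` and its own copies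
acting on the cones. -/
theorem exists_fg_cone_closed (g : Equiv.Perm ℕ) (J : Set ℕ) (hJ : J.Finite) :
    ∃ Λ : Subgroup (Equiv.Perm ℕ), Λ.FG ∧ g ∈ Λ ∧
      ∀ k ∈ J, ∀ h ∈ Λ, Equiv.Perm.viaEmbeddingHom (cone k) h ∈ Λ := by
  obtain ⟨x, hx⟩ := exists_perm_comp_eq (fun y => cone 0 (cone 0 y)) (cone 0)
    (fun _ _ h => (cone 0).injective ((cone 0).injective h)) (cone 0).injective
    (infinite_compl_of_forall_cone_ne 1 (by simp [cone_eq_cone]))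
    (infinite_compl_of_forall_cone_ne 1 (by simp [cone_eq_cone]))
  have hσ : ∀ k, ∃ σ : Equiv.Perm ℕ, ∀ y, σ (cone 0 y) = cone k y := fun k =>
    exists_perm_comp_eq _ _ (cone 0).injective (cone k).injective
      (infinite_compl_of_forall_cone_ne 1 (by simp [cone_eq_cone]))
      (infinite_compl_of_forall_cone_ne (k + 1) (by simp [cone_eq_cone]))
  choose σ hσ using hσ
  let θ := Equiv.Perm.viaEmbeddingHom (cone 0)
  let S : Set (Equiv.Perm ℕ) := {g, x} ∪ σ '' J
  let Λ := Subgroup.closure (S ∪ θ '' S)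
  have hS : S ⊆ Λ := fun s hs => Subgroup.subset_closure (Or.inl hs)
  have hxΛ : x ∈ Λ := hS (Or.inl (Or.inr rfl))
  have hθθ : ∀ h, θ (θ h) = x⁻¹ * θ h * x := by
    intro h
    have := conj_viaEmbeddingHom ((cone 0).trans (cone 0)) (cone 0) x hx h
    rw [← viaEmbeddingHom_trans] at this
    have h' : x * θ (θ h) = θ h * x := mul_inv_eq_iff_eq_mul.mp this
    rw [mul_assoc, ← h', inv_mul_cancel_left]
  have hθ : Λ ≤ Λ.comap θ := by
    refine (Subgroup.closure_le _).mpr ?_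
    rintro _ (hs | ⟨s, hs, rfl⟩)
    · exact Subgroup.subset_closure (Or.inr ⟨_, hs, rfl⟩)
    · change θ (θ s) ∈ Λ
      rw [hθθ]
      exact Λ.mul_mem (Λ.mul_mem (Λ.inv_mem hxΛ)
        (Subgroup.subset_closure (Or.inr ⟨_, hs, rfl⟩))) hxΛ
  have hfin : S.Finite := ((Set.finite_singleton x).insert g).union (hJ.image σ)
  refine ⟨Λ, (Subgroup.fg_iff _).mpr ⟨_, rfl, hfin.union (hfin.image θ)⟩,
    hS (Or.inl (Or.inl rfl)), fun k hk h hh => ?_⟩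
  have hσΛ : σ k ∈ Λ := hS (Or.inr ⟨k, hk, rfl⟩)
  rw [← conj_viaEmbeddingHom (cone 0) (cone k) (σ k) (hσ k) h]
  exact Λ.mul_mem (Λ.mul_mem hσΛ (hθ hh)) (Λ.inv_mem hσΛ)

/-- The ping-pong relations, for suitable words, hold for some permutations of `ℕ`. -/
theorem exists_pingPongRelations_perm (n : ℕ) :
    ∃ (I : Type) (_ : Finite I) (r : Fin n × Bool → I → FreeGroup I) (r₀ : FreeGroup I)
      (a : Fin n → Equiv.Perm ℕ) (p : Fin n × Bool → I → Equiv.Perm ℕ) (z z' : Equiv.Perm ℕ),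
      PingPongRelations r r₀ a p z z' := by
  let code : Fin n × Bool → ℕ := fun s => Encodable.encode s + 2
  have code_inj : ∀ {s t}, code s = code t ↔ s = t := by simp [code]
  have code_ne_one : ∀ s, code s ≠ 1 := by simp [code]
  obtain ⟨Λ, ⟨T, hT⟩, hgΛ, hΛ⟩ := exists_fg_cone_closed (Equiv.swap 0 1)
    (insert 1 (Set.range code)) ((Set.finite_range code).insert 1)
  let q : T → Equiv.Perm ℕ := Subtype.val
  have hq : ∀ h ∈ Λ, ∃ w, FreeGroup.lift q w = h := by
    intro h hh
    have : Λ = (FreeGroup.lift q).range := by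
      rw [FreeGroup.range_lift_eq_closure, ← hT]
      simp [q]
    rwa [this] at hh
  let θ : ℕ → Equiv.Perm ℕ →* Equiv.Perm ℕ := fun k => Equiv.Perm.viaEmbeddingHom (cone k)
  have hr : ∀ (s : Fin n × Bool) (i : T), ∃ w, FreeGroup.lift q w = θ (code s) (q i) := fun s i =>
    hq _ (hΛ _ (Or.inr ⟨s, rfl⟩) _ (hT ▸ Subgroup.subset_closure i.2))
  choose r hr using hr
  obtain ⟨r₀, hr₀⟩ := hq _ (hΛ 1 (Or.inl rfl) _ hgΛ)
  have ha : ∀ i : Fin n, ∃ h : Equiv.Perm ℕ,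
      (∀ k ∈ insert 1 (Set.range code), k ≠ code (i, false) →
        ∀ y, h (cone k y) = cone (code (i, true)) (cone k y)) ∧
      (∀ k ∈ insert 1 (Set.range code), k ≠ code (i, true) →
        ∀ y, h (cone (code (i, false)) (cone k y)) = cone k y) := by
    intro i
    let K := insert 1 (Set.range code)
    have zero_notMem : ∀ k ∈ K, k ≠ 0 := by
      rintro _ (rfl | ⟨s, rfl⟩) <;> simp [code]
    let f : ({k // k ∈ K ∧ k ≠ code (i, false)} × ℕ) ⊕ ({k // k ∈ K ∧ k ≠ code (i, true)} × ℕ)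
        → ℕ := Sum.elim (fun x => cone x.1 x.2) (fun x => cone (code (i, false)) (cone x.1 x.2))
    let g : ({k // k ∈ K ∧ k ≠ code (i, false)} × ℕ) ⊕ ({k // k ∈ K ∧ k ≠ code (i, true)} × ℕ)
        → ℕ := Sum.elim (fun x => cone (code (i, true)) (cone x.1 x.2)) (fun x => cone x.1 x.2)
    obtain ⟨h, hh⟩ := exists_perm_comp_eq f g
      (by
        rintro (⟨⟨k, hk, hk'⟩, x⟩ | ⟨⟨k, hk, hk'⟩, x⟩)
          (⟨⟨l, hl, hl'⟩, y⟩ | ⟨⟨l, hl, hl'⟩, y⟩) hxy <;>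
          simp_all [f, cone_eq_cone]
        exact absurd hxy.1.symm hl')
      (by
        rintro (⟨⟨k, hk, hk'⟩, x⟩ | ⟨⟨k, hk, hk'⟩, x⟩)
          (⟨⟨l, hl, hl'⟩, y⟩ | ⟨⟨l, hl, hl'⟩, y⟩) hxy <;>
          simp_all [g, cone_eq_cone]
        exact absurd hxy.1.symm hl')
      (infinite_compl_of_forall_cone_ne 0 (by
        rintro x ⟨⟨⟨k, hk, hk'⟩, y⟩ | ⟨⟨k, hk, hk'⟩, y⟩, hy⟩
        · exact zero_notMem k hk (cone_eq_cone.mp hy).1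
        · exact absurd (cone_eq_cone.mp hy).1 (by simp [code])))
      (infinite_compl_of_forall_cone_ne 0 (by
        rintro x ⟨⟨⟨k, hk, hk'⟩, y⟩ | ⟨⟨k, hk, hk'⟩, y⟩, hy⟩
        · exact absurd (cone_eq_cone.mp hy).1 (by simp [code])
        · exact zero_notMem k hk (cone_eq_cone.mp hy).1))
    exact ⟨h, fun k hk hk' y => hh (Sum.inl (⟨k, hk, hk'⟩, y)),
      fun k hk hk' y => hh (Sum.inr (⟨k, hk, hk'⟩, y))⟩
  choose a ha ha' using ha
  have hletter : ∀ t : Fin n × Bool, ∀ k ∈ insert 1 (Set.range code), k ≠ code (t.1, !t.2) →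
      ∀ h, letterValue a t * θ k h * (letterValue a t)⁻¹ = θ (code t) (θ k h) := by
    rintro ⟨i, b⟩ k hk hk' h
    simp only [θ]
    rw [viaEmbeddingHom_trans]
    refine conj_viaEmbeddingHom _ _ _ (fun y => ?_) h
    cases b
    · exact (Equiv.Perm.inv_eq_iff_eq).mpr (ha' i k hk hk' y).symm
    · exact ha i k hk hk' y
  have hlift : ∀ t w, FreeGroup.lift (fun i => θ (code t) (q i)) w
      = θ (code t) (FreeGroup.lift q w) := by
    intro t w
    have : FreeGroup.lift (fun i => θ (code t) (q i)) = (θ (code t)).comp (FreeGroup.lift q) := by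
      ext1 i; simp
    exact DFunLike.congr_fun this w
  refine ⟨T, inferInstance, r, r₀, a, fun s i => θ (code s) (q i), θ 1 (Equiv.swap 0 1),
    θ 1 (Equiv.swap 1 2), fun t s i hts => ?_, fun t => ?_, fun s i => ?_, ?_⟩
  · rw [hlift, hr]
    refine hletter t _ (Or.inr ⟨s, rfl⟩) (fun h => hts ?_) _
    rw [code_inj.mp h]
    simp
  · rw [hlift, hr₀]
    exact hletter t 1 (Or.inl rfl) (code_ne_one _).symm _
  · refine commute_viaEmbeddingHom _ _ (Set.disjoint_left.mpr ?_) _ _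
    rintro _ ⟨x, rfl⟩ ⟨y, hy⟩
    exact code_ne_one s (cone_eq_cone.mp hy).1
  · rw [← map_mul, ← map_mul]
    intro h
    have := DFunLike.congr_fun (Equiv.Perm.viaEmbeddingHom_injective _ h) 0
    revert this
    decide

theorem IsSolution.map {G H : Type*} [Group G] [Group H] {n m : ℕ}
    {E N : Finset (FreeGroup (Fin n ⊕ Fin m))} {a : Fin n → G} {b : Fin m → G}
    (h : IsSolution E N a b) (f : G →* H) (hf : Function.Injective f) :
    IsSolution E N (f ∘ a) (f ∘ b) := by
  have hlift : ∀ w, FreeGroup.lift (Sum.elim (f ∘ a) (f ∘ b)) w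
      = f (FreeGroup.lift (Sum.elim a b) w) := by
    intro w
    have : FreeGroup.lift (Sum.elim (f ∘ a) (f ∘ b)) = f.comp (FreeGroup.lift (Sum.elim a b)) := by
      ext1 (i | i) <;> simp
    exact DFunLike.congr_fun this w
  exact ⟨fun w hw => by rw [hlift, h.1 w hw, map_one],
    fun w hw => by rw [hlift, Ne, map_eq_one_iff f hf]; exact h.2 w hw⟩

/-- A system solvable in some group `K` by a tuple `a ≠ 1` has infinitely many solution tuples
in each existentially closed group. -/
theorem IsEC.infinite_setOf_isSolution {G K : Type u} [Group G] [Group K] (hG : IsEC G)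
    {n m : ℕ} {E N : Finset (FreeGroup (Fin n ⊕ Fin m))} {a : Fin n → K} {b : Fin m → K}
    (h : IsSolution E N a b) (ha : a ≠ 1) :
    {a : Fin n → G | ∃ b : Fin m → G, IsSolution E N a b}.Infinite := by
  classical
  intro hfin
  obtain ⟨k, hk⟩ : ∃ k, a k ≠ 1 := Function.ne_iff.mp ha
  let ι : Fin n ⊕ Fin m → G ⊕ Fin (n + m) := fun v => Sum.inr (finSumFinEquiv v)
  let N' : Finset (FreeGroup (G ⊕ Fin (n + m))) := hfin.toFinset.image fun f =>
    FreeGroup.of (Sum.inl (f k)) * (FreeGroup.of (ι (Sum.inl k)))⁻¹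
  have hsol := h.map (MonoidHom.inr G K) (fun x y hxy => (Prod.ext_iff.mp hxy).2)
  obtain ⟨c, hcE, hcN⟩ := hG (G × K) (MonoidHom.inl G K)
    (fun x y hxy => (Prod.ext_iff.mp hxy).1) (n + m)
    (E.image (FreeGroup.map ι)) (N.image (FreeGroup.map ι) ∪ N')
    ⟨fun j => Sum.elim (MonoidHom.inr G K ∘ a) (MonoidHom.inr G K ∘ b) (finSumFinEquiv.symm j),
      by
        intro w hw
        obtain ⟨v, hv, rfl⟩ := Finset.mem_image.mp hw
        rw [← hsol.1 v hv, lift_map]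
        congr 2
        ext1 v
        simp [ι], by
        intro w hw
        obtain hw | hw := Finset.mem_union.mp hw
        · obtain ⟨v, hv, rfl⟩ := Finset.mem_image.mp hw
          convert hsol.2 v hv using 1
          rw [lift_map]
          congr 2
          ext1 v
          simp [ι]
        · obtain ⟨f, -, rfl⟩ := Finset.mem_image.mp hw
          rw [map_mul, map_inv, Ne, mul_inv_eq_one]
          intro hf
          have := congrArg Prod.snd hf
          simp [ι] at this
          exact hk this.symm⟩
  let a' : Fin n → G := fun i => c (finSumFinEquiv (Sum.inl i))
  let b' : Fin m → G := fun i => c (finSumFinEquiv (Sum.inr i))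
  have hab : ∀ w, FreeGroup.lift (Sum.elim id c) (FreeGroup.map ι w)
      = FreeGroup.lift (Sum.elim a' b') w := by
    intro w
    rw [lift_map]
    congr 2
    ext1 (v | v) <;> rfl
  have hmem : a' ∈ hfin.toFinset := hfin.mem_toFinset.mpr ⟨b',
    fun w hw => by rw [← hab]; exact hcE _ (Finset.mem_image_of_mem _ hw),
    fun w hw => by
      rw [← hab]
      exact hcN _ (Finset.mem_union_left _ (Finset.mem_image_of_mem _ hw))⟩
  refine hcN _ (Finset.mem_union_right _ (Finset.mem_image_of_mem _ hmem)) ?_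
  simp [a', ι]

/-- There are `n`, `m`, `ε > 0` and a finite system `Σ(x, y)` of equations and inequations
such that (i) in any group `G`, solvability of `Σ(a, y)` rules out `(a, ε)`-Følner subsets,
and (ii) in any existentially closed group `G`, the set of tuples `a` for which `Σ(a, y)` is
solvable in `G` is infinite. -/
theorem system_with_infinitely_many_witnesses_in_ec :
    ∃ (n m : ℕ) (ε : ℝ) (E N : Finset (FreeGroup (Fin n ⊕ Fin m))),
      0 < ε ∧
      (∀ (G : Type u) [Group G] (a : Fin n → G),
        (∃ b : Fin m → G, IsSolution E N a b) → ∀ H : Finset G, ¬ IsFolnerTuple a ε H) ∧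
      (∀ (G : Type u) [Group G], IsEC G →
        {a : Fin n → G | ∃ b : Fin m → G, IsSolution E N a b}.Infinite) := by
  obtain ⟨I, _, r, r₀, a, p, z, z', h⟩ := exists_pingPongRelations_perm 2
  obtain ⟨m, E, N, hEN⟩ := exists_system_pingPongRelations r r₀
  refine ⟨2, m, 1 / 2, E, N, by norm_num, fun G _ a ha H => ?_, fun G _ hG => ?_⟩
  · obtain ⟨p, z, z', hp⟩ := (hEN a).mp ha
    exact not_isFolnerTuple_of_injective_lift a hp.injective_lift H
  · let f : Equiv.Perm ℕ ≃* ULift.{u} (Equiv.Perm ℕ) := MulEquiv.ulift.symm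
    have hK := h.map f.toMonoidHom f.injective
    obtain ⟨b, hb⟩ := (hEN _).mpr ⟨_, _, _, hK⟩
    refine hG.infinite_setOf_isSolution hb fun h1 => ?_
    have h2 := hK.injective_lift (a₁ := FreeGroup.of 0) (a₂ := 1)
      (by simpa using congrFun h1 0)
    exact FreeGroup.of_ne_one _ h2
end

section
/- Let G be a group, n₀ ∈ ℕ, and ε₀ > 0, and suppose that for every m ∈ ℕ there exists a tuple a ∈ G^{n₀} such that every (a,ε₀)-Følner subset of G has cardinality greater than m. Then for every nonprincipal ultrafilter U on ℕ there exists a tuple ā ∈ (G^U)^{n₀} such that the ultrapower G^U contains no (ā,ε₀)-Følner set. -/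
open Filter

universe u

open scoped Classical in
/-- A map that is injective on `H` and intertwines the left translations by `a i` and `b i`, as far
as these are visible inside `H`, carries Følner sets to Følner sets. -/
theorem IsFolnerTuple.image {G K : Type*} [Group G] [Group K] {n : ℕ} {a : Fin n → G}
    {b : Fin n → K} {ε : ℝ} {H : Finset G} (hH : IsFolnerTuple a ε H) {f : G → K}
    (hf : Set.InjOn f H) (hab : ∀ i, ∀ x ∈ H, a i * x ∈ H → f (a i * x) = b i * f x) :
    IsFolnerTuple b ε (H.image f) := by
  intro i
  have hsub₁ : (H.image f).image (fun h => b i * h) \ H.image f ⊆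
      (H.image (fun h => a i * h) \ H).image (fun z => b i * f ((a i)⁻¹ * z)) := by
    intro z hz
    simp only [Finset.mem_sdiff, Finset.mem_image] at hz ⊢
    obtain ⟨⟨_, ⟨x, hx, rfl⟩, rfl⟩, hz⟩ := hz
    exact ⟨a i * x, ⟨⟨x, hx, rfl⟩, fun h => hz ⟨a i * x, h, hab i x hx h⟩⟩, by simp⟩
  have hsub₂ : H.image f \ (H.image f).image (fun h => b i * h) ⊆
      (H \ H.image (fun h => a i * h)).image f := by
    intro z hz
    simp only [Finset.mem_sdiff, Finset.mem_image] at hz ⊢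
    obtain ⟨⟨y, hy, rfl⟩, hz⟩ := hz
    refine ⟨y, ⟨hy, ?_⟩, rfl⟩
    rintro ⟨x, hx, rfl⟩
    exact hz ⟨f x, ⟨x, hx, rfl⟩, (hab i x hx hy).symm⟩
  have hdisj : Disjoint (H.image (fun h => a i * h) \ H) (H \ H.image (fun h => a i * h)) :=
    disjoint_sdiff_sdiff
  have hcard := (Finset.card_union_le _ _).trans <| add_le_add
    ((Finset.card_le_card hsub₁).trans Finset.card_image_le)
    ((Finset.card_le_card hsub₂).trans Finset.card_image_le)
  rw [← Finset.card_union_of_disjoint hdisj] at hcard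
  rw [Finset.card_image_of_injOn hf]
  exact (Nat.cast_le.mpr hcard).trans_lt (hH i)

/-- Each Følner set for a tuple of germs along an ultrafilter projects, on a large set of indices,
to Følner sets of the same cardinality for the representing tuples. -/
theorem IsFolnerTuple.eventually_exists {α G : Type*} [Group G] {U : Ultrafilter α} {n : ℕ}
    {a : α → Fin n → G} {ε : ℝ} {H : Finset (Filter.Germ (U : Filter α) G)}
    (hH : IsFolnerTuple (fun i => ((fun k => a k i : α → G) : Filter.Germ (U : Filter α) G)) ε H) :
    ∀ᶠ k in (U : Filter α), ∃ F : Finset G, IsFolnerTuple (a k) ε F ∧ F.card = H.card := by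
  classical
  have hrep (x : Filter.Germ (U : Filter α) G) :
      ∃ f : α → G, (f : Filter.Germ (U : Filter α) G) = x :=
    x.inductionOn fun f => ⟨f, rfl⟩
  choose r hr using hrep
  have hinj : ∀ᶠ k in (U : Filter α), ∀ x ∈ H, ∀ y ∈ H, x ≠ y → r x k ≠ r y k := by
    simp only [Filter.eventually_all_finset]
    intro x _ y _
    by_cases hxy : x = y
    · simp [hxy]
    · have : ¬ ∀ᶠ k in (U : Filter α), r x k = r y k := fun he =>
        hxy (by rw [← hr x, ← hr y]; exact Filter.Germ.coe_eq.mpr he)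
      exact (Ultrafilter.eventually_not.mpr this).mono fun k hk _ => hk
  have hmul : ∀ᶠ k in (U : Filter α), ∀ i, ∀ x ∈ H,
      r (((fun k => a k i : α → G) : Filter.Germ (U : Filter α) G) * x) k = a k i * r x k := by
    simp only [Filter.eventually_all_finset, Filter.eventually_all]
    intro i x _
    refine Filter.Germ.coe_eq.mp (?_ : (_ : Filter.Germ (U : Filter α) G) =
      (((fun k => a k i) * r x : α → G) : Filter.Germ (U : Filter α) G))
    rw [hr, Filter.Germ.coe_mul, hr]
  filter_upwards [hinj, hmul] with k hk hk'
  have hinjOn : Set.InjOn (fun x => r x k) H := fun x hx y hy hxy =>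
    by_contra fun hne => hk x hx y hy hne hxy
  exact ⟨H.image fun x => r x k, hH.image hinjOn fun i x hx _ => hk' i x hx,
    Finset.card_image_of_injOn hinjOn⟩

/-- If for every `m` there is a tuple `a ∈ G^{n₀}` all of whose `(a, ε₀)`-Følner sets have
cardinality greater than `m`, then for every nonprincipal ultrafilter `U` on `ℕ` there is a
tuple in the ultrapower `G^U` admitting no `(·, ε₀)`-Følner set at all. -/
theorem ultrapower_kills_folner {G : Type u} [Group G] (n₀ : ℕ) (ε₀ : ℝ) (hε : 0 < ε₀)
    (h : ∀ m : ℕ, ∃ a : Fin n₀ → G, ∀ H : Finset G, IsFolnerTuple a ε₀ H → m < H.card)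
    (U : Ultrafilter ℕ) (hU : ∀ s : Set ℕ, s.Finite → s ∉ U) :
    ∃ abar : Fin n₀ → Filter.Germ (U : Filter ℕ) G,
      ∀ H : Finset (Filter.Germ (U : Filter ℕ) G), ¬ IsFolnerTuple abar ε₀ H := by
  choose a ha using h
  refine ⟨fun i => ((fun k => a k i : ℕ → G) : Filter.Germ (U : Filter ℕ) G), fun H hH => ?_⟩
  have hlarge : ∀ᶠ k in (U : Filter ℕ), ¬ k < H.card :=
    Ultrafilter.eventually_not.mpr (hU _ (Set.finite_lt_nat H.card))
  obtain ⟨k, ⟨F, hF, hcard⟩, hk⟩ := (hH.eventually_exists.and hlarge).exists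
  exact hk (hcard ▸ ha k F hF)
end

section
/- There exist a group G, natural numbers n, a real number ε > 0, an ultrafilter U on ℕ, and a tuple ā ∈ (G^U)ⁿ such that: for every tuple a ∈ Gⁿ there is an (a,ε)-Følner subset of G, yet there is no (ā,ε)-Følner subset of the ultrapower G^U. (Consequently, for such n and ε, the existence of (a,ε)-Følner sets cannot be expressed by a first-order formula uniformly in all groups.) -/
open Filter

universe u

/-- Auxiliary predicate: every `a ∈ Gⁿ` admits an `(a, ε)`-Følner subset of `G`, yet the
tuple `abar` in the ultrapower `G^U` admits no `(abar, ε)`-Følner set. -/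
def FolnerNotFirstOrderWitness (G : Type) [Group G] (n : ℕ) (ε : ℝ) (U : Ultrafilter ℕ) : Prop :=
  ∃ abar : Fin n → Filter.Germ (U : Filter ℕ) G,
    (∀ a : Fin n → G, ∃ H : Finset G, IsFolnerTuple a ε H) ∧
    (∀ H : Finset (Filter.Germ (U : Filter ℕ) G), ¬ IsFolnerTuple abar ε H)

/-- A free left action by an injective homomorphism `f` admits an equivariant map to its domain. -/
lemma exists_equivariant_of_injective {F Γ : Type*} [Group F] [Group Γ] (f : F →* Γ)
    (hf : Function.Injective f) : ∃ p : Γ → F, ∀ w x, p (f w * x) = w * p x := by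
  have hr : ∀ x : Γ, ∃ w : F,
      f w * (Quotient.out (Quotient.mk (QuotientGroup.rightRel f.range) x)) = x := by
    intro x
    have h := Quotient.mk_out (s := QuotientGroup.rightRel f.range) x
    obtain ⟨w, hw⟩ := QuotientGroup.rightRel_apply.mp h
    exact ⟨w, by rw [hw]; group⟩
  choose p hp using hr
  refine ⟨p, fun w x => hf ?_⟩
  have hq : Quotient.mk (QuotientGroup.rightRel f.range) (f w * x) =
      Quotient.mk (QuotientGroup.rightRel f.range) x := by
    refine Quotient.sound (QuotientGroup.rightRel_apply.mpr ⟨w⁻¹, ?_⟩)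
    simp
  have h := hp (f w * x)
  rw [hq] at h
  rw [map_mul]
  refine mul_right_cancel (h.trans ?_)
  rw [mul_assoc, hp x]

open scoped Classical in
/-- The images of free generators under an injective homomorphism admit no Følner set. -/
lemma not_isFolnerTuple_of_injective {Γ : Type*} [Group Γ] (f : FreeGroup (Fin 2) →* Γ)
    (hf : Function.Injective f) (H : Finset Γ) :
    ¬ IsFolnerTuple (fun i => f (FreeGroup.of i)) (1 / 2) H := by
  intro hH
  obtain ⟨p, hp⟩ := exists_equivariant_of_injective f hf
  let A : Fin 2 × Bool → Finset Γ := fun l => {x ∈ H | p x ∈ FreeGroup.startsWith l}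
  have hdisj : ∀ l m, l ≠ m → Disjoint (A l) (A m) := fun l m hlm =>
    Finset.disjoint_filter.mpr fun x _ hl hm =>
      Set.disjoint_left.mp (FreeGroup.startsWith.disjoint_iff_ne.mpr hlm) hl hm
  have hletter : ∀ i : Fin 2, H.card ≤ (A (i, true)).card + (A (i, false)).card +
      (H \ H.image (fun h => f (FreeGroup.of i) * h)).card := by
    intro i
    have hsub : H ⊆ A (i, true) ∪ (A (i, false)).image (fun h => f (FreeGroup.of i) * h) ∪
        (H \ H.image (fun h => f (FreeGroup.of i) * h)) := by
      intro x hx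
      by_cases h₁ : p x ∈ FreeGroup.startsWith (i, true)
      · simp [A, hx, h₁]
      by_cases h₂ : x ∈ H.image (fun h => f (FreeGroup.of i) * h)
      · obtain ⟨y, hy, rfl⟩ := Finset.mem_image.mp h₂
        have hs := FreeGroup.startsWith_mk_mul (w := (i, false)) _ h₁
        have he : FreeGroup.mk [(i, false)] = (FreeGroup.of i)⁻¹ := rfl
        rw [hp, he, inv_mul_cancel_left] at hs
        refine Finset.mem_union_left _ (Finset.mem_union_right _ (Finset.mem_image_of_mem _ ?_))
        exact Finset.mem_filter.mpr ⟨hy, hs⟩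
      · exact Finset.mem_union_right _ (Finset.mem_sdiff.mpr ⟨hx, h₂⟩)
    refine (Finset.card_le_card hsub).trans ((Finset.card_union_le _ _).trans ?_)
    gcongr
    exact (Finset.card_union_le _ _).trans (Nat.add_le_add_left Finset.card_image_le _)
  have hfour : ∑ l, (A l).card ≤ H.card := by
    rw [← Finset.card_biUnion (fun l _ m _ h => hdisj l m h)]
    exact Finset.card_le_card (Finset.biUnion_subset.mpr fun l _ => Finset.filter_subset _ _)
  have hsmall : ∀ i : Fin 2,
      ((H \ H.image (fun h => f (FreeGroup.of i) * h)).card : ℝ) < 1 / 2 * H.card := fun i =>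
    lt_of_le_of_lt (Nat.cast_le.mpr (Finset.card_le_card Finset.subset_union_right)) (hH i)
  simp only [Fintype.sum_prod_type, Fin.sum_univ_two, Fintype.sum_bool] at hfour
  have h₀ := hletter 0
  have h₁ := hletter 1
  have s₀ := hsmall 0
  have s₁ := hsmall 1
  rify at hfour h₀ h₁
  linarith

open scoped Classical in
/-- A nonempty finite set invariant under left multiplication by the tuple is a Følner set. -/
lemma isFolnerTuple_of_mul_mem {G : Type*} [Group G] {n : ℕ} {a : Fin n → G} {ε : ℝ}
    (hε : 0 < ε) {H : Finset G} (hne : H.Nonempty) (h : ∀ i, ∀ g ∈ H, a i * g ∈ H) :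
    IsFolnerTuple a ε H := by
  intro i
  have himage : H.image (fun g => a i * g) = H :=
    Finset.eq_of_subset_of_card_le (Finset.image_subset_iff.mpr (h i))
      (Finset.card_image_of_injective _ (mul_right_injective (a i))).ge
  have hcard : (0 : ℝ) < H.card := mod_cast hne.card_pos
  rw [himage]
  simpa using mul_pos hε hcard

/-- The group of finitely supported permutations of `X`. -/
abbrev FinitaryPerm (X : Type*) [DecidableEq X] : Type _ :=
  Subgroup.closure {σ : Equiv.Perm X | σ.IsSwap}

/-- Every finite tuple of finitely supported permutations admits a Følner set. -/
lemma exists_isFolnerTuple_finitaryPerm {X : Type*} [DecidableEq X] {n : ℕ}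
    (a : Fin n → FinitaryPerm X) {ε : ℝ} (hε : 0 < ε) :
    ∃ H : Finset (FinitaryPerm X), IsFolnerTuple a ε H := by
  classical
  let S : Set X := ⋃ i, (MulAction.fixedBy X (a i : Equiv.Perm X))ᶜ
  have hS : S.Finite := Set.finite_iUnion fun i => mem_closure_isSwap'.mp (a i).2
  have : Finite S := hS
  let T : Set (FinitaryPerm X) := {g | ∀ x ∉ S, (g : Equiv.Perm X) x = x}
  have hmaps : ∀ g ∈ T, ∀ x ∈ S, (g : Equiv.Perm X) x ∈ S := by
    intro g hg x hx
    by_contra h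
    have := (g : Equiv.Perm X).injective (hg _ h)
    exact h (by rwa [this])
  have hT : T.Finite := by
    have : Function.Injective (fun (g : T) (x : S) => (⟨_, hmaps g.1 g.2 x.1 x.2⟩ : S)) := by
      intro g h hgh
      apply Subtype.ext
      apply Subtype.ext
      ext x
      by_cases hx : x ∈ S
      · exact congrArg Subtype.val (congrFun hgh ⟨x, hx⟩)
      · rw [g.2 x hx, h.2 x hx]
    exact Finite.of_injective _ this
  have ha : ∀ i, ∀ x ∉ S, (a i : Equiv.Perm X) x = x := by
    intro i x hx
    by_contra h
    exact hx (Set.mem_iUnion.mpr ⟨i, h⟩)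
  refine ⟨hT.toFinset, isFolnerTuple_of_mul_mem hε ⟨1, ?_⟩ fun i h hh => ?_⟩
  · rw [Set.Finite.mem_toFinset]
    exact fun x _ => rfl
  rw [Set.Finite.mem_toFinset] at hh ⊢
  intro x hx
  change (a i : Equiv.Perm X) ((h : Equiv.Perm X) x) = x
  rw [hh x hx, ha i x hx]

/-- On a finite set, a permutation agrees with a finitely supported one wherever both the point
and its image lie in the set. -/
lemma exists_finitaryPerm_eq {X : Type*} [DecidableEq X] (e : Equiv.Perm X) {S : Set X}
    (hS : S.Finite) :
    ∃ σ : FinitaryPerm X, ∀ x ∈ S, e x ∈ S → (σ : Equiv.Perm X) x = e x := by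
  classical
  have := hS.fintype
  let d : {x : S // e x ∈ S} ≃ {y : S // e.symm y ∈ S} :=
    { toFun := fun x => ⟨⟨e x, x.2⟩, by simp⟩
      invFun := fun y => ⟨⟨e.symm y, y.2⟩, by simp⟩
      left_inv := fun x => by simp
      right_inv := fun y => by simp }
  refine ⟨⟨Equiv.Perm.ofSubtype d.extendSubtype, ?_⟩, fun x hx hex => ?_⟩
  · rw [mem_closure_isSwap']
    refine hS.subset fun x hx => ?_
    by_contra h
    exact hx (Equiv.Perm.ofSubtype_apply_of_not_mem _ h)
  · change Equiv.Perm.ofSubtype d.extendSubtype x = e x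
    rw [Equiv.Perm.ofSubtype_apply_of_mem _ hx,
      d.extendSubtype_apply_of_mem ⟨x, hx⟩ hex]
    rfl

/-- The free group on two generators embeds in a nonprincipal ultrapower of the group of its
finitely supported permutations. -/
lemma exists_injective_freeGroup_germ :
    ∃ f : FreeGroup (Fin 2) →*
      Germ (hyperfilter ℕ : Filter ℕ) (FinitaryPerm (FreeGroup (Fin 2))),
      Function.Injective f := by
  obtain ⟨c, hc⟩ := Countable.exists_injective_nat (FreeGroup (Fin 2))
  have hfin : ∀ k : ℕ, (c ⁻¹' Set.Iio k).Finite := fun k =>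
    (Set.finite_Iio k).preimage hc.injOn
  choose σ hσ using fun (i : Fin 2) (k : ℕ) =>
    exists_finitaryPerm_eq (Equiv.mulLeft (FreeGroup.of i)) (hfin k)
  let φ : FreeGroup (Fin 2) →* (ℕ → FinitaryPerm (FreeGroup (Fin 2))) := FreeGroup.lift σ
  have hφ : ∀ w x, ∀ᶠ k in atTop, (φ w k : Equiv.Perm (FreeGroup (Fin 2))) x = w * x := by
    intro w
    induction w using FreeGroup.induction_on with
    | C1 => simp
    | of i =>
      intro x
      filter_upwards [eventually_gt_atTop (c x), eventually_gt_atTop (c (FreeGroup.of i * x))]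
        with k h₁ h₂
      simpa [φ] using hσ i k x h₁ h₂
    | inv_of i ih =>
      intro x
      filter_upwards [ih ((FreeGroup.of i)⁻¹ * x)] with k hk
      rw [mul_inv_cancel_left] at hk
      rw [map_inv, Pi.inv_apply, Subgroup.coe_inv, Equiv.Perm.inv_eq_iff_eq]
      exact hk.symm
    | mul v w hv hw =>
      intro x
      filter_upwards [hv (w * x), hw x] with k h₁ h₂
      rw [map_mul, Pi.mul_apply, Subgroup.coe_mul, Equiv.Perm.mul_apply, h₂, h₁, mul_assoc]
  refine ⟨(Germ.coeMulHom _).comp φ, (injective_iff_map_eq_one _).mpr fun w hw => ?_⟩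
  have h₁ : ∀ᶠ k in (hyperfilter ℕ : Filter ℕ), φ w k = 1 := Germ.coe_eq.mp hw
  have h₂ := (hφ w 1).filter_mono (Nat.hyperfilter_le_atTop)
  obtain ⟨k, hk₁, hk₂⟩ := (h₁.and h₂).exists
  simpa [hk₁] using hk₂.symm

/-- There are a group `G`, `n ∈ ℕ`, `ε > 0`, an ultrafilter `U` on `ℕ` and a tuple `abar` in
the ultrapower `G^U` such that every `a ∈ Gⁿ` admits an `(a, ε)`-Følner subset of `G`, but
`G^U` has no `(abar, ε)`-Følner set. -/
theorem folner_existence_not_first_order :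
    ∃ (G : Type) (instG : Group G) (n : ℕ) (ε : ℝ) (U : Ultrafilter ℕ),
      0 < ε ∧ @FolnerNotFirstOrderWitness G instG n ε U := by
  obtain ⟨f, hf⟩ := exists_injective_freeGroup_germ
  exact ⟨FinitaryPerm (FreeGroup (Fin 2)), inferInstance, 2, 1 / 2, hyperfilter ℕ, by norm_num,
    fun i => f (FreeGroup.of i), fun a => exists_isFolnerTuple_finitaryPerm a (by norm_num),
    fun H => not_isFolnerTuple_of_injective f hf H⟩
end

section
/- The group S_∞ of finitary permutations of ℕ (the subgroup of all permutations of ℕ that move only finitely many points) is amenable but not uniformly amenable: for every finite subset F of S_∞ and every ε > 0 there is an (F,ε)-Følner subset of S_∞, but there is no function Φ : ℕ → (0,1) → ℕ such that for every finite subset F of S_∞ and every ε ∈ (0,1) there is an (F,ε)-Følner subset of S_∞ of cardinality at most Φ(|F|)(ε). -/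
open Filter

universe u

open scoped Classical in
/-- `H` is an `(F, ε)`-Følner subset of `G`: for each `g ∈ F`, `|g • H △ H| < ε * |H|`. -/
def IsFolnerSet {G : Type*} [Group G] (F : Finset G) (ε : ℝ) (H : Finset G) : Prop :=
  ∀ g ∈ F,
    ((((H.image (fun h => g * h)) \ H) ∪ (H \ (H.image (fun h => g * h)))).card : ℝ)
      < ε * H.card

/-- The group `S_∞` of finitary permutations of `ℕ`: permutations moving only finitely many
points. -/
def finitaryPerms : Subgroup (Equiv.Perm ℕ) where
  carrier := {σ | {x : ℕ | σ x ≠ x}.Finite}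
  one_mem' := by simp
  mul_mem' := by
    intro a b ha hb
    refine Set.Finite.subset (ha.union hb) ?_
    intro x hx
    by_contra h
    simp only [Set.mem_union, Set.mem_setOf_eq, not_or, not_not] at h
    exact hx (by simp only [Equiv.Perm.mul_apply, h.2, h.1])
  inv_mem' := by
    intro a ha
    have h : {x : ℕ | a⁻¹ x ≠ x} = {x : ℕ | a x ≠ x} := by
      ext x
      simp only [Set.mem_setOf_eq, ne_eq, Equiv.Perm.inv_eq_iff_eq]
      exact ⟨fun h h' => h h'.symm, fun h h' => h h'.symm⟩
    show Set.Finite {x : ℕ | a⁻¹ x ≠ x}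
    rw [h]
    exact ha

/-- The involution of lists that exchanges `v` and `i :: v` whenever `v` has length less than `L`
and does not start with `i`, and fixes all other lists. -/
def headFlip {α : Type*} [DecidableEq α] (L : ℕ) (i : α) (w : List α) : List α :=
  if w.head? = some i then
    if w.tail.head? ≠ some i ∧ w.tail.length < L then w.tail else w
  else if w.length < L then i :: w else w

theorem headFlip_involutive {α : Type*} [DecidableEq α] (L : ℕ) (i : α) :
    Function.Involutive (headFlip L i) := by
  intro w
  by_cases h : w.head? = some i
  · by_cases h' : w.tail.head? ≠ some i ∧ w.tail.length < L
    · rw [show headFlip L i w = w.tail by rw [headFlip, if_pos h, if_pos h'], headFlip,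
        if_neg h'.1, if_pos h'.2]
      exact List.cons_head?_tail h
    · have : headFlip L i w = w := by rw [headFlip, if_pos h, if_neg h']
      rw [this, this]
  · by_cases h' : w.length < L
    · rw [show headFlip L i w = i :: w by rw [headFlip, if_neg h, if_pos h'], headFlip,
        if_pos List.head?_cons, if_pos ⟨h, h'⟩, List.tail_cons]
    · have : headFlip L i w = w := by rw [headFlip, if_neg h, if_neg h']
      rw [this, this]

theorem length_le_of_headFlip_ne {α : Type*} [DecidableEq α] {L : ℕ} {i : α} {w : List α}
    (h : headFlip L i w ≠ w) : w.length ≤ L := by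
  unfold headFlip at h
  split_ifs at h with h₁ h₂ h₃
  · have := h₂.2
    rw [List.length_tail] at this
    omega
  · exact absurd rfl h
  · exact h₃.le
  · exact absurd rfl h

theorem prod_headFlip_apply_nil {α : Type*} [DecidableEq α] {L : ℕ} {w : List α}
    (hw : w.IsChain (· ≠ ·)) (hL : w.length ≤ L) :
    (w.map fun i => (headFlip_involutive L i).toPerm).prod [] = w := by
  induction w with
  | nil => simp
  | cons i w ih =>
    rw [List.length_cons] at hL
    rw [List.map_cons, List.prod_cons, Equiv.Perm.mul_apply, ih hw.tail (by omega)]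
    have hi : w.head? ≠ some i := by
      intro h
      rw [List.isChain_cons] at hw
      exact hw.1 i h rfl
    change headFlip L i w = _
    rw [headFlip, if_neg hi, if_pos (by omega)]

/-- There are three involutions in `S_∞` satisfying no nontrivial relation of length at
most `L` other than the consequences of being involutions. -/
theorem exists_finitaryPerms_involutions (L : ℕ) :
    ∃ s : Fin 3 → finitaryPerms, (∀ i, s i * s i = 1) ∧
      ∀ w : List (Fin 3), w ≠ [] → w.IsChain (· ≠ ·) → w.length ≤ L →
        (w.map s).prod ≠ 1 := by
  obtain ⟨e⟩ : Nonempty (List (Fin 3) ≃ ℕ) := nonempty_equiv_of_countable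
  let t : Fin 3 → Equiv.Perm (List (Fin 3)) := fun i => (headFlip_involutive L i).toPerm
  have ht : ∀ i, e.permCongrHom (t i) ∈ finitaryPerms := by
    intro i
    refine ((List.finite_length_le (Fin 3) L).image e).subset ?_
    intro x hx
    refine ⟨e.symm x, length_le_of_headFlip_ne (i := i) ?_, e.apply_symm_apply x⟩
    intro h
    refine hx ?_
    change e (headFlip L i (e.symm x)) = x
    rw [h, e.apply_symm_apply]
  refine ⟨fun i => ⟨_, ht i⟩, fun i => ?_, fun w hne hw hL h => hne ?_⟩
  · apply Subtype.ext
    change e.permCongrHom (t i) * e.permCongrHom (t i) = 1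
    rw [← map_mul, map_eq_one_iff _ e.permCongrHom.injective]
    ext1 w
    exact headFlip_involutive L i w
  · have h' := congrArg finitaryPerms.subtype h
    rw [map_list_prod, List.map_map, map_one] at h'
    have h'' : e.permCongrHom (w.map t).prod = 1 := by
      rw [map_list_prod, List.map_map]
      exact h'
    rw [map_eq_one_iff _ e.permCongrHom.injective] at h''
    have := prod_headFlip_apply_nil hw hL
    rw [← this]
    exact congrArg (fun σ : Equiv.Perm (List (Fin 3)) => σ []) h''

open scoped Classical in
/-- If every element of `H` has two neighbours in `H`, then there are arbitrarily long
nonbacktracking walks in `H`. -/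
theorem exists_isChain_suffix_mem {G ι : Type*} [Group G] [Fintype ι] (s : ι → G) {H : Finset G}
    (hne : H.Nonempty)
    (hdeg : ∀ h ∈ H, 2 ≤ (Finset.univ.filter fun i => s i * h ∈ H).card) (n : ℕ) :
    ∃ w : List ι, ∃ h : G, w.length = n ∧ w.IsChain (· ≠ ·) ∧
      ∀ k, ((w.drop k).map s).prod * h ∈ H := by
  induction n with
  | zero =>
    obtain ⟨h, hh⟩ := hne
    exact ⟨[], h, rfl, by simp, by simpa using hh⟩
  | succ n ih =>
    obtain ⟨w, h, hlen, hw, hmem⟩ := ih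
    have h2 := hdeg _ (hmem 0)
    rw [List.drop_zero] at h2
    obtain ⟨i, hi, hiw⟩ : ∃ i, s i * ((w.map s).prod * h) ∈ H ∧ ∀ j ∈ w.head?, i ≠ j := by
      obtain ⟨a, ha, b, hb, hab⟩ := Finset.one_lt_card.mp h2
      rw [Finset.mem_filter] at ha hb
      by_cases haw : ∀ j ∈ w.head?, a ≠ j
      · exact ⟨a, ha.2, haw⟩
      · push Not at haw
        obtain ⟨j, hj, rfl⟩ := haw
        refine ⟨b, hb.2, fun k hk hbk => hab ?_⟩
        rw [hbk]
        exact Option.mem_unique hj hk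
    refine ⟨i :: w, h, by simp [hlen], List.isChain_cons.mpr ⟨hiw, hw⟩, fun k => ?_⟩
    cases k with
    | zero => simpa [mul_assoc] using hi
    | succ k => simpa using hmem k

open scoped Classical in
theorem exists_degree_le_one {G ι : Type*} [Group G] [Fintype ι] (s : ι → G) {L : ℕ}
    (hs : ∀ w : List ι, w ≠ [] → w.IsChain (· ≠ ·) → w.length ≤ L → (w.map s).prod ≠ 1)
    {H : Finset G} (hne : H.Nonempty) (hL : H.card ≤ L) :
    ∃ h ∈ H, (Finset.univ.filter fun i => s i * h ∈ H).card ≤ 1 := by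
  by_contra! hcon
  obtain ⟨w, h, hlen, hw, hmem⟩ := exists_isChain_suffix_mem s hne hcon H.card
  obtain ⟨p, hp, q, hq, hpq, heq⟩ := Finset.exists_ne_map_eq_of_card_lt_of_maps_to
    (s := Finset.range (H.card + 1)) (t := H) (by simp) fun k _ => hmem k
  wlog hlt : p < q generalizing p q
  · exact this q hq p hp hpq.symm heq.symm (by omega)
  rw [Finset.mem_range] at hp hq
  refine hs ((w.drop p).take (q - p)) ?_ ?_ ?_ ?_
  · intro h0
    have := congrArg List.length h0
    simp at this
    omega
  · exact (hw.drop p).take _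
  · simp
    omega
  · have h1 := mul_right_cancel heq
    have h2 : w.drop p = (w.drop p).take (q - p) ++ w.drop q := by
      conv_lhs => rw [← List.take_append_drop (q - p) (w.drop p)]
      rw [List.drop_drop, Nat.add_sub_cancel' hlt.le]
    rw [h2, List.map_append, List.prod_append] at h1
    exact mul_eq_right.mp h1

open scoped Classical in
/-- In a Cayley graph of involutions without short relations, small sets span forests. -/
theorem sum_card_filter_mul_mem_le {G ι : Type*} [Group G] [Fintype ι] (s : ι → G) {L : ℕ}
    (hinv : ∀ i, s i * s i = 1)
    (hs : ∀ w : List ι, w ≠ [] → w.IsChain (· ≠ ·) → w.length ≤ L → (w.map s).prod ≠ 1)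
    (H : Finset G) (hL : H.card ≤ L) :
    ∑ i, (H.filter fun x => s i * x ∈ H).card ≤ 2 * H.card := by
  induction hn : H.card generalizing H with
  | zero => simp [Finset.card_eq_zero.mp hn]
  | succ n ih =>
    obtain ⟨h, hh, hdeg⟩ := exists_degree_le_one s hs (Finset.card_pos.mp (by omega)) hL
    have hcard : (H.erase h).card = n := by rw [Finset.card_erase_of_mem hh, hn]; rfl
    have key : ∀ i, (H.filter fun x => s i * x ∈ H).card ≤
        ((H.erase h).filter fun x => s i * x ∈ H.erase h).card
          + 2 * (if s i * h ∈ H then 1 else 0) := by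
      intro i
      have hsub : (H.filter fun x => s i * x ∈ H) ⊆
          ((H.erase h).filter fun x => s i * x ∈ H.erase h) ∪
            (if s i * h ∈ H then {h, s i * h} else ∅) := by
        intro x hx
        rw [Finset.mem_filter] at hx
        have hback : s i * (s i * x) = x := by rw [← mul_assoc, hinv, one_mul]
        by_cases h1 : x = h
        · subst h1
          simp [hx.2]
        · by_cases h2 : s i * x = h
          · rw [h2] at hback
            simp [hback, hx.1]
          · simp [h1, h2, hx.1, hx.2]
      refine (Finset.card_le_card hsub).trans ((Finset.card_union_le _ _).trans ?_)
      gcongr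
      split_ifs
      · exact Finset.card_le_two
      · simp
    calc ∑ i, (H.filter fun x => s i * x ∈ H).card
        ≤ ∑ i, (((H.erase h).filter fun x => s i * x ∈ H.erase h).card
          + 2 * (if s i * h ∈ H then 1 else 0)) := Finset.sum_le_sum fun i _ => key i
      _ = ∑ i, ((H.erase h).filter fun x => s i * x ∈ H.erase h).card
          + 2 * (Finset.univ.filter fun i => s i * h ∈ H).card := by
        rw [Finset.sum_add_distrib, ← Finset.mul_sum, Finset.card_filter]
      _ ≤ 2 * n + 2 * 1 := by
        gcongr
        exact ih _ (by omega) hcard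
      _ = 2 * (n + 1) := by ring

open scoped Classical in
theorem IsFolnerSet.lt_card_filter {G : Type*} [Group G] {F : Finset G} {ε : ℝ} {H : Finset G}
    (hH : IsFolnerSet F ε H) {g : G} (hg : g ∈ F) :
    (1 - ε) * H.card < ((H.filter fun x => g * x ∈ H).card : ℝ) := by
  have h1 := hH g hg
  have h2 : (H.filter fun x => ¬ g * x ∈ H).card ≤
      (((H.image (fun h => g * h)) \ H) ∪ (H \ (H.image (fun h => g * h)))).card := by
    rw [← Finset.card_image_of_injective _ (mul_right_injective g)]
    refine Finset.card_le_card fun y hy => ?_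
    obtain ⟨x, hx, rfl⟩ := Finset.mem_image.mp hy
    rw [Finset.mem_filter] at hx
    exact Finset.mem_union_left _
      (Finset.mem_sdiff.mpr ⟨Finset.mem_image_of_mem _ hx.1, hx.2⟩)
  have h3 : ((H.filter fun x => g * x ∈ H).card : ℝ) + (H.filter fun x => ¬ g * x ∈ H).card
      = H.card := by
    exact_mod_cast Finset.card_filter_add_card_filter_not (s := H) fun x => g * x ∈ H
  have h4 : ((H.filter fun x => ¬ g * x ∈ H).card : ℝ) ≤ _ := Nat.cast_le.mpr h2
  linarith

theorem IsFolnerSet.lt_card_of_involutions {G : Type*} [Group G] {F : Finset G} {H : Finset G}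
    (hH : IsFolnerSet F (1 / 4) H) {s : Fin 3 → G} {L : ℕ} (hF : ∀ i, s i ∈ F)
    (hinv : ∀ i, s i * s i = 1)
    (hs : ∀ w : List (Fin 3), w ≠ [] → w.IsChain (· ≠ ·) → w.length ≤ L →
      (w.map s).prod ≠ 1) :
    L < H.card := by
  classical
  by_contra! hcard
  have hle := sum_card_filter_mul_mem_le s hinv hs H hcard
  rw [Fin.sum_univ_three, ← Nat.cast_le (α := ℝ)] at hle
  push_cast at hle
  have hnonneg : (0 : ℝ) ≤ H.card := Nat.cast_nonneg _
  linarith [hH.lt_card_filter (hF 0), hH.lt_card_filter (hF 1), hH.lt_card_filter (hF 2)]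

open scoped Classical in
theorem isFolnerSet_of_mul_mem {G : Type*} [Group G] {F : Finset G} {ε : ℝ} {H : Finset G}
    (hε : 0 < ε) (hne : H.Nonempty) (hmul : ∀ g ∈ F, ∀ h ∈ H, g * h ∈ H) :
    IsFolnerSet F ε H := by
  intro g hg
  have himage : H.image (fun h => g * h) = H :=
    Finset.eq_of_subset_of_card_le (Finset.image_subset_iff.mpr (hmul g hg))
      (Finset.card_image_of_injective _ (mul_right_injective g)).ge
  have hpos : 0 < H.card := Finset.card_pos.mpr hne
  rw [himage, Finset.sdiff_self, Finset.union_empty, Finset.card_empty, Nat.cast_zero]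
  positivity

/-- The finitary permutations fixing every point outside a finite set form a finite set. -/
theorem finite_finitaryPerms_support_subset {K : Set ℕ} (hK : K.Finite) :
    {σ : finitaryPerms | ∀ x ∉ K, (σ : Equiv.Perm ℕ) x = x}.Finite := by
  classical
  have : Finite K := hK
  have hfin : (Set.range (Equiv.Perm.ofSubtype : Equiv.Perm K →* Equiv.Perm ℕ)).Finite :=
    Set.finite_range _
  refine (hfin.preimage (f := ((↑) : finitaryPerms → Equiv.Perm ℕ))
    Subtype.val_injective.injOn).subset ?_
  intro σ hσ
  have hmem : ∀ x, (σ : Equiv.Perm ℕ) x ∈ K ↔ x ∈ K := by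
    intro x
    refine ⟨fun h => ?_, fun h => ?_⟩
    · by_contra hx
      exact hx (hσ x hx ▸ h)
    · by_contra hx
      have hfix := (σ : Equiv.Perm ℕ).injective (hσ _ hx)
      exact hx (hfix.symm ▸ h)
  exact ⟨(σ : Equiv.Perm ℕ).subtypePerm hmem, Equiv.Perm.ofSubtype_subtypePerm hmem fun x hx => by
    by_contra h
    exact hx (hσ x h)⟩

theorem finitaryPerms_exists_isFolnerSet (F : Finset finitaryPerms) {ε : ℝ} (hε : 0 < ε) :
    ∃ H : Finset finitaryPerms, IsFolnerSet F ε H := by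
  classical
  let K : Set ℕ := ⋃ σ ∈ F, {x | (σ : Equiv.Perm ℕ) x ≠ x}
  have hK : K.Finite := F.finite_toSet.biUnion fun σ _ => σ.2
  let H := (finite_finitaryPerms_support_subset hK).toFinset
  have hmem : ∀ τ, τ ∈ H ↔ ∀ x ∉ K, (τ : Equiv.Perm ℕ) x = x := fun τ => by simp [H]
  refine ⟨H, isFolnerSet_of_mul_mem hε ⟨1, (hmem 1).mpr fun x _ => rfl⟩ fun g hg τ hτ => ?_⟩
  have hgK : ∀ x ∉ K, (g : Equiv.Perm ℕ) x = x := by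
    intro x hx
    by_contra h
    exact hx (Set.mem_biUnion hg h)
  rw [hmem] at hτ ⊢
  intro x hx
  rw [Subgroup.coe_mul, Equiv.Perm.mul_apply, hτ x hx, hgK x hx]

/-- `S_∞` is amenable but not uniformly amenable: every `(F, ε)` admits a Følner set, but
there is no function `Φ : ℕ → (0,1) → ℕ` bounding the size of some `(F, ε)`-Følner set in
terms of `|F|` and `ε`. -/
theorem SInf_amenable_not_uniformly_amenable :
    (∀ (F : Finset finitaryPerms) (ε : ℝ), 0 < ε →
      ∃ H : Finset finitaryPerms, IsFolnerSet F ε H) ∧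
    ¬ ∃ Φ : ℕ → Set.Ioo (0 : ℝ) 1 → ℕ,
        ∀ (F : Finset finitaryPerms) (ε : Set.Ioo (0 : ℝ) 1),
          ∃ H : Finset finitaryPerms, IsFolnerSet F (ε : ℝ) H ∧ H.card ≤ Φ F.card ε := by
  classical
  refine ⟨fun F ε hε => finitaryPerms_exists_isFolnerSet F hε, ?_⟩
  rintro ⟨Φ, hΦ⟩
  let ε : Set.Ioo (0 : ℝ) 1 := ⟨1 / 4, by norm_num, by norm_num⟩
  obtain ⟨s, hinv, hs⟩ := exists_finitaryPerms_involutions (Φ 3 ε + 2)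
  have hinj : Function.Injective s := by
    intro i j hij
    by_contra hne
    refine hs [i, j] (by simp) (by simpa using hne) (by simp) ?_
    simpa [← hij] using hinv i
  obtain ⟨H, hH, hcard⟩ := hΦ (Finset.univ.image s) ε
  rw [Finset.card_image_of_injective _ hinj, Finset.card_univ, Fintype.card_fin] at hcard
  exact absurd (hH.lt_card_of_involutions (s := s) (by simp) hinv hs) (by omega)
end

section
/- Every finitely generated group with solvable word problem embeds into every existentially closed group: if S is a group for which there exist k ∈ ℕ and a surjective group homomorphism π from the free group on k generators onto S such that the set {w : π(w) = 1} is a computable subset of the free group on k generators, and G is an existentially closed group, then there is an injective group homomorphism from S into G. -/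
open Filter

universe u

/-- `S` is a finitely generated group with solvable word problem: there is a surjection
`π : F_k → S` from a free group on `k` generators such that `{w : π w = 1}` is a computable
(decidable) subset of `F_k`, where elements of `F_k` are presented by words, i.e. lists of
generators and their inverses. -/
def HasSolvableWordProblem (S : Type*) [Group S] : Prop :=
  ∃ (k : ℕ) (π : FreeGroup (Fin k) →* S), Function.Surjective π ∧
    ComputablePred (fun l : List (Fin k × Bool) => π (FreeGroup.mk l) = 1)

theorem exists_extension_conj {D : Type*} {K : Type u} [Group D] [Group K] (j₁ j₂ : D →* K)
    (h₁ : Function.Injective j₁) (h₂ : Function.Injective j₂) :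
    ∃ (K' : Type u) (_ : Group K') (i : K →* K') (r : K'), Function.Injective i ∧
      ∀ d, r * i (j₁ d) * r⁻¹ = i (j₂ d) := by
  let φ : j₁.range ≃* j₂.range :=
    (MonoidHom.ofInjective h₁).symm.trans (MonoidHom.ofInjective h₂)
  refine ⟨HNNExtension K _ _ φ, inferInstance, HNNExtension.of, HNNExtension.t,
    HNNExtension.of_injective _, fun d => ?_⟩
  have := HNNExtension.equiv_eq_conj (φ := φ) (MonoidHom.ofInjective h₁ d)
  simp only [φ, MulEquiv.trans_apply, MulEquiv.symm_apply_apply, MonoidHom.ofInjective_apply]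
    at this
  exact this.symm

theorem exists_extension_forall_conj {R : Type*} {D : R → Type*} {K : Type u}
    [∀ ρ, Group (D ρ)] [Group K] (j₁ j₂ : ∀ ρ, D ρ →* K) (s : Finset R)
    (h₁ : ∀ ρ ∈ s, Function.Injective (j₁ ρ)) (h₂ : ∀ ρ ∈ s, Function.Injective (j₂ ρ)) :
    ∃ (K' : Type u) (_ : Group K') (i : K →* K') (r : R → K'), Function.Injective i ∧
      ∀ ρ ∈ s, ∀ d, r ρ * i (j₁ ρ d) * (r ρ)⁻¹ = i (j₂ ρ d) := by
  classical
  induction s using Finset.induction_on with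
  | empty => exact ⟨K, inferInstance, MonoidHom.id K, fun _ => 1, Function.injective_id, by simp⟩
  | insert ρ s hρ ih =>
    obtain ⟨K₁, _, i, r, hi, hr⟩ := ih (fun σ hσ => h₁ σ (Finset.mem_insert_of_mem hσ))
      (fun σ hσ => h₂ σ (Finset.mem_insert_of_mem hσ))
    obtain ⟨K₂, _, i', r', hi', hr'⟩ := exists_extension_conj (i.comp (j₁ ρ)) (i.comp (j₂ ρ))
      (hi.comp (h₁ ρ (Finset.mem_insert_self _ _))) (hi.comp (h₂ ρ (Finset.mem_insert_self _ _)))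
    refine ⟨K₂, inferInstance, i'.comp i, Function.update (fun σ => i' (r σ)) ρ r',
      hi'.comp hi, fun σ hσ d => ?_⟩
    by_cases h : σ = ρ
    · subst h
      simpa using hr' d
    · simp [Function.update_of_ne h, ← map_mul, ← map_inv,
        hr σ ((Finset.mem_insert.1 hσ).resolve_left h) d]

namespace HNNExtension

theorem exists_reducedWord_prod_eq {P : Type*} [Group P] {A B : Subgroup P} (φ : A ≃* B)
    (g : HNNExtension P A B φ) :
    ∃ w : NormalWord.ReducedWord P A B, w.prod φ = g := by
  obtain ⟨d⟩ := NormalWord.TransversalPair.nonempty P A B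
  exact ⟨((NormalWord.equiv φ d) g).toReducedWord, (NormalWord.equiv φ d).symm_apply_apply g⟩

theorem injective_of_map {P₀ P : Type*} [Group P₀] [Group P] {A₀ B₀ : Subgroup P₀}
    {A B : Subgroup P} {φ₀ : A₀ ≃* B₀} {φ : A ≃* B} (f : P₀ →* P) (hf : Function.Injective f)
    (hA : ∀ g, f g ∈ A → g ∈ A₀) (hB : ∀ g, f g ∈ B → g ∈ B₀)
    (F : HNNExtension P₀ A₀ B₀ φ₀ →* HNNExtension P A B φ)
    (hF : ∀ g, F (of g) = of (f g)) (hFt : F t = t) : Function.Injective F := by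
  rw [injective_iff_map_eq_one]
  intro x hx
  obtain ⟨w, rfl⟩ := exists_reducedWord_prod_eq φ₀ x
  let w' : NormalWord.ReducedWord P A B :=
    { head := f w.head
      toList := w.toList.map (fun a => (a.1, f a.2))
      chain := by
        rw [List.isChain_map]
        refine w.chain.imp fun a b hab h => hab ?_
        rcases Int.units_eq_one_or a.1 with ha | ha <;> rw [ha] at h ⊢
        · exact hA _ h
        · exact hB _ h }
  have hw' : w'.prod φ = F (w.prod φ₀) := by
    simp [NormalWord.ReducedWord.prod, w', hF, hFt, map_list_prod, Function.comp_def]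
  have hnil := ReducedWord.toList_eq_nil_of_mem_of_range φ w' (by rw [hw', hx]; exact one_mem _)
  have hnil' : w.toList = [] := by simpa [w'] using hnil
  have hx' : f w.head = 1 := by
    apply of_injective (φ := φ)
    simpa [NormalWord.ReducedWord.prod, hnil', hF] using hx
  have : w.head = 1 := hf (by simpa using hx')
  simp [NormalWord.ReducedWord.prod, hnil', this]

end HNNExtension

section Base

variable {Γ C : Type} [Group Γ] [MulAction Γ C] {H : Type u} [Group H]

/-- The action of `Γ` on the free group on the tokens `C` and the letters `ℕ`, by permuting
tokens. -/
def tokenAct (Γ C : Type) [Group Γ] [MulAction Γ C] : Γ →* MulAut (FreeGroup (C ⊕ ℕ)) where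
  toFun γ := FreeGroup.freeGroupCongr (Equiv.sumCongr (MulAction.toPerm γ) (Equiv.refl ℕ))
  map_one' := by
    apply MulEquiv.toMonoidHom_injective
    ext (c | j) <;> simp
  map_mul' a b := by
    apply MulEquiv.toMonoidHom_injective
    ext (c | j) <;> simp [mul_smul]

@[simp] theorem tokenAct_inl (γ : Γ) (c : C) :
    tokenAct Γ C γ (FreeGroup.of (Sum.inl c)) = FreeGroup.of (Sum.inl (γ • c)) := by
  simp [tokenAct]

@[simp] theorem tokenAct_inr (γ : Γ) (j : ℕ) :
    tokenAct Γ C γ (FreeGroup.of (Sum.inr j)) = FreeGroup.of (Sum.inr j) := by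
  simp [tokenAct]

/-- The homomorphism evaluating tokens by `V` and letters by `h`. -/
abbrev tokenVal (V : C → H) (h : ℕ → H) : FreeGroup (C ⊕ ℕ) →* H :=
  FreeGroup.lift (Sum.elim V h)

/-- The base group of the HNN extension `TokenHNN`. -/
abbrev TokenBase (Γ C : Type) [Group Γ] [MulAction Γ C] (H : Type u) [Group H] : Type u :=
  (FreeGroup (C ⊕ ℕ) ⋊[tokenAct Γ C] Γ) × H

/-- The graph of a homomorphism from the free group to `H`, inside `TokenBase`. -/
def tokenGraph (Γ : Type) {C : Type} [Group Γ] [MulAction Γ C] (χ : FreeGroup (C ⊕ ℕ) →* H) :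
    FreeGroup (C ⊕ ℕ) →* TokenBase Γ C H :=
  (SemidirectProduct.inl (φ := tokenAct Γ C)).prod χ

theorem tokenGraph_injective (χ : FreeGroup (C ⊕ ℕ) →* H) :
    Function.Injective (tokenGraph Γ χ) := fun _ _ hab =>
  SemidirectProduct.inl_injective (congrArg Prod.fst hab)

theorem mem_range_tokenGraph {χ : FreeGroup (C ⊕ ℕ) →* H} {g : TokenBase Γ C H} :
    g ∈ (tokenGraph Γ χ).range ↔ g.1.right = 1 ∧ g.2 = χ g.1.left := by
  constructor
  · rintro ⟨w, rfl⟩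
    simp [tokenGraph]
  · rintro ⟨h₁, h₂⟩
    refine ⟨g.1.left, Prod.ext (SemidirectProduct.ext ?_ ?_) ?_⟩ <;>
      simp [tokenGraph, h₁, h₂]

/-- The isomorphism between the graphs of the trivial homomorphism and of the evaluation. -/
noncomputable def tokenEquiv (Γ : Type) {C : Type} [Group Γ] [MulAction Γ C] (V : C → H)
    (h : ℕ → H) :
    (tokenGraph Γ (1 : FreeGroup (C ⊕ ℕ) →* H)).range ≃* (tokenGraph Γ (tokenVal V h)).range :=
  (MonoidHom.ofInjective (tokenGraph_injective _)).symm.trans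
    (MonoidHom.ofInjective (tokenGraph_injective _))

/-- The HNN extension of `TokenBase` whose stable letter conjugates every element `w` of the free
group on tokens and letters to the product of `w` and its value in `H`. -/
abbrev TokenHNN (Γ : Type) {C : Type} [Group Γ] [MulAction Γ C] (V : C → H) (h : ℕ → H) : Type u :=
  HNNExtension (TokenBase Γ C H) _ _ (tokenEquiv Γ V h)

namespace TokenHNN

variable (Γ) (V : C → H) (h : ℕ → H)

/-- The inclusion of the free group. -/
noncomputable def word : FreeGroup (C ⊕ ℕ) →* TokenHNN Γ V h :=
  HNNExtension.of.comp ((MonoidHom.inl _ _).comp SemidirectProduct.inl)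

/-- The inclusion of `Γ`. -/
noncomputable def shift : Γ →* TokenHNN Γ V h :=
  HNNExtension.of.comp ((MonoidHom.inl _ _).comp SemidirectProduct.inr)

/-- The inclusion of `H`. -/
noncomputable def coef : H →* TokenHNN Γ V h :=
  HNNExtension.of.comp (MonoidHom.inr _ _)

theorem coef_injective : Function.Injective (coef Γ V h) :=
  (HNNExtension.of_injective _).comp fun _ _ hab => congrArg Prod.snd hab

theorem of_tokenGraph (χ : FreeGroup (C ⊕ ℕ) →* H) (w : FreeGroup (C ⊕ ℕ)) :
    (HNNExtension.of (tokenGraph Γ χ w) : TokenHNN Γ V h) =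
      word Γ V h w * coef Γ V h (χ w) := by
  simp only [word, coef, MonoidHom.comp_apply, ← map_mul]
  congr 1
  simp [tokenGraph]

theorem t_conj_word (w : FreeGroup (C ⊕ ℕ)) :
    HNNExtension.t * word Γ V h w * HNNExtension.t⁻¹ =
      word Γ V h w * coef Γ V h (tokenVal V h w) := by
  have := HNNExtension.equiv_eq_conj (φ := tokenEquiv Γ V h)
    (MonoidHom.ofInjective (tokenGraph_injective 1) w)
  simp only [tokenEquiv, MulEquiv.trans_apply, MulEquiv.symm_apply_apply,
    MonoidHom.ofInjective_apply] at this
  have h₁ := of_tokenGraph Γ V h 1 w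
  have h₂ := of_tokenGraph Γ V h (tokenVal V h) w
  simp only [MonoidHom.one_apply, map_one, mul_one] at h₁
  rw [← h₂, ← h₁]
  exact this.symm

theorem commute_word_coef (w : FreeGroup (C ⊕ ℕ)) (x : H) :
    Commute (word Γ V h w) (coef Γ V h x) := by
  simp only [Commute, SemiconjBy, word, coef, MonoidHom.comp_apply, ← map_mul]
  simp

theorem shift_conj_word (γ : Γ) (w : FreeGroup (C ⊕ ℕ)) :
    shift Γ V h γ * word Γ V h w * (shift Γ V h γ)⁻¹ = word Γ V h (tokenAct Γ C γ w) := by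
  simp only [shift, word, MonoidHom.comp_apply, ← map_mul, ← map_inv]
  rw [SemidirectProduct.inl_aut]

end TokenHNN

section Map

variable {Γ₀ C₀ : Type} [Group Γ₀] [MulAction Γ₀ C₀]

/-- The homomorphism of free groups which maps tokens along `ε` and then multiplies
them by the word `e` in the letters. -/
def tokenMap (ε : C₀ → C) (e : FreeGroup ℕ) : FreeGroup (C₀ ⊕ ℕ) →* FreeGroup (C ⊕ ℕ) :=
  FreeGroup.lift (Sum.elim
    (fun c => FreeGroup.map Sum.inr e * FreeGroup.of (Sum.inl (ε c)))
    (fun j => FreeGroup.of (Sum.inr j)))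

@[simp] theorem tokenMap_inl (ε : C₀ → C) (e : FreeGroup ℕ) (c : C₀) :
    tokenMap ε e (FreeGroup.of (Sum.inl c)) =
      FreeGroup.map Sum.inr e * FreeGroup.of (Sum.inl (ε c)) := by
  simp [tokenMap]

@[simp] theorem tokenMap_inr (ε : C₀ → C) (e : FreeGroup ℕ) (j : ℕ) :
    tokenMap ε e (FreeGroup.of (Sum.inr j)) = FreeGroup.of (Sum.inr j) := by
  simp [tokenMap]

theorem tokenMap_map_inr (ε : C₀ → C) (e e' : FreeGroup ℕ) :
    tokenMap ε e (FreeGroup.map Sum.inr e') = FreeGroup.map Sum.inr e' := by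
  have : (tokenMap ε e).comp (FreeGroup.map Sum.inr) = FreeGroup.map Sum.inr := by
    ext j; simp
  exact DFunLike.congr_fun this e'

theorem tokenAct_map_inr (γ : Γ) (e : FreeGroup ℕ) :
    tokenAct Γ C γ (FreeGroup.map Sum.inr e) = FreeGroup.map Sum.inr e := by
  have : (tokenAct Γ C γ).toMonoidHom.comp (FreeGroup.map Sum.inr) = FreeGroup.map Sum.inr := by
    ext j; simp
  exact DFunLike.congr_fun this e

theorem tokenVal_map_inr (V : C → H) (h : ℕ → H) (e : FreeGroup ℕ) :
    tokenVal V h (FreeGroup.map Sum.inr e) = FreeGroup.lift h e := by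
  have : (tokenVal V h).comp (FreeGroup.map Sum.inr) = FreeGroup.lift h := by
    ext j; simp
  exact DFunLike.congr_fun this e

theorem tokenMap_injective {ε : C₀ → C} (hε : Function.Injective ε) (e : FreeGroup ℕ) :
    Function.Injective (tokenMap ε e) := by
  have h₁ : (tokenMap (C₀ := C) id e⁻¹).comp (tokenMap ε e) =
      FreeGroup.map (Sum.map ε id) := by
    ext (c | j)
    · simp [tokenMap_map_inr]
    · simp
  have h₂ : Function.Injective (FreeGroup.map (Sum.map ε (id : ℕ → ℕ))) :=
    FreeGroup.map_injective (Sum.map_injective.2 ⟨hε, Function.injective_id⟩)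
  rw [← h₁] at h₂
  exact Function.Injective.of_comp h₂

theorem tokenVal_tokenMap {V : C → H} {V₀ : C₀ → H} {h : ℕ → H} {ε : C₀ → C} {e : FreeGroup ℕ}
    (hV : ∀ c, V₀ c = FreeGroup.lift h e * V (ε c)) (w : FreeGroup (C₀ ⊕ ℕ)) :
    tokenVal V h (tokenMap ε e w) = tokenVal V₀ h w := by
  have : (tokenVal V h).comp (tokenMap ε e) = tokenVal V₀ h := by
    ext (c | j)
    · have := tokenVal_map_inr V h e
      simp only [tokenVal] at this
      simp [hV, this]
    · simp
  exact DFunLike.congr_fun this w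

theorem exists_tokenHNN_map {V : C → H} {V₀ : C₀ → H} {h : ℕ → H} {ε : C₀ → C} {e : FreeGroup ℕ}
    {μ : Γ₀ →* Γ} (hμ : Function.Injective μ) (hε : Function.Injective ε)
    (hεμ : ∀ γ c, ε (γ • c) = μ γ • ε c) (hV : ∀ c, V₀ c = FreeGroup.lift h e * V (ε c)) :
    ∃ j : TokenHNN Γ₀ V₀ h →* TokenHNN Γ V h, Function.Injective j ∧
      j HNNExtension.t = HNNExtension.t ∧
      (∀ w, j (TokenHNN.word Γ₀ V₀ h w) = TokenHNN.word Γ V h (tokenMap ε e w)) ∧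
      (∀ γ, j (TokenHNN.shift Γ₀ V₀ h γ) = TokenHNN.shift Γ V h (μ γ)) ∧
      ∀ x, j (TokenHNN.coef Γ₀ V₀ h x) = TokenHNN.coef Γ V h x := by
  let f : TokenBase Γ₀ C₀ H →* TokenBase Γ C H :=
    (SemidirectProduct.map (tokenMap ε e) μ (fun γ => by
      ext (c | j)
      · simp [hεμ, tokenAct_map_inr]
      · simp)).prodMap (MonoidHom.id H)
  have hθ := tokenMap_injective hε e
  have hf : Function.Injective f := by
    rintro ⟨⟨a, b⟩, x⟩ ⟨⟨a', b'⟩, x'⟩ hab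
    simp only [f, MonoidHom.coe_prodMap, Prod.map, Prod.mk.injEq, SemidirectProduct.ext_iff,
      SemidirectProduct.map_left, SemidirectProduct.map_right, MonoidHom.id_apply] at hab ⊢
    exact ⟨⟨hθ hab.1.1, hμ hab.1.2⟩, hab.2⟩
  have hG : ∀ χ χ₀, (∀ w, χ (tokenMap ε e w) = χ₀ w) → ∀ w,
      f (tokenGraph Γ₀ χ₀ w) = tokenGraph Γ χ (tokenMap ε e w) := by
    intro χ χ₀ hχ w
    refine Prod.ext (SemidirectProduct.ext ?_ ?_) ?_ <;> simp [f, tokenGraph, hχ]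
  have hmem : ∀ χ χ₀, (∀ w, χ (tokenMap ε e w) = χ₀ w) → ∀ g,
      f g ∈ (tokenGraph Γ χ).range → g ∈ (tokenGraph Γ₀ χ₀).range := by
    intro χ χ₀ hχ g hg
    rw [mem_range_tokenGraph] at hg ⊢
    simp only [f, MonoidHom.coe_prodMap, Prod.map, SemidirectProduct.map_right,
      SemidirectProduct.map_left, MonoidHom.id_apply, hχ] at hg
    exact ⟨hμ (by rw [hg.1, map_one]), hg.2⟩
  have hval := tokenVal_tokenMap hV
  let F : TokenHNN Γ₀ V₀ h →* TokenHNN Γ V h :=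
    HNNExtension.lift (HNNExtension.of.comp f) HNNExtension.t (by
      rintro ⟨_, w, rfl⟩
      have key := HNNExtension.t_mul_of (φ := tokenEquiv Γ V h)
        (MonoidHom.ofInjective (tokenGraph_injective 1) (tokenMap ε e w))
      have h₀ : tokenEquiv Γ₀ V₀ h ⟨tokenGraph Γ₀ 1 w, w, rfl⟩ =
          MonoidHom.ofInjective (tokenGraph_injective (tokenVal V₀ h)) w := by
        have : (⟨tokenGraph Γ₀ 1 w, w, rfl⟩ : (tokenGraph Γ₀ (1 : _ →* H)).range) =
          MonoidHom.ofInjective (tokenGraph_injective 1) w := rfl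
        rw [this]
        simp [tokenEquiv]
      simp only [tokenEquiv, MulEquiv.trans_apply, MulEquiv.symm_apply_apply,
        MonoidHom.ofInjective_apply] at key
      rw [h₀]
      simp only [MonoidHom.comp_apply, MonoidHom.ofInjective_apply]
      rw [hG 1 1 (fun _ => rfl), hG _ _ hval]
      exact key)
  refine ⟨F, HNNExtension.injective_of_map f hf (hmem _ _ fun _ => rfl) (hmem _ _ hval) F
    (fun g => by simp [F]) (by simp [F]), by simp [F], fun w => ?_, fun γ => ?_, fun x => ?_⟩
  · simp [F, TokenHNN.word, f]
  · simp [F, TokenHNN.shift, f]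
  · simp [F, TokenHNN.coef, f]

end Map

end Base

/-- A configuration of a counter machine: a state and integer registers. -/
@[ext] structure Conf (Q ι : Type) where
  /-- The state. -/
  st : Q
  /-- The contents of the registers. -/
  val : ι → ℤ

instance (Q ι : Type) : MulAction (Multiplicative (ι → ℤ)) (Conf Q ι) where
  smul γ c := ⟨c.st, γ.toAdd + c.val⟩
  one_smul _ := Conf.ext rfl (zero_add _)
  mul_smul _ _ _ := Conf.ext rfl (add_assoc _ _ _)

theorem Conf.smul_def {Q ι : Type} (γ : Multiplicative (ι → ℤ)) (c : Conf Q ι) :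
    γ • c = ⟨c.st, γ.toAdd + c.val⟩ := rfl

/-- An affine rewriting rule: for every `v`, it leads from the state `src` with
registers `a + m * v` to the state `tgt` with registers `a' + m' * v`, emitting `out`. -/
structure AffineRule (Q ι : Type) where
  /-- The source state. -/
  src : Q
  /-- The target state. -/
  tgt : Q
  /-- The source offset. -/
  a : ι → ℤ
  /-- The source slope. -/
  m : ι → ℤ
  /-- The target offset. -/
  a' : ι → ℤ
  /-- The target slope. -/
  m' : ι → ℤ
  /-- The emitted letter, if any. -/
  out : Option ℕ

namespace AffineRule

variable {Q ι : Type}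

/-- The configurations to which the rule applies. -/
def source (ρ : AffineRule Q ι) (v : ι → ℤ) : Conf Q ι := ⟨ρ.src, ρ.a + ρ.m * v⟩

/-- The configurations which the rule produces. -/
def target (ρ : AffineRule Q ι) (v : ι → ℤ) : Conf Q ι := ⟨ρ.tgt, ρ.a' + ρ.m' * v⟩

/-- The emitted word. -/
def word (ρ : AffineRule Q ι) : FreeGroup ℕ := ρ.out.elim 1 FreeGroup.of

/-- The rule has slopes with the same zeros. -/
def Balanced (ρ : AffineRule Q ι) : Prop := ∀ j, ρ.m j = 0 ↔ ρ.m' j = 0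

/-- Paths between configurations along the rules in `s`, with the list of emitted letters. -/
inductive Path (s : Set (AffineRule Q ι)) : Conf Q ι → List ℕ → Conf Q ι → Prop
  | refl (c) : Path s c [] c
  | step {ρ l c} (hρ : ρ ∈ s) (v : ι → ℤ) (h : Path s (ρ.target v) l c) :
      Path s (ρ.source v) (ρ.out.toList ++ l) c

theorem Path.trans {s : Set (AffineRule Q ι)} {c₁ c₂ c₃ : Conf Q ι} {l l' : List ℕ}
    (h : Path s c₁ l c₂) (h' : Path s c₂ l' c₃) : Path s c₁ (l ++ l') c₃ := by
  induction h with
  | refl => exact h'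
  | step hρ v _ ih => rw [List.append_assoc]; exact .step hρ v (ih h')

theorem Path.forall_mem {s : Set (AffineRule Q ι)} {n : ℕ} (hs : ∀ ρ ∈ s, ∀ i ∈ ρ.out, i < n)
    {c c' : Conf Q ι} {l : List ℕ} (h : Path s c l c') : ∀ i ∈ l, i < n := by
  induction h with
  | refl => simp
  | @step ρ l _ hρ v _ ih =>
    intro i hi
    rcases List.mem_append.1 hi with hi | hi
    · exact hs ρ hρ i (by simpa using hi)
    · exact ih i hi

/-- The evaluation `V` of configurations is compatible with the rules in `s`. -/
def Invariant {H : Type*} [Group H] (s : Set (AffineRule Q ι)) (h : ℕ → H) (V : Conf Q ι → H) :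
    Prop :=
  ∀ ρ ∈ s, ∀ v, V (ρ.source v) = FreeGroup.lift h ρ.word * V (ρ.target v)

/-- The generators of the group presenting a finite system of affine rules. -/
inductive Gen (Q ι : Type) : Type
  | x (j : ι)
  | t (q : Q)
  | k
  | f (i : ℕ)
  | b (i : ℕ)
  | r (ρ : AffineRule Q ι)

section Relations

variable [Fintype ι] {L : Type*} [Group L]

/-- The monomial with exponents `u`. -/
noncomputable def mono (y : ι → L) (u : ι → ℤ) : L :=
  ((Finset.univ : Finset ι).toList.map fun j => y j ^ u j).prod

theorem mono_add {y : ι → L} (hy : ∀ i j, Commute (y i) (y j)) (u v : ι → ℤ) :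
    mono y (u + v) = mono y u * mono y v := by
  unfold mono
  induction (Finset.univ : Finset ι).toList with
  | nil => simp
  | cons j l ih =>
    have hc : Commute (y j ^ v j) ((l.map fun j => y j ^ u j).prod) := by
      refine Commute.list_prod_right _ _ fun z hz => ?_
      obtain ⟨i, -, rfl⟩ := List.mem_map.1 hz
      exact ((hy j i).zpow_left _).zpow_right _
    rw [List.map_cons, List.prod_cons, ih, Pi.add_apply, zpow_add]
    simp only [List.map_cons, List.prod_cons]
    calc _ = y j ^ u j * (y j ^ v j * (l.map fun j => y j ^ u j).prod) *
          (l.map fun j => y j ^ v j).prod := by group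
      _ = _ := by rw [hc.eq]; group

theorem map_mono {L' : Type*} [Group L'] (f : L →* L') (y : ι → L) (u : ι → ℤ) :
    f (mono y u) = mono (f ∘ y) u := by
  simp [mono, map_list_prod, Function.comp_def]

theorem mono_mul_eq {y y' : ι → L} {m m' : ι → ℤ} (h : ∀ j, y j ^ m j = y' j ^ m' j)
    (u : ι → ℤ) : mono y (m * u) = mono y' (m' * u) := by
  simp [mono, zpow_mul, h]

theorem commute_mono {y : ι → L} {z : L} (h : ∀ j, Commute z (y j)) (u : ι → ℤ) :
    Commute z (mono y u) := by
  refine Commute.list_prod_right _ _ fun z hz => ?_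
  obtain ⟨i, -, rfl⟩ := List.mem_map.1 hz
  exact (h i).zpow_right _

/-- The element representing a configuration. -/
noncomputable def tok (y : Gen Q ι → L) (c : Conf Q ι) : L :=
  mono (fun j => y (.x j)) c.val * y (.t c.st) * (mono (fun j => y (.x j)) c.val)⁻¹

theorem map_tok {L' : Type*} [Group L'] (g : L →* L') (y : Gen Q ι → L) (c : Conf Q ι) :
    g (tok y c) = tok (g ∘ y) c := by
  simp [tok, map_mono, Function.comp_def]

/-- The relations of the group presenting the rules in `s`. -/
structure Sol (n : ℕ) (s : Set (AffineRule Q ι)) (c₀ c₁ : Conf Q ι) (y : Gen Q ι → L) :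
    Prop where
  xx : ∀ i j, Commute (y (.x i)) (y (.x j))
  xf : ∀ j, ∀ i < n, Commute (y (.x j)) (y (.f i))
  fb : ∀ i < n, ∀ j < n, Commute (y (.f i)) (y (.b j))
  kf : ∀ i < n, y .k * y (.f i) * (y .k)⁻¹ = y (.f i) * y (.b i)
  k₀ : Commute (y .k) (tok y c₀)
  k₁ : Commute (y .k) (tok y c₁)
  rk : ∀ ρ ∈ s, Commute (y (.r ρ)) (y .k)
  rf : ∀ ρ ∈ s, ∀ i < n, Commute (y (.r ρ)) (y (.f i))
  rx : ∀ ρ ∈ s, ∀ j, y (.r ρ) * y (.x j) ^ ρ.m j * (y (.r ρ))⁻¹ = y (.x j) ^ ρ.m' j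
  rt : ∀ ρ ∈ s, y (.r ρ) * tok y ⟨ρ.src, ρ.a⟩ * (y (.r ρ))⁻¹ =
    FreeGroup.lift (fun i => y (.f i)) ρ.word * tok y ⟨ρ.tgt, ρ.a'⟩

theorem Sol.tok_add {n : ℕ} {s : Set (AffineRule Q ι)} {c₀ c₁ : Conf Q ι} {y : Gen Q ι → L}
    (hy : Sol n s c₀ c₁ y) (q : Q) (u v : ι → ℤ) :
    tok y ⟨q, u + v⟩ = mono (fun j => y (.x j)) v * tok y ⟨q, u⟩ *
      (mono (fun j => y (.x j)) v)⁻¹ := by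
  simp only [tok]
  rw [add_comm, mono_add hy.xx]
  group

theorem Sol.conj_source {n : ℕ} {s : Set (AffineRule Q ι)} {c₀ c₁ : Conf Q ι} {y : Gen Q ι → L}
    (hy : Sol n s c₀ c₁ y) (hs : ∀ ρ ∈ s, ∀ i ∈ ρ.out, i < n) {ρ} (hρ : ρ ∈ s) (v : ι → ℤ) :
    y (.r ρ) * tok y (ρ.source v) * (y (.r ρ))⁻¹ =
      (ρ.out.toList.map fun i => y (.f i)).prod * tok y (ρ.target v) := by
  have hx : y (.r ρ) * mono (fun j => y (.x j)) (ρ.m * v) * (y (.r ρ))⁻¹ =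
      mono (fun j => y (.x j)) (ρ.m' * v) := by
    have := map_mono (MulAut.conj (y (.r ρ))).toMonoidHom (fun j => y (.x j)) (ρ.m * v)
    simp only [MulEquiv.toMonoidHom_eq_coe, MonoidHom.coe_coe, MulAut.conj_apply] at this
    rw [this]
    refine mono_mul_eq (fun j => ?_) v
    simpa using hy.rx ρ hρ j
  have hw : FreeGroup.lift (fun i => y (.f i)) ρ.word =
      (ρ.out.toList.map fun i => y (.f i)).prod := by
    cases h : ρ.out <;> simp [word, h]
  have hc : Commute (ρ.out.toList.map fun i => y (.f i)).prod
      (mono (fun j => y (.x j)) (ρ.m' * v)) := by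
    refine Commute.list_prod_left _ _ fun z hz => ?_
    obtain ⟨i, hi, rfl⟩ := List.mem_map.1 hz
    exact commute_mono (fun j => (hy.xf j i (hs ρ hρ i (by simpa using hi))).symm) _
  have ht := hy.rt ρ hρ
  rw [hw] at ht
  rw [source, target, hy.tok_add, hy.tok_add]
  calc _ = (y (.r ρ) * mono (fun j => y (.x j)) (ρ.m * v) * (y (.r ρ))⁻¹) *
        (y (.r ρ) * tok y ⟨ρ.src, ρ.a⟩ * (y (.r ρ))⁻¹) *
        (y (.r ρ) * mono (fun j => y (.x j)) (ρ.m * v) * (y (.r ρ))⁻¹)⁻¹ := by group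
    _ = _ := by
      rw [hx, ht]
      simp only [← mul_assoc]
      rw [hc.eq]

theorem Sol.exists_conj {n : ℕ} {s : Set (AffineRule Q ι)} {c₀ c₁ : Conf Q ι} {y : Gen Q ι → L}
    (hy : Sol n s c₀ c₁ y) (hs : ∀ ρ ∈ s, ∀ i ∈ ρ.out, i < n) {c c' : Conf Q ι} {l : List ℕ}
    (h : Path s c l c') : ∃ R : L, Commute R (y .k) ∧ (∀ i < n, Commute R (y (.f i))) ∧
      R * tok y c * R⁻¹ = (l.map fun i => y (.f i)).prod * tok y c' := by
  induction h with
  | refl c => exact ⟨1, by simp⟩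
  | @step ρ l c hρ v h ih =>
    obtain ⟨R, hk, hf, hR⟩ := ih
    refine ⟨R * y (.r ρ), hk.mul_left (hy.rk ρ hρ), fun i hi => (hf i hi).mul_left
      (hy.rf ρ hρ i hi), ?_⟩
    have hc : Commute R (ρ.out.toList.map fun i => y (.f i)).prod := by
      refine Commute.list_prod_right _ _ fun z hz => ?_
      obtain ⟨i, hi, rfl⟩ := List.mem_map.1 hz
      exact hf i (hs ρ hρ i (by simpa using hi))
    calc _ = R * (y (.r ρ) * tok y (ρ.source v) * (y (.r ρ))⁻¹) * R⁻¹ := by group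
      _ = R * (ρ.out.toList.map fun i => y (.f i)).prod * tok y (ρ.target v) * R⁻¹ := by
        rw [hy.conj_source hs hρ]; group
      _ = (ρ.out.toList.map fun i => y (.f i)).prod * (R * tok y (ρ.target v) * R⁻¹) := by
        rw [hc.eq]; group
      _ = _ := by rw [hR]; simp [mul_assoc]

theorem Sol.prod_eq_one {n : ℕ} {s : Set (AffineRule Q ι)} {c₀ c₁ : Conf Q ι}
    {y : Gen Q ι → L} (hy : Sol n s c₀ c₁ y) (hs : ∀ ρ ∈ s, ∀ i ∈ ρ.out, i < n) {l : List ℕ}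
    (h : Path s c₀ l c₁) : (l.map fun i => y (.b i)).prod = 1 := by
  obtain ⟨R, hk, -, hR⟩ := hy.exists_conj hs h
  have hl : ∀ l : List ℕ, (∀ i ∈ l, i < n) → MulAut.conj (y .k) (l.map fun i => y (.f i)).prod =
      (l.map fun i => y (.f i)).prod * (l.map fun i => y (.b i)).prod := by
    intro l hl
    induction l with
    | nil => simp
    | cons i l ih =>
      simp only [List.map_cons, List.prod_cons, map_mul]
      rw [ih fun j hj => hl j (List.mem_cons_of_mem _ hj), MulAut.conj_apply,
        hy.kf i (hl i List.mem_cons_self)]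
      have hc : Commute (y (.b i)) (l.map fun i => y (.f i)).prod := by
        refine Commute.list_prod_right _ _ fun z hz => ?_
        obtain ⟨j, hj, rfl⟩ := List.mem_map.1 hz
        exact (hy.fb j (hl j (List.mem_cons_of_mem _ hj)) i (hl i List.mem_cons_self)).symm
      calc _ = y (.f i) * (y (.b i) * (l.map fun i => y (.f i)).prod) *
            (l.map fun i => y (.b i)).prod := by group
        _ = _ := by rw [hc.eq]; group
  have h₁ : (l.map fun i => y (.f i)).prod = R * tok y c₀ * R⁻¹ * (tok y c₁)⁻¹ := by
    rw [hR]; group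
  have h₂ : Commute (y .k) (l.map fun i => y (.f i)).prod := by
    rw [h₁]
    exact ((hk.symm.mul_right hy.k₀).mul_right hk.symm.inv_right).mul_right hy.k₁.inv_right
  have h₃ := hl l (h.forall_mem hs)
  rw [MulAut.conj_apply, h₂.eq, mul_inv_cancel_right] at h₃
  exact (left_eq_mul.1 h₃)

open scoped commutatorElement in
theorem exists_finset_iff_sol (n : ℕ) {s : Set (AffineRule Q ι)} (hs : s.Finite)
    (c₀ c₁ : Conf Q ι) : ∃ E : Finset (FreeGroup (Gen Q ι)), ∀ (L : Type u) [Group L]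
      (y : Gen Q ι → L), (∀ w ∈ E, FreeGroup.lift y w = 1) ↔ Sol n s c₀ c₁ y := by
  let g : Gen Q ι → FreeGroup (Gen Q ι) := FreeGroup.of
  let S : Set (FreeGroup (Gen Q ι)) :=
    (Set.range fun p : ι × ι => ⁅g (.x p.1), g (.x p.2)⁆) ∪
    (Set.range fun p : ι × Fin n => ⁅g (.x p.1), g (.f p.2)⁆) ∪
    (Set.range fun p : Fin n × Fin n => ⁅g (.f p.1), g (.b p.2)⁆) ∪
    (Set.range fun i : Fin n => g .k * g (.f i) * (g .k)⁻¹ * (g (.f i) * g (.b i))⁻¹) ∪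
    {⁅g .k, tok g c₀⁆} ∪ {⁅g .k, tok g c₁⁆} ∪
    (⋃ ρ ∈ s, {⁅g (.r ρ), g .k⁆}) ∪
    (⋃ ρ ∈ s, Set.range fun i : Fin n => ⁅g (.r ρ), g (.f i)⁆) ∪
    (⋃ ρ ∈ s, Set.range fun j => g (.r ρ) * g (.x j) ^ ρ.m j * (g (.r ρ))⁻¹ *
      (g (.x j) ^ ρ.m' j)⁻¹) ∪
    (⋃ ρ ∈ s, {g (.r ρ) * tok g ⟨ρ.src, ρ.a⟩ * (g (.r ρ))⁻¹ *
      (FreeGroup.lift (fun i => g (.f i)) ρ.word * tok g ⟨ρ.tgt, ρ.a'⟩)⁻¹})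
  have hS : S.Finite := by
    refine .union (.union (.union (.union (.union (.union (.union (.union (.union ?_ ?_) ?_) ?_)
      ?_) ?_) ?_) ?_) ?_) ?_
    all_goals first
      | exact Set.finite_range _
      | exact Set.finite_singleton _
      | exact hs.biUnion fun _ _ => Set.finite_range _
      | exact hs.biUnion fun _ _ => Set.finite_singleton _
  refine ⟨hS.toFinset, fun L _ y => ?_⟩
  have hg : ∀ a, FreeGroup.lift y (g a) = y a := fun a => FreeGroup.lift_apply_of
  have ht : ∀ c, FreeGroup.lift y (tok g c) = tok y c := fun c => by
    rw [map_tok]; congr 1; funext a; exact hg a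
  have hw : ∀ w : FreeGroup ℕ, FreeGroup.lift y (FreeGroup.lift (fun i => g (.f i)) w) =
      FreeGroup.lift (fun i => y (.f i)) w := fun w => by
    have : (FreeGroup.lift y).comp (FreeGroup.lift fun i => g (.f i)) =
      FreeGroup.lift (fun i => y (.f i)) := by ext i; simp [hg]
    exact DFunLike.congr_fun this w
  have hU : ∀ (T : AffineRule Q ι → Set (FreeGroup (Gen Q ι))) (P : FreeGroup (Gen Q ι) → Prop),
      (∀ w, w ∈ ⋃ ρ ∈ s, T ρ → P w) ↔ ∀ ρ ∈ s, ∀ w, w ∈ T ρ → P w := fun T P => by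
    simp only [Set.mem_iUnion, exists_prop, forall_exists_index, and_imp]
    exact ⟨fun h ρ hρ w => h w ρ hρ, fun h w ρ hρ => h ρ hρ w⟩
  simp only [Set.Finite.mem_toFinset, S, hU, Set.mem_union, or_imp, forall_and, Set.forall_mem_range,
    Set.mem_singleton_iff, forall_eq, map_mul, map_inv,
    map_zpow, map_commutatorElement, hg, ht, hw, commutatorElement_eq_one_iff_commute,
    mul_inv_eq_one, Prod.forall, Fin.forall_iff]
  constructor
  · rintro ⟨⟨⟨⟨⟨⟨⟨⟨⟨h1, h2⟩, h3⟩, h4⟩, h5⟩, h6⟩, h7⟩, h8⟩, h9⟩, h10⟩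
    exact ⟨fun i j => h1 i j, fun j i hi => h2 j i hi, fun i hi j hj => h3 i hi j hj, h4, h5, h6,
      h7, h8, h9, h10⟩
  · rintro ⟨h1, h2, h3, h4, h5, h6, h7, h8, h9, h10⟩
    exact ⟨⟨⟨⟨⟨⟨⟨⟨⟨h1, h2⟩, h3⟩, h4⟩, h5⟩, h6⟩, h7⟩, h8⟩, h9⟩, h10⟩

end Relations

end AffineRule

namespace AffineRule

variable {Q ι : Type}

section Model

/-- The exponents which are not annihilated by the slope. -/
def support (ρ : AffineRule Q ι) : Subgroup (Multiplicative (ι → ℤ)) where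
  carrier := {γ | ∀ j, ρ.m j = 0 → γ.toAdd j = 0}
  one_mem' := by simp
  mul_mem' := fun ha hb j hj => by simp [ha j hj, hb j hj]
  inv_mem' := fun ha j hj => by simp [ha j hj]

/-- Coordinatewise multiplication by a slope. -/
def scale (ρ : AffineRule Q ι) (m : ι → ℤ) : ρ.support →* Multiplicative (ι → ℤ) where
  toFun γ := Multiplicative.ofAdd (m * γ.1.toAdd)
  map_one' := by simp
  map_mul' a b := by simp [mul_add]

theorem scale_injective (ρ : AffineRule Q ι) {m : ι → ℤ} (hm : ∀ j, m j = 0 → ρ.m j = 0) :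
    Function.Injective (ρ.scale m) := by
  intro a b hab
  apply Subtype.ext
  apply Multiplicative.toAdd.injective
  funext j
  by_cases hj : ρ.m j = 0
  · rw [a.2 j hj, b.2 j hj]
  · have h : m * a.1.toAdd = m * b.1.toAdd := Multiplicative.ofAdd.injective hab
    exact mul_left_cancel₀ (fun h0 => hj (hm j h0)) (congrFun h j)

/-- The configurations with state `q` and registers in the image of `a + m * ·`. -/
def place (ρ : AffineRule Q ι) (q : Q) (a m : ι → ℤ) (γ : ρ.support) : Conf Q ι :=
  ⟨q, a + m * γ.1.toAdd⟩

theorem place_injective (ρ : AffineRule Q ι) (q : Q) (a : ι → ℤ) {m : ι → ℤ}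
    (hm : ∀ j, m j = 0 → ρ.m j = 0) : Function.Injective (ρ.place q a m) := by
  intro γ γ' h
  apply ρ.scale_injective hm
  have := congrArg Conf.val h
  exact congrArg Multiplicative.ofAdd (add_left_cancel this)

theorem place_smul (ρ : AffineRule Q ι) (q : Q) (a m : ι → ℤ) (γ c : ρ.support) :
    ρ.place q a m (γ • c) = ρ.scale m γ • ρ.place q a m c := by
  simp only [place, Conf.smul_def, scale, MonoidHom.coe_mk, OneHom.coe_mk, toAdd_ofAdd, smul_eq_mul,
    Subgroup.coe_mul, toAdd_mul, mul_add, Conf.mk.injEq, true_and]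
  abel

theorem mono_shift [Fintype ι] [DecidableEq ι] {L : Type*} [Group L] (g : Multiplicative (ι → ℤ) →* L)
    (u : ι → ℤ) :
    mono (fun j => g (Multiplicative.ofAdd (Pi.single j 1))) u = g (Multiplicative.ofAdd u) := by
  rw [← Function.comp_def g, ← map_mono]
  congr 1
  apply Multiplicative.toAdd.injective
  rw [mono, Finset.prod_map_toList]
  funext i
  simp [toAdd_prod, Finset.sum_apply, Pi.single_apply]

theorem exists_sol [Fintype ι] {H : Type u} [Group H] (n : ℕ) {s : Set (AffineRule Q ι)} (hs : s.Finite)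
    (hbal : ∀ ρ ∈ s, ρ.Balanced) {c₀ c₁ : Conf Q ι} (h : ℕ → H) {V : Conf Q ι → H}
    (hV : Invariant s h V) (h₀ : V c₀ = 1) (h₁ : V c₁ = 1) :
    ∃ (H' : Type u) (_ : Group H') (i : H →* H') (y : Gen Q ι → H'), Function.Injective i ∧
      Sol n s c₀ c₁ y ∧ ∀ j, y (.b j) = i (h j) := by
  classical
  let Γ := Multiplicative (ι → ℤ)
  let W (ρ : AffineRule Q ι) : ρ.support → H := fun γ => V (ρ.source γ.1.toAdd)
  have hj₁ : ∀ ρ, ρ ∈ s → _ := fun ρ _ =>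
    exists_tokenHNN_map (h := h) (V := V) (V₀ := W ρ) (e := 1)
      (ρ.scale_injective (m := ρ.m) fun _ => id) (ρ.place_injective ρ.src ρ.a fun _ => id)
      (ρ.place_smul ρ.src ρ.a ρ.m) (fun γ => by simp [W, place, source])
  have hj₂ : ∀ ρ, ρ ∈ s → _ := fun ρ hρ =>
    exists_tokenHNN_map (h := h) (V := V) (V₀ := W ρ) (e := ρ.word)
      (ρ.scale_injective (m := ρ.m') fun j => (hbal ρ hρ j).2)
      (ρ.place_injective ρ.tgt ρ.a' fun j => (hbal ρ hρ j).2)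
      (ρ.place_smul ρ.tgt ρ.a' ρ.m') (fun γ => hV ρ hρ _)
  choose! j₁ hj₁ ht₁ hw₁ hs₁ _ using hj₁
  choose! j₂ hj₂ ht₂ hw₂ hs₂ _ using hj₂
  obtain ⟨K, _, i, r, hi, hr⟩ := exists_extension_forall_conj j₁ j₂ hs.toFinset
    (fun ρ hρ => hj₁ ρ (by simpa using hρ)) (fun ρ hρ => hj₂ ρ (by simpa using hρ))
  replace hr : ∀ ρ ∈ s, ∀ d, r ρ * i (j₁ ρ d) * (r ρ)⁻¹ = i (j₂ ρ d) :=
    fun ρ hρ => hr ρ (by simpa using hρ)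
  let word := (i.comp (TokenHNN.word Γ V h))
  let shift := (i.comp (TokenHNN.shift Γ V h))
  let y : Gen Q ι → K
    | .x j => shift (Multiplicative.ofAdd (Pi.single j 1))
    | .t q => word (FreeGroup.of (Sum.inl ⟨q, 0⟩))
    | .k => i HNNExtension.t
    | .f j => word (FreeGroup.of (Sum.inr j))
    | .b j => i (TokenHNN.coef Γ V h (h j))
    | .r ρ => r ρ
  have hword : ∀ w γ, shift γ * word w * (shift γ)⁻¹ = word (tokenAct Γ _ γ w) := fun w γ => by
    have := congrArg i (TokenHNN.shift_conj_word Γ V h γ w)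
    rwa [map_mul, map_mul, map_inv] at this
  have htok : ∀ c, tok y c = word (FreeGroup.of (Sum.inl c)) := fun c => by
    have := mono_shift shift c.val
    simp only [tok, y]
    rw [this, hword, tokenAct_inl, Conf.smul_def]
    simp
  have hx : ∀ j (a : ℤ), y (.x j) ^ a = shift (Multiplicative.ofAdd (Pi.single j a)) := by
    intro j a
    simp only [y]
    rw [← map_zpow, ← ofAdd_zsmul, ← Pi.single_smul]
    simp
  have hk : ∀ c, V c = 1 → Commute (y .k) (tok y c) := fun c hc => by
    rw [htok, Commute, SemiconjBy, ← mul_inv_eq_iff_eq_mul]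
    have := congrArg i (TokenHNN.t_conj_word Γ V h (FreeGroup.of (Sum.inl c)))
    rw [map_mul, map_mul, map_inv] at this
    simpa [y, word, hc] using this
  have hlet : ∀ e, word (FreeGroup.map Sum.inr e) = FreeGroup.lift (fun i => y (.f i)) e := by
    intro e
    have : word.comp (FreeGroup.map Sum.inr) = FreeGroup.lift (fun i => y (.f i)) := by
      ext i; simp [y]
    exact DFunLike.congr_fun this e
  refine ⟨K, inferInstance, i.comp (TokenHNN.coef Γ V h), y,
    hi.comp (TokenHNN.coef_injective Γ V h), ⟨fun a b => ?_, fun j a _ => ?_, fun a _ b _ => ?_,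
    fun a _ => ?_, hk _ h₀, hk _ h₁, fun ρ hρ => ?_, fun ρ hρ a _ => ?_, fun ρ hρ j => ?_,
    fun ρ hρ => ?_⟩, fun _ => rfl⟩
  · simp only [y]
    exact (Commute.all _ _).map shift
  · rw [Commute, SemiconjBy, ← mul_inv_eq_iff_eq_mul]
    simp only [y, hword, tokenAct_inr]
  · exact (TokenHNN.commute_word_coef Γ V h _ _).map i
  · have := congrArg i (TokenHNN.t_conj_word Γ V h (FreeGroup.of (Sum.inr a)))
    rw [map_mul, map_mul, map_inv] at this
    simpa [y, word] using this
  · have := hr ρ hρ HNNExtension.t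
    rw [ht₁ ρ hρ, ht₂ ρ hρ, mul_inv_eq_iff_eq_mul] at this
    exact this
  · have := hr ρ hρ (TokenHNN.word _ _ _ (FreeGroup.of (Sum.inr a)))
    rw [hw₁ ρ hρ, hw₂ ρ hρ, mul_inv_eq_iff_eq_mul, tokenMap_inr, tokenMap_inr] at this
    exact this
  · rw [hx, hx]
    by_cases hj : ρ.m j = 0
    · simp [hj, (hbal ρ hρ j).1 hj]
    · have := hr ρ hρ (TokenHNN.shift _ _ _ ⟨Multiplicative.ofAdd (Pi.single j 1), fun j' hj' => by
        have : j' ≠ j := fun e => hj (e ▸ hj')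
        simp [this]⟩)
      rw [hs₁ ρ hρ, hs₂ ρ hρ] at this
      have hm : ∀ m : ι → ℤ, m * Pi.single j 1 = Pi.single j (m j) := fun m => by
        funext j'
        by_cases hj' : j' = j
        · subst hj'; simp
        · simp [hj']
      simp only [scale, MonoidHom.coe_mk, OneHom.coe_mk, toAdd_ofAdd, hm] at this
      exact this
  · have := hr ρ hρ (TokenHNN.word _ _ _ (FreeGroup.of (Sum.inl 1)))
    rw [hw₁ ρ hρ, hw₂ ρ hρ, tokenMap_inl, tokenMap_inl] at this
    rw [htok, htok, ← hlet, ← map_mul]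
    simp only [place, map_one, one_mul, OneMemClass.coe_one, toAdd_one, mul_zero, add_zero] at this
    exact this

end Model

/-- A finite system of relations which, in the letters `β`, has exactly the consequences
needed to enforce the relations in `W`, provided that the words in `W` are the labels of the paths
between two configurations. -/
theorem exists_relations (n : ℕ) [Fintype ι] {s : Set (AffineRule Q ι)} (hs : s.Finite)
    (hbal : ∀ ρ ∈ s, ρ.Balanced) (hout : ∀ ρ ∈ s, ∀ i ∈ ρ.out, i < n) {c₀ c₁ : Conf Q ι}
    {W : Set (List ℕ)} (hW : ∀ w ∈ W, Path s c₀ w c₁)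
    (hV : ∀ (H : Type u) [Group H] (h : ℕ → H), (∀ w ∈ W, (w.map h).prod = 1) →
      ∃ V : Conf Q ι → H, Invariant s h V ∧ V c₀ = 1 ∧ V c₁ = 1) :
    ∃ (X : Type) (β : ℕ → X) (E : Finset (FreeGroup X)),
      (∀ (L : Type u) [Group L] (y : X → L), (∀ e ∈ E, FreeGroup.lift y e = 1) →
        ∀ w ∈ W, (w.map fun i => y (β i)).prod = 1) ∧
      ∀ (H : Type u) [Group H] (h : ℕ → H), (∀ w ∈ W, (w.map h).prod = 1) →
        ∃ (H' : Type u) (_ : Group H') (i : H →* H') (y : X → H'), Function.Injective i ∧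
          (∀ e ∈ E, FreeGroup.lift y e = 1) ∧ ∀ j, y (β j) = i (h j) := by
  obtain ⟨E, hE⟩ := exists_finset_iff_sol.{u} n hs c₀ c₁
  refine ⟨Gen Q ι, .b, E, fun L _ y hy w hw => ((hE L y).1 hy).prod_eq_one hout (hW w hw),
    fun H _ h hh => ?_⟩
  obtain ⟨V, hV, h₀, h₁⟩ := hV H h hh
  obtain ⟨H', _, i, y, hi, hy, hb⟩ := exists_sol n hs hbal h hV h₀ h₁
  exact ⟨H', inferInstance, i, y, hi, (hE H' y).2 hy, hb⟩

end AffineRule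

theorem AffineRule.Path.single {Q ι : Type} {s : Set (AffineRule Q ι)} {ρ : AffineRule Q ι}
    (hρ : ρ ∈ s) (v : ι → ℤ) {c c' : Conf Q ι} (hc : ρ.source v = c) (hc' : ρ.target v = c') :
    AffineRule.Path s c ρ.out.toList c' := by
  subst hc hc'
  simpa using AffineRule.Path.step hρ v (.refl _)

theorem AffineRule.Path.mono {Q ι : Type} {s s' : Set (AffineRule Q ι)} (hs : s ⊆ s')
    {c c' : Conf Q ι} {l : List ℕ} (h : AffineRule.Path s c l c') :
    AffineRule.Path s' c l c' := by
  induction h with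
  | refl => exact .refl _
  | step hρ v _ ih => exact .step (hs hρ) v ih

theorem AffineRule.Invariant.path {Q ι : Type} {s : Set (AffineRule Q ι)} {H : Type*} [Group H]
    {h : ℕ → H} {V : Conf Q ι → H} (hV : AffineRule.Invariant s h V) {c c' : Conf Q ι}
    {l : List ℕ} (hp : AffineRule.Path s c l c') : V c = (l.map h).prod * V c' := by
  induction hp with
  | refl => simp
  | @step ρ l c hρ v _ ih =>
    rw [hV ρ hρ v, ih]
    rcases ho : ρ.out with _ | i <;> simp [AffineRule.word, ho, mul_assoc]

namespace AffineRule.StackSim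

open Turing Turing.PartrecToTM2

instance : Fintype K' := ⟨{.main, .rev, .aux, .stack}, by rintro ⟨⟩ <;> simp⟩

/-- The base 5 digit of a stack symbol. -/
def digit : Γ' → ℤ
  | .bit0 => 1
  | .bit1 => 2
  | .cons => 3
  | .consₗ => 4

/-- The stack symbol of a digit. -/
def undigit (z : ℤ) : Option Γ' :=
  if z = 1 then some .bit0 else if z = 2 then some .bit1 else if z = 3 then some .cons else
    if z = 4 then some .consₗ else none

theorem undigit_digit (a : Γ') : undigit (digit a) = some a := by cases a <;> rfl

theorem digit_bounds (a : Γ') : 0 < digit a ∧ digit a < 5 := by cases a <;> simp [digit]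

/-- The number whose base 5 digits represent a stack. -/
def enc : List Γ' → ℤ
  | [] => 0
  | a :: l => 5 * enc l + digit a

/-- The registers representing a family of stacks. -/
def encStacks (S : K' → List Γ') : Option K' → ℤ
  | none => 0
  | some k => enc (S k)

/-- The states of the counter machine. -/
inductive St
  | start
  | load
  | run (q : Stmt') (v : Option Γ')
  | read (i : ℕ)

/-- The top symbol of the stack represented by a number, if the number represents a stack. -/
def top (z : ℤ) : Option (Option Γ') :=
  if z = 0 then some none else (undigit (z % 5)).map some

theorem top_zero : top 0 = some none := rfl

theorem top_digit (z : ℤ) (a : Γ') : top (5 * z + digit a) = some (some a) := by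
  have := digit_bounds a
  rw [top, if_neg (by omega), show (5 * z + digit a) % 5 = digit a by omega, undigit_digit]
  rfl

/-- The deterministic part of the transition function of the counter machine. -/
def next (q₀ : Stmt') : Conf St (Option K') → Option (Conf St (Option K'))
  | ⟨.run (.push k f q) v, u⟩ =>
    some ⟨.run q v, Function.update u (some k) (5 * u (some k) + digit (f v))⟩
  | ⟨.run (.peek k f q) v, u⟩ => (top (u (some k))).map fun o => ⟨.run q (f v o), u⟩
  | ⟨.run (.pop k f q) v, u⟩ => (top (u (some k))).map fun o =>
      ⟨.run q (f v o), Function.update u (some k) (u (some k) / 5)⟩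
  | ⟨.run (.load f q) v, u⟩ => some ⟨.run q (f v), u⟩
  | ⟨.run (.branch p q₁ q₂) v, u⟩ => some ⟨.run (cond (p v) q₁ q₂) v, u⟩
  | ⟨.run (.goto l) v, u⟩ => some ⟨.run (tr (l v)) v, u⟩
  | ⟨.run .halt _, u⟩ => some ⟨.read 0, u⟩
  | ⟨.load, u⟩ =>
    if u none = 0 then some ⟨.run q₀ none, u⟩
    else if u none % 5 = 1 ∨ u none % 5 = 2 then
      some ⟨.load, Function.update (Function.update u none (u none / 5)) (some .main)
        (5 * u (some .main) + u none % 5)⟩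
    else none
  | _ => none

section Rules

variable {Q ι : Type} [DecidableEq ι]

/-- The rule which only changes the state. -/
def idRule (q q' : Q) : AffineRule Q ι := ⟨q, q', 0, 1, 0, 1, none⟩

/-- The rule which appends a digit to a register. -/
def pushRule (q q' : Q) (j : ι) (d : ℤ) : AffineRule Q ι :=
  ⟨q, q', 0, 1, Pi.single j d, Function.update 1 j 5, none⟩

/-- The rule which removes a digit from a register. -/
def popRule (q q' : Q) (j : ι) (d : ℤ) (o : Option ℕ) : AffineRule Q ι :=
  ⟨q, q', Pi.single j d, Function.update 1 j 5, 0, 1, o⟩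

/-- The rule which tests the last digit of a register. -/
def peekRule (q q' : Q) (j : ι) (d : ℤ) : AffineRule Q ι :=
  ⟨q, q', Pi.single j d, Function.update 1 j 5, Pi.single j d, Function.update 1 j 5, none⟩

/-- The rule which tests whether a register is zero. -/
def zeroRule (q q' : Q) (j : ι) : AffineRule Q ι :=
  ⟨q, q', 0, Function.update 1 j 0, 0, Function.update 1 j 0, none⟩

/-- The rule which moves a digit from a register to another one. -/
def moveRule (q q' : Q) (j j' : ι) (d : ℤ) : AffineRule Q ι :=
  ⟨q, q', Pi.single j d, Function.update 1 j 5, Pi.single j' d, Function.update 1 j' 5, none⟩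

theorem single_add_update_mul (j : ι) (d e : ℤ) (v : ι → ℤ) :
    Pi.single j d + Function.update (1 : ι → ℤ) j e * v = Function.update v j (e * v j + d) := by
  ext i
  by_cases h : i = j
  · subst h; simp [add_comm]
  · simp [h]

theorem update_zero_mul (j : ι) (v : ι → ℤ) :
    Function.update (1 : ι → ℤ) j 0 * v = Function.update v j 0 := by
  simpa using single_add_update_mul j 0 0 v

end Rules

/-- The rules simulating a statement in a given internal state. -/
def rulesAt : Stmt' → Option Γ' → Set (AffineRule St (Option K'))
  | .push k f q, v => {pushRule (.run (.push k f q) v) (.run q v) (some k) (digit (f v))}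
  | .peek k f q, v => insert (zeroRule (.run (.peek k f q) v) (.run q (f v none)) (some k))
      (Set.range fun a => peekRule (.run (.peek k f q) v) (.run q (f v (some a))) (some k)
        (digit a))
  | .pop k f q, v => insert (zeroRule (.run (.pop k f q) v) (.run q (f v none)) (some k))
      (Set.range fun a => popRule (.run (.pop k f q) v) (.run q (f v (some a))) (some k)
        (digit a) none)
  | .load f q, v => {idRule (.run (.load f q) v) (.run q (f v))}
  | .branch p q₁ q₂, v => {idRule (.run (.branch p q₁ q₂) v) (.run (cond (p v) q₁ q₂) v)}
  | .goto l, v => {idRule (.run (.goto l) v) (.run (tr (l v)) v)}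
  | .halt, v => {idRule (.run .halt v) (.read 0)}

theorem rulesAt_finite (q : Stmt') (v : Option Γ') : (rulesAt q v).Finite := by
  cases q <;> simp [rulesAt, Set.finite_range]

theorem rulesAt_balanced {q : Stmt'} {v : Option Γ'} {ρ : AffineRule St (Option K')}
    (h : ρ ∈ rulesAt q v) : ρ.Balanced ∧ ρ.out = none := by
  have key (j i : Option K') : Function.update (1 : Option K' → ℤ) j 5 i ≠ 0 := by
    by_cases h : i = j
    · subst h; simp
    · simp [h]
  cases q <;> simp only [rulesAt, Set.mem_insert_iff, Set.mem_range, Set.mem_singleton_iff] at h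
  all_goals first | subst h | rcases h with rfl | ⟨a, rfl⟩
  all_goals simp [AffineRule.Balanced, idRule, pushRule, peekRule, popRule, zeroRule, key]

theorem rulesAt_next {q₀ q : Stmt'} {v : Option Γ'} {ρ : AffineRule St (Option K')}
    (h : ρ ∈ rulesAt q v) (w : Option K' → ℤ) : next q₀ (ρ.source w) = some (ρ.target w) := by
  have hd (z : ℤ) (a : Γ') : (5 * z + digit a) / 5 = z := by have := digit_bounds a; omega
  cases q <;> simp only [rulesAt, Set.mem_insert_iff, Set.mem_range, Set.mem_singleton_iff] at h
  all_goals first | subst h | rcases h with rfl | ⟨a, rfl⟩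
  all_goals simp [idRule, pushRule, peekRule, popRule, zeroRule, source, target, next,
    single_add_update_mul, update_zero_mul, top_zero, top_digit, hd]

/-- The configuration representing a configuration of the stack machine. -/
def conf : Cfg' → Conf St (Option K')
  | ⟨none, _, S⟩ => ⟨.read 0, encStacks S⟩
  | ⟨some l, v, S⟩ => ⟨.run (tr l) v, encStacks S⟩

theorem encStacks_update (S : K' → List Γ') (k : K') (l : List Γ') :
    encStacks (Function.update S k l) = Function.update (encStacks S) (some k) (enc l) := by
  ext (_ | i)
  · rfl
  · by_cases h : i = k
    · subst h; simp [encStacks]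
    · simp [encStacks, h]

theorem path_stepAux {s : Set (AffineRule St (Option K'))} (q : Stmt')
    (hs : ∀ q' ∈ TM2.stmts₁ q, ∀ v, rulesAt q' v ⊆ s) (v : Option Γ') (S : K' → List Γ') :
    Path s ⟨.run q v, encStacks S⟩ [] (conf (TM2.stepAux q v S)) := by
  have hself := hs q TM2.stmts₁_self v
  induction q generalizing v S with
  | push k f q ih =>
    have hs' : ∀ q' ∈ TM2.stmts₁ q, ∀ v, rulesAt q' v ⊆ s :=
      fun q' h => hs q' (by simp [TM2.stmts₁, h])
    refine Path.trans (l := []) (Path.single (hself rfl) (encStacks S) ?_ rfl) ?_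
    · simp [pushRule, source]
    · convert ih hs' v (Function.update S k (f v :: S k)) (hs' q TM2.stmts₁_self v) using 1
      · simp [pushRule, target, single_add_update_mul, encStacks_update, enc, encStacks]
      · rfl
  | peek k f q ih =>
    have hs' : ∀ q' ∈ TM2.stmts₁ q, ∀ v, rulesAt q' v ⊆ s :=
      fun q' h => hs q' (by simp [TM2.stmts₁, h])
    refine Path.trans (l := []) ?_ (ih hs' _ _ (hs' q TM2.stmts₁_self _))
    rcases hS : S k with _ | ⟨a, l⟩
    · refine Path.single (hself (Set.mem_insert _ _)) (encStacks S) ?_ ?_ <;>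
        simp [zeroRule, source, target, update_zero_mul, Function.update_eq_self_iff, encStacks, hS,
          enc]
    · refine Path.single (hself (Set.mem_insert_of_mem _ ⟨a, rfl⟩))
        (Function.update (encStacks S) (some k) (enc l)) ?_ ?_ <;>
      simp [peekRule, source, target, single_add_update_mul, Function.update_eq_self_iff,
          encStacks, hS, enc]
  | pop k f q ih =>
    have hs' : ∀ q' ∈ TM2.stmts₁ q, ∀ v, rulesAt q' v ⊆ s :=
      fun q' h => hs q' (by simp [TM2.stmts₁, h])
    refine Path.trans (l := []) ?_ (ih hs' _ _ (hs' q TM2.stmts₁_self _))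
    rcases hS : S k with _ | ⟨a, l⟩
    · refine Path.single (hself (Set.mem_insert _ _)) (encStacks S) ?_ ?_ <;>
        simp [zeroRule, source, target, update_zero_mul, Function.update_eq_self_iff, encStacks, hS,
          enc, encStacks_update]
    · refine Path.single (hself (Set.mem_insert_of_mem _ ⟨a, rfl⟩))
        (Function.update (encStacks S) (some k) (enc l)) ?_ ?_ <;>
      simp [popRule, source, target, single_add_update_mul, Function.update_eq_self_iff,
          encStacks, hS, enc, encStacks_update]
  | load f q ih =>
    have hs' : ∀ q' ∈ TM2.stmts₁ q, ∀ v, rulesAt q' v ⊆ s :=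
      fun q' h => hs q' (by simp [TM2.stmts₁, h])
    refine Path.trans (l := []) (Path.single (hself rfl) (encStacks S) ?_ ?_)
      (ih hs' _ _ (hs' q TM2.stmts₁_self _)) <;> simp [idRule, source, target]
  | branch p q₁ q₂ ih₁ ih₂ =>
    have hs₁ : ∀ q' ∈ TM2.stmts₁ q₁, ∀ v, rulesAt q' v ⊆ s :=
      fun q' h => hs q' (by simp [TM2.stmts₁, h])
    have hs₂ : ∀ q' ∈ TM2.stmts₁ q₂, ∀ v, rulesAt q' v ⊆ s :=
      fun q' h => hs q' (by simp [TM2.stmts₁, h])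
    rcases hp : p v
    · refine Path.trans (l := []) (Path.single (hself rfl) (encStacks S) ?_ ?_)
        (by simpa [TM2.stepAux, hp] using ih₂ hs₂ v S (hs₂ q₂ TM2.stmts₁_self v))
      · simp [idRule, source]
      · simp [idRule, target, hp]; rfl
    · refine Path.trans (l := []) (Path.single (hself rfl) (encStacks S) ?_ ?_)
        (by simpa [TM2.stepAux, hp] using ih₁ hs₁ v S (hs₁ q₁ TM2.stmts₁_self v))
      · simp [idRule, source]
      · simp [idRule, target, hp]; rfl
  | goto l =>
    refine Path.single (hself rfl) (encStacks S) ?_ ?_ <;> simp [idRule, source, target, conf]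
  | halt =>
    refine Path.single (hself rfl) (encStacks S) ?_ ?_ <;> simp [idRule, source, target, conf]

theorem path_reaches {s : Set (AffineRule St (Option K'))} {Λ : Finset Λ'}
    (hΛ : ∀ l ∈ Λ, TM2.SupportsStmt Λ (tr l))
    (hs : ∀ l ∈ Λ, ∀ q ∈ TM2.stmts₁ (tr l), ∀ v, rulesAt q v ⊆ s) {c c' : Cfg'}
    (h : StateTransition.Reaches (TM2.step tr) c c') (hc : c.l ∈ Finset.insertNone Λ) :
    Path s (conf c) [] (conf c') := by
  induction h using Relation.ReflTransGen.head_induction_on with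
  | refl => exact .refl _
  | @head a b hab _ ih =>
    obtain ⟨_ | l, v, S⟩ := a
    · cases hab
    · have hl : l ∈ Λ := Finset.some_mem_insertNone.1 hc
      let : Inhabited Λ' := ⟨l⟩
      have hb := TM2.step_supports tr ⟨hl, hΛ⟩ hab hc
      have hab' : TM2.stepAux (tr l) v S = b := Option.some.inj hab
      subst hab'
      exact Path.trans (l := []) (path_stepAux (tr l) (hs l hl) v S) (ih hb)

/-- The registers representing the input `z` and the contents `e` of the main stack. -/
def base (z e : ℤ) : Option K' → ℤ
  | none => z
  | some .main => e
  | some _ => 0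

theorem base_update_none (z e z' : ℤ) : Function.update (base z e) none z' = base z' e := by
  ext (_ | i)
  · rfl
  · cases i <;> simp [base]

theorem base_update_main (z e e' : ℤ) :
    Function.update (base z e) (some .main) e' = base z e' := by
  ext (_ | _ | _ | _ | _) <;> simp [base]

/-- The register representing the stack with a single number. -/
def encNat (n : ℕ) : ℤ := enc (trList [n])

theorem encNat_zero : encNat 0 = 3 := by simp [encNat, trList, enc, digit]

theorem encNat_two_mul {n : ℕ} (hn : n ≠ 0) : encNat (2 * n) = 5 * encNat n + 1 := by
  obtain ⟨m, rfl⟩ : ∃ m : Num, (m : ℕ) = n := ⟨n, Num.to_of_nat n⟩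
  have h : 2 * (m : ℕ) = (m.bit0 : Num) := by rw [Num.cast_bit0]
  simp only [encNat, trList, trNat, h, Num.of_to_nat]
  cases m with
  | zero => simp at hn
  | pos p => simp [Num.bit0, trNum, trPosNum, enc, digit]

theorem encNat_two_mul_add_one (n : ℕ) : encNat (2 * n + 1) = 5 * encNat n + 2 := by
  obtain ⟨m, rfl⟩ : ∃ m : Num, (m : ℕ) = n := ⟨n, Num.to_of_nat n⟩
  have h : 2 * (m : ℕ) + 1 = (m.bit1 : Num) := by rw [Num.cast_bit1]
  simp only [encNat, trList, trNat, h, Num.of_to_nat]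
  cases m <;> simp [Num.bit1, trNum, trPosNum, enc, digit]

/-- The rules which load the input, run the machine and read its output. -/
def machineRules (Λ : Finset Λ') (q₀ : Stmt') (n : ℕ) : Set (AffineRule St (Option K')) :=
  (⋃ l ∈ Λ, ⋃ q ∈ TM2.stmts₁ (tr l), ⋃ v, rulesAt q v) ∪
  ({zeroRule .load (.run q₀ none) none, moveRule .load .load none (some .main) 1,
    moveRule .load .load none (some .main) 2} ∪
  ⋃ i ∈ Finset.range n, {popRule (.read i) (.read (i + 1)) (some .main) 1 none,
    popRule (.read i) (.read 0) (some .main) 2 (some i)})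

/-- The rule which starts loading the input. -/
def loadRule : AffineRule St (Option K') :=
  ⟨.start, .load, base 0 (encNat 1), Pi.single none 1, base 0 (encNat 1), Pi.single none 1, none⟩

/-- The rules which guess the input. -/
def guessRules : Set (AffineRule St (Option K')) :=
  {pushRule .start .start none 1, pushRule .start .start none 2, loadRule}

section Value

variable {H : Type*} [Group H]

/-- The word read off a number, starting from the letter `i`. -/
def emit (h : ℕ → H) (i : ℕ) (v : ℤ) : H :=
  if v % 5 = 1 then emit h (i + 1) (v / 5)
  else if v % 5 = 2 then h i * emit h 0 (v / 5) else 1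
termination_by v.natAbs
decreasing_by all_goals omega

/-- The value of a terminal configuration. -/
def terminalValue (h : ℕ → H) : Conf St (Option K') → H
  | ⟨.read i, u⟩ => emit h i (u (some .main))
  | _ => 1

open Classical in
/-- The value of a configuration, obtained by running the machine. -/
noncomputable def value (q₀ : Stmt') (h : ℕ → H) (c : Conf St (Option K')) : H :=
  if hd : (StateTransition.eval (next q₀) c).Dom then
    terminalValue h ((StateTransition.eval (next q₀) c).get hd) else 1

theorem value_next {q₀ : Stmt'} {h : ℕ → H} {c c' : Conf St (Option K')}
    (hc : next q₀ c = some c') : value q₀ h c = value q₀ h c' := by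
  unfold value
  rw [StateTransition.reaches_eval (Relation.ReflTransGen.single hc)]

theorem value_terminal {q₀ : Stmt'} {h : ℕ → H} {c : Conf St (Option K')}
    (hc : next q₀ c = none) : value q₀ h c = terminalValue h c := by
  have hm : c ∈ StateTransition.eval (next q₀) c :=
    StateTransition.mem_eval.2 ⟨.refl, hc⟩
  unfold value
  rw [dif_pos (Part.dom_iff_mem.2 ⟨c, hm⟩), Part.get_eq_of_mem hm]

theorem value_read (q₀ : Stmt') (h : ℕ → H) (i : ℕ) (u : Option K' → ℤ) :
    value q₀ h ⟨.read i, u⟩ = emit h i (u (some .main)) :=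
  value_terminal (by simp [next])

theorem value_start (q₀ : Stmt') (h : ℕ → H) (u : Option K' → ℤ) :
    value q₀ h ⟨.start, u⟩ = 1 :=
  value_terminal (by simp [next])

theorem invariant_machineRules (Λ : Finset Λ') (q₀ : Stmt') (n : ℕ) (h : ℕ → H) :
    Invariant (machineRules Λ q₀ n) h (value q₀ h) := by
  have hstep {ρ : AffineRule St (Option K')} {w : Option K' → ℤ} (ho : ρ.out = none)
      (hn : next q₀ (ρ.source w) = some (ρ.target w)) :
      value q₀ h (ρ.source w) = FreeGroup.lift h ρ.word * value q₀ h (ρ.target w) := by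
    rw [value_next hn]; simp [word, ho]
  have h₁ (z : ℤ) : (5 * z + 1) % 5 = 1 ∧ (5 * z + 1) / 5 = z ∧ 5 * z + 1 ≠ 0 := by omega
  have h₂ (z : ℤ) : (5 * z + 2) % 5 = 2 ∧ (5 * z + 2) / 5 = z ∧ 5 * z + 2 ≠ 0 := by omega
  rintro ρ (hρ | hρ | hρ) w
  · simp only [Set.mem_iUnion] at hρ
    obtain ⟨l, -, q, -, v, hρ⟩ := hρ
    exact hstep (rulesAt_balanced hρ).2 (rulesAt_next hρ w)
  · rcases hρ with rfl | rfl | rfl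
    · refine hstep rfl ?_
      simp [zeroRule, source, target, update_zero_mul, next]
    · refine hstep rfl ?_
      simp [moveRule, source, target, single_add_update_mul, next, h₁]
    · refine hstep rfl ?_
      simp [moveRule, source, target, single_add_update_mul, next, h₂]
  · simp only [Set.mem_iUnion] at hρ
    obtain ⟨i, -, rfl | rfl⟩ := hρ
    · simp only [popRule, source, target, single_add_update_mul, value_read]
      rw [emit]
      simp [h₁, word]
    · simp only [popRule, source, target, single_add_update_mul, value_read]
      rw [emit]
      simp [h₂, word]

theorem value_load {Λ : Finset Λ'} {q₀ : Stmt'} {n : ℕ} {g : ℕ → List ℕ} {h : ℕ → H}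
    {c : Conf St (Option K')} (hc : value q₀ h c = 1)
    (hg : ∀ p, ((g p).map h).prod = 1)
    (hp : ∀ p, Path (machineRules Λ q₀ n) ⟨.load, base 0 (encNat (p + 1))⟩ (g p) c)
    (z : ℤ) (p : ℕ) : value q₀ h ⟨.load, base z (encNat (p + 1))⟩ = 1 := by
  induction hz : z.natAbs using Nat.strong_induction_on generalizing z p with
  | _ k ih =>
  by_cases h0 : z = 0
  · subst h0
    rw [(invariant_machineRules Λ q₀ n h).path (hp p), hg, hc, one_mul]
  by_cases h1 : z % 5 = 1
  · rw [value_next (c' := ⟨.load, base (z / 5) (encNat (2 * p + 1 + 1))⟩), ih _ (by omega) _ _ rfl]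
    rw [show 2 * p + 1 + 1 = 2 * (p + 1) by ring, encNat_two_mul (by omega)]
    simp [next, base, h0, h1, base_update_none, base_update_main]
  by_cases h2 : z % 5 = 2
  · rw [value_next (c' := ⟨.load, base (z / 5) (encNat (2 * (p + 1) + 1))⟩), ih _ (by omega) _ _ rfl]
    rw [encNat_two_mul_add_one]
    simp [next, base, h0, h2, base_update_none, base_update_main]
  · rw [value_terminal]
    · rfl
    · simp [next, base, h0, h1, h2]

end Value

/-- A number encoding a list of numbers. -/
def code : List ℕ → ℕ
  | [] => 0
  | i :: l => 2 ^ i * (2 * code l + 1)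

theorem code_primrec : Primrec code := by
  have h : Primrec₂ fun (_ : List ℕ) (x : ℕ × ℕ) => 2 ^ x.1 * (2 * x.2 + 1) := by
    have hp : Primrec₂ fun a b : ℕ => a ^ b := Primrec₂.unpaired'.1 Nat.Primrec.pow
    exact Primrec.nat_mul.comp (hp.comp (.const 2) (Primrec.fst.comp .snd))
      (Primrec.succ.comp (Primrec.nat_mul.comp (.const 2) (Primrec.snd.comp .snd)))
  refine (Primrec.list_foldr (h := fun _ x => 2 ^ x.1 * (2 * x.2 + 1)) .id (.const 0) h).of_eq
    fun l => ?_
  induction l with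
  | nil => rfl
  | cons i l ih => simpa [code] using ih

theorem exists_toPartrec_code {f : ℕ → ℕ} (hf : Computable f) :
    ∃ c : ToPartrec.Code, ∀ n, c.eval [n] = pure [f n] := by
  obtain ⟨c, hc⟩ := ToPartrec.Code.exists_code
    (Nat.Partrec'.part_iff₁.2 (show Partrec fun n => Part.some (f n) from hf))
  exact ⟨c, fun n => (hc ⟨[n], rfl⟩).trans (by simp [List.Vector.head])⟩

section Mem

variable {Λ : Finset Λ'} {q₀ : Stmt'} {n : ℕ}

theorem zeroRule_mem : zeroRule .load (.run q₀ none) none ∈ machineRules Λ q₀ n :=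
  .inr (.inl (.inl rfl))

theorem moveRule_one_mem : moveRule .load .load none (some .main) 1 ∈ machineRules Λ q₀ n :=
  .inr (.inl (.inr (.inl rfl)))

theorem moveRule_two_mem : moveRule .load .load none (some .main) 2 ∈ machineRules Λ q₀ n :=
  .inr (.inl (.inr (.inr rfl)))

theorem pushRule_one_mem : pushRule .start .start none 1 ∈ guessRules := .inl rfl

theorem pushRule_two_mem : pushRule .start .start none 2 ∈ guessRules := .inr (.inl rfl)

theorem loadRule_mem : loadRule ∈ guessRules := .inr (.inr rfl)

end Mem

theorem path_machine {Λ : Finset Λ'} {c : ToPartrec.Code} {n : ℕ} {k l : ℕ}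
    (hΛ : Λ = codeSupp c .halt) (hc : c.eval [k] = pure [l]) :
    Path (machineRules Λ (tr (trNormal c .halt)) n) ⟨.load, base 0 (encNat k)⟩ []
      ⟨.read 0, base 0 (encNat l)⟩ := by
  have hb (m : ℕ) : encStacks (K'.elim (trList [m]) [] [] []) = base 0 (encNat m) := by
    ext (_ | _ | _ | _ | _) <;> rfl
  have hr : StateTransition.Reaches (TM2.step tr) (init c [k]) (halt [l]) := by
    refine (StateTransition.mem_eval.1 ?_).1
    rw [tr_eval, hc]
    exact ⟨trivial, rfl⟩
  have hp : Path (machineRules Λ (tr (trNormal c .halt)) n) (conf (init c [k])) []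
      (conf (halt [l])) := by
    refine path_reaches (Λ := Λ) ?_ ?_ hr ?_
    · rw [hΛ]
      exact (tr_supports c .halt).2
    · intro l hl q hq v ρ hρ
      refine .inl ?_
      simp only [Set.mem_iUnion]
      exact ⟨l, hl, q, hq, v, hρ⟩
    · rw [hΛ]
      exact Finset.some_mem_insertNone.2 (codeSupp_self c .halt (trStmts₁_self _))
  refine Path.trans (l := []) (Path.single zeroRule_mem (base 0 (encNat k)) ?_ ?_)
    (c₂ := ⟨.run (tr (trNormal c .halt)) none, base 0 (encNat k)⟩) ?_
  · simp [zeroRule, source, update_zero_mul, base_update_none]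
  · simp [zeroRule, target, update_zero_mul, base_update_none]
  · simp only [← hb]
    exact hp

theorem path_read_letter {Λ : Finset Λ'} {q₀ : Stmt'} {n : ℕ} (i j k : ℕ) (hi : j + i < n) :
    Path (machineRules Λ q₀ n) ⟨.read j, base 0 (encNat (2 ^ i * (2 * k + 1)))⟩ [j + i]
      ⟨.read 0, base 0 (encNat k)⟩ := by
  have hmem (j : ℕ) (hj : j < n) (ρ) (hρ : ρ ∈ ({popRule (.read j) (.read (j + 1)) (some .main) 1
      none, popRule (.read j) (.read 0) (some .main) 2 (some j)} : Set (AffineRule St _))) :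
      ρ ∈ machineRules Λ q₀ n := by
    refine .inr (.inr ?_)
    simp only [Set.mem_iUnion]
    exact ⟨j, Finset.mem_range.2 hj, hρ⟩
  induction i generalizing j with
  | zero =>
    refine Path.single (hmem j (by omega) _ (.inr rfl)) (base 0 (encNat k)) ?_ ?_
    · simp [popRule, source, single_add_update_mul, encNat_two_mul_add_one, base_update_main,
        base]
    · simp [popRule, target]
  | succ i ih =>
    have := ih (j + 1) (by omega)
    rw [show j + 1 + i = j + (i + 1) by ring] at this
    refine Path.trans (l := []) (Path.single (hmem j (by omega) _ (.inl rfl))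
      (base 0 (encNat (2 ^ i * (2 * k + 1)))) ?_ ?_) this
    · rw [show 2 ^ (i + 1) * (2 * k + 1) = 2 * (2 ^ i * (2 * k + 1)) by ring,
        encNat_two_mul (by positivity)]
      simp [popRule, source, single_add_update_mul, base_update_main, base]
    · simp [popRule, target]

theorem path_read {Λ : Finset Λ'} {q₀ : Stmt'} {n : ℕ} (l : List ℕ) (hl : ∀ i ∈ l, i < n) :
    Path (machineRules Λ q₀ n) ⟨.read 0, base 0 (encNat (code l))⟩ l
      ⟨.read 0, base 0 (encNat 0)⟩ := by
  induction l with
  | nil => exact .refl _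
  | cons i l ih =>
    have := path_read_letter (Λ := Λ) (q₀ := q₀) i 0 (code l)
      (by simpa using hl i List.mem_cons_self)
    rw [zero_add] at this
    exact this.trans (ih fun j hj => hl j (List.mem_cons_of_mem _ hj))

theorem path_guess (Λ : Finset Λ') (q₀ : Stmt') (n : ℕ) (k : ℕ) (hk : k ≠ 0) (z : ℤ) :
    ∃ z', Path guessRules ⟨.start, base z (encNat 1)⟩ [] ⟨.start, base z' (encNat 1)⟩ ∧
      Path (machineRules Λ q₀ n) ⟨.load, base z' (encNat 1)⟩ [] ⟨.load, base z (encNat k)⟩ := by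
  induction k using Nat.strong_induction_on generalizing z with
  | _ k ih =>
  by_cases h1 : k = 1
  · subst h1
    exact ⟨z, .refl _, .refl _⟩
  obtain ⟨m, rfl | rfl⟩ := Nat.even_or_odd' k
  · obtain ⟨z', hz, hz'⟩ := ih m (by omega) (by omega) (5 * z + 1)
    refine ⟨z', .trans (l := []) (.single pushRule_one_mem (base z (encNat 1)) ?_ ?_) hz,
      hz'.trans (.single moveRule_one_mem (base z (encNat m)) ?_ ?_)⟩ <;>
    simp [pushRule, moveRule, source, target, single_add_update_mul, base_update_main,
      base_update_none, encNat_two_mul (show m ≠ 0 by omega)] <;> simp [base]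
  · obtain ⟨z', hz, hz'⟩ := ih m (by omega) (by omega) (5 * z + 2)
    refine ⟨z', .trans (l := []) (.single pushRule_two_mem (base z (encNat 1)) ?_ ?_) hz,
      hz'.trans (.single moveRule_two_mem (base z (encNat m)) ?_ ?_)⟩ <;>
    simp [pushRule, moveRule, source, target, single_add_update_mul, base_update_main,
      base_update_none, encNat_two_mul_add_one] <;> simp [base]

/-- Every computable sequence of words is generated by a finite system of affine rules. -/
theorem exists_rules {n : ℕ} {g : ℕ → List ℕ} (hg : Computable g)
    (hn : ∀ p, ∀ i ∈ g p, i < n) :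
    ∃ (s : Set (AffineRule St (Option K'))) (c₀ c₁ : Conf St (Option K')), s.Finite ∧
      (∀ ρ ∈ s, ρ.Balanced) ∧ (∀ ρ ∈ s, ∀ i ∈ ρ.out, i < n) ∧ (∀ p, Path s c₀ (g p) c₁) ∧
      ∀ (H : Type u) [Group H] (h : ℕ → H), (∀ p, ((g p).map h).prod = 1) →
        ∃ V, Invariant s h V ∧ V c₀ = 1 ∧ V c₁ = 1 := by
  obtain ⟨c, hc⟩ := exists_toPartrec_code
    (f := fun p => code (g p.pred)) (code_primrec.to_comp.comp (hg.comp Primrec.pred.to_comp))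
  set q₀ := tr (trNormal c .halt)
  set Λ := codeSupp c .halt with hΛ
  have hp (p : ℕ) : Path (machineRules Λ q₀ n) ⟨.load, base 0 (encNat (p + 1))⟩ (g p)
      ⟨.read 0, base 0 (encNat 0)⟩ :=
    Path.trans (path_machine hΛ (hc (p + 1))) (path_read (g p) (hn p))
  have key (d : ℤ) (hd : d ≠ 0) (j i : Option K') :
      Function.update (1 : Option K' → ℤ) j d i ≠ 0 := by
    by_cases h : i = j
    · subst h; simpa
    · simp [h]
  refine ⟨machineRules Λ q₀ n ∪ guessRules, ⟨.start, base 0 (encNat 1)⟩,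
    ⟨.read 0, base 0 (encNat 0)⟩, ?_, ?_, ?_, fun p => ?_, fun H _ h hh => ?_⟩
  · refine .union (.union ?_ (.union (by simp) ?_)) (by simp [guessRules])
    · exact Λ.finite_toSet.biUnion fun l _ => (TM2.stmts₁ (tr l)).finite_toSet.biUnion fun q _ =>
        Set.finite_iUnion (rulesAt_finite q)
    · exact (Finset.range n).finite_toSet.biUnion fun i _ => by simp
  · rintro ρ ((hρ | (rfl | rfl | rfl) | hρ) | (rfl | rfl | rfl))
    · simp only [Set.mem_iUnion] at hρ
      obtain ⟨l, -, q, -, v, hρ⟩ := hρ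
      exact (rulesAt_balanced hρ).1
    · simp [AffineRule.Balanced, zeroRule]
    · simp [AffineRule.Balanced, moveRule, key]
    · simp [AffineRule.Balanced, moveRule, key]
    · simp only [Set.mem_iUnion] at hρ
      obtain ⟨i, -, rfl | rfl⟩ := hρ <;> simp [AffineRule.Balanced, popRule, key]
    · simp [AffineRule.Balanced, pushRule, key]
    · simp [AffineRule.Balanced, pushRule, key]
    · simp [AffineRule.Balanced, loadRule]
  · rintro ρ ((hρ | (rfl | rfl | rfl) | hρ) | (rfl | rfl | rfl))
    · simp only [Set.mem_iUnion] at hρ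
      obtain ⟨l, -, q, -, v, hρ⟩ := hρ
      simp [(rulesAt_balanced hρ).2]
    · simp [zeroRule]
    · simp [moveRule]
    · simp [moveRule]
    · simp only [Set.mem_iUnion, Finset.mem_range] at hρ
      obtain ⟨i, hi, rfl | rfl⟩ := hρ <;> simp [popRule, hi]
    · simp [pushRule]
    · simp [pushRule]
    · simp [loadRule]
  · obtain ⟨z, h₁, h₂⟩ := path_guess Λ q₀ n (p + 1) p.succ_ne_zero 0
    refine (h₁.mono Set.subset_union_right).trans (l := []) (.trans (l := [])
      (.single (Set.mem_union_right _ loadRule_mem) (base z (encNat 1)) ?_ ?_)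
      (.trans (l := []) (h₂.mono Set.subset_union_left) ((hp p).mono Set.subset_union_left)))
    all_goals
      ext (_ | _ | _ | _ | _) <;> simp [loadRule, source, target, base]
  · have hend : value q₀ h ⟨.read 0, base 0 (encNat 0)⟩ = 1 := by
      rw [value_read, emit]
      simp [base, encNat_zero]
    refine ⟨value q₀ h, ?_, value_start _ _ _, hend⟩
    rintro ρ (hρ | rfl | rfl | rfl) w
    · exact invariant_machineRules Λ q₀ n h ρ hρ w
    · simp [pushRule, source, target, value_start, word]
    · simp [pushRule, source, target, value_start, word]
    · have hw : base 0 (encNat 1) + Pi.single none 1 * w = base (w none) (encNat 1) := by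
        ext (_ | _ | _ | _ | _) <;> simp [base]
      simp only [loadRule, source, target, hw, value_start, word]
      simpa using (value_load hend hh hp (w none) 0).symm

end AffineRule.StackSim

theorem FreeGroup.lift_map_apply {α β G : Type*} [Group G] (f : β → G) (g : α → β)
    (w : FreeGroup α) : FreeGroup.lift f (FreeGroup.map g w) = FreeGroup.lift (f ∘ g) w := by
  have : (FreeGroup.lift f).comp (FreeGroup.map g) = FreeGroup.lift (f ∘ g) := by ext; simp
  exact DFunLike.congr_fun this w

theorem FreeGroup.map_lift_apply {α G G' : Type*} [Group G] [Group G'] (φ : G →* G') (f : α → G)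
    (w : FreeGroup α) : φ (FreeGroup.lift f w) = FreeGroup.lift (φ ∘ f) w := by
  have : φ.comp (FreeGroup.lift f) = FreeGroup.lift (φ ∘ f) := by ext; simp
  exact DFunLike.congr_fun this w

/-- A finite system of equations without parameters together with an inequation which is
solvable in some group is solvable in every existentially closed group. -/
theorem IsEC.exists_solution {G : Type u} [Group G] (hG : IsEC G) {X : Type*}
    (E : Finset (FreeGroup X)) (x₀ : X) {H : Type u} [Group H] (y : X → H)
    (hE : ∀ e ∈ E, FreeGroup.lift y e = 1) (hx₀ : y x₀ ≠ 1) :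
    ∃ z : X → G, (∀ e ∈ E, FreeGroup.lift z e = 1) ∧ z x₀ ≠ 1 := by
  classical
  let T : Finset X := insert x₀ (E.biUnion fun e => (e.toWord.map Prod.fst).toFinset)
  have hx₀T : x₀ ∈ T := Finset.mem_insert_self _ _
  let τ : X → Fin T.card := fun x => T.equivFin (if h : x ∈ T then ⟨x, h⟩ else ⟨x₀, hx₀T⟩)
  let σ : Fin T.card → X := fun j => T.equivFin.symm j
  have hσ : ∀ x ∈ T, σ (τ x) = x := fun x hx => by simp [σ, τ, hx]
  have hlift : ∀ e ∈ E, FreeGroup.lift (y ∘ σ ∘ τ) e = FreeGroup.lift y e := by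
    intro e he
    rw [← FreeGroup.mk_toWord (x := e), FreeGroup.lift_mk, FreeGroup.lift_mk]
    congr 1
    refine List.map_congr_left fun p hp => ?_
    have hpT : p.1 ∈ T := by
      refine Finset.mem_insert_of_mem (Finset.mem_biUnion.2 ⟨e, he, ?_⟩)
      exact List.mem_toFinset.2 (List.mem_map_of_mem hp)
    simp [hσ _ hpT]
  have hex : ∃ b : Fin T.card → G × H,
      (∀ w ∈ E.image (FreeGroup.map (Sum.inr ∘ τ)),
        FreeGroup.lift (Sum.elim (⇑(MonoidHom.inl G H)) b) w = 1) ∧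
      (∀ w ∈ ({FreeGroup.of (Sum.inr (τ x₀))} : Finset (FreeGroup (G ⊕ Fin T.card))),
        FreeGroup.lift (Sum.elim (⇑(MonoidHom.inl G H)) b) w ≠ 1) := by
    refine ⟨fun j => MonoidHom.inr G H (y (σ j)), fun w hw => ?_, fun w hw => ?_⟩
    · obtain ⟨e, he, rfl⟩ := Finset.mem_image.1 hw
      rw [FreeGroup.lift_map_apply]
      have := FreeGroup.map_lift_apply (MonoidHom.inr G H) (y ∘ σ ∘ τ) e
      rw [hlift e he, hE e he, map_one] at this
      exact this.symm
    · rw [Finset.mem_singleton.1 hw]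
      simp [hσ _ hx₀T, hx₀]
  obtain ⟨c, hc, hc'⟩ := hG (G × H) (MonoidHom.inl G H) (fun a b h => (Prod.ext_iff.1 h).1) T.card
    _ _ hex
  refine ⟨c ∘ τ, fun e he => ?_, ?_⟩
  · have := hc _ (Finset.mem_image_of_mem _ he)
    rwa [FreeGroup.lift_map_apply] at this
  · simpa using hc' _ (Finset.mem_singleton_self _)

/-- A group containing an element `c` which is a commutator as soon as an element of `S` is
nontrivial. -/
theorem exists_commutator_model (S : Type u) [Group S] :
    ∃ (P : Type u) (_ : Group P) (ρ : S →* P) (t κ c : P), t * κ * t⁻¹ * κ⁻¹ = 1 ∧ c ≠ 1 ∧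
      ∀ s ≠ 1, ρ s * t * (ρ s)⁻¹ * κ * (ρ s * t * (ρ s)⁻¹)⁻¹ * κ⁻¹ * c = 1 := by
  classical
  let q : (S →₀ ℤ) →+ ℤ :=
    Finsupp.liftAddHom fun g => if g = 1 then 0 else AddMonoidHom.id ℤ
  let t (s : S) : Equiv.Perm ((S →₀ ℤ) × ℤ) :=
    (Equiv.addRight (Finsupp.single s (1 : ℤ))).prodCongr (Equiv.refl ℤ)
  let κ : Equiv.Perm ((S →₀ ℤ) × ℤ) :=
    { toFun := fun p => (p.1, p.2 + q p.1)
      invFun := fun p => (p.1, p.2 - q p.1)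
      left_inv := fun p => by simp
      right_inv := fun p => by simp }
  let c : Equiv.Perm ((S →₀ ℤ) × ℤ) := (Equiv.refl _).prodCongr (Equiv.addRight (1 : ℤ))
  let ρ : S →* Equiv.Perm ((S →₀ ℤ) × ℤ) :=
    { toFun := fun s => (Finsupp.domCongr (Equiv.mulLeft s)).toEquiv.prodCongr (Equiv.refl ℤ)
      map_one' := by
        ext p a
        · change p.1 (1⁻¹ * a) = p.1 a
          simp
        · rfl
      map_mul' := fun s s' => by
        ext p a
        · change p.1 ((s * s')⁻¹ * a) = p.1 (s'⁻¹ * (s⁻¹ * a))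
          simp [mul_assoc]
        · rfl }
  have hρ (s : S) : ρ s * t 1 * (ρ s)⁻¹ = t s := by
    rw [mul_inv_eq_iff_eq_mul]
    refine Equiv.ext fun p => Prod.ext ?_ rfl
    change Finsupp.domCongr (Equiv.mulLeft s) (p.1 + Finsupp.single 1 1) =
      Finsupp.domCongr (Equiv.mulLeft s) p.1 + Finsupp.single s 1
    rw [map_add]
    simp
  refine ⟨_, inferInstance, ρ, t 1, κ, c, ?_, ?_, fun s hs => ?_⟩
  · rw [mul_inv_eq_one, mul_inv_eq_iff_eq_mul]
    refine Equiv.ext fun p => Prod.ext rfl ?_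
    simp [t, κ, q]
  · intro h
    simpa [c] using congrArg (fun f : Equiv.Perm ((S →₀ ℤ) × ℤ) => (f 0).2) h
  · rw [hρ]
    have h₁ : t s * κ * c = κ * t s := by
      refine Equiv.ext fun p => Prod.ext rfl ?_
      simp [t, κ, q, c, hs]
      ring
    have h₂ : κ⁻¹ * c = c * κ⁻¹ := by
      rw [inv_mul_eq_iff_eq_mul, ← mul_assoc, eq_mul_inv_iff_mul_eq]
      refine Equiv.ext fun p => Prod.ext rfl ?_
      simp [κ, c]
      ring
    have h₃ : (t s)⁻¹ * c = c * (t s)⁻¹ := by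
      rw [inv_mul_eq_iff_eq_mul, ← mul_assoc, eq_mul_inv_iff_mul_eq]
      exact Equiv.ext fun p => Prod.ext rfl rfl
    calc t s * κ * (t s)⁻¹ * κ⁻¹ * c = t s * κ * ((t s)⁻¹ * (κ⁻¹ * c)) := by group
      _ = t s * κ * (((t s)⁻¹ * c) * κ⁻¹) := by rw [h₂]; group
      _ = t s * κ * c * ((t s)⁻¹ * κ⁻¹) := by rw [h₃]; group
      _ = 1 := by rw [h₁]; group

namespace WordProblem

variable {k : ℕ}

/-- The letters: the generators and their inverses, two further letters with their inverses,
and one more letter. -/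
abbrev Letter (k : ℕ) : Type := (Fin k × Bool) ⊕ Fin 5

/-- The relations which do not depend on the group. -/
def basicWords (k : ℕ) : List (List (Letter k)) :=
  [.inr 0, .inr 1] :: [.inr 2, .inr 3] :: [.inr 0, .inr 2, .inr 1, .inr 3] ::
    (List.finRange k).map fun i => [.inl (i, true), .inl (i, false)]

/-- The relation certifying that a word is nontrivial. -/
def separatingWord (l : List (Fin k × Bool)) : List (Letter k) :=
  l.map .inl ++ .inr 0 :: ((FreeGroup.invRev l).map .inl ++ .inr 2 :: (l.map .inl ++
    .inr 1 :: ((FreeGroup.invRev l).map .inl ++ [.inr 3, .inr 4])))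

theorem separatingWord_primrec : Primrec (separatingWord (k := k)) := by
  have h₁ : Primrec fun l : List (Fin k × Bool) => (l.map .inl : List (Letter k)) :=
    Primrec.list_map .id (Primrec.sumInl.comp .snd)
  have h₂ : Primrec (FreeGroup.invRev : List (Fin k × Bool) → _) := by
    refine Primrec.list_reverse.comp (Primrec.list_map .id ?_)
    exact (Primrec.pair (Primrec.fst.comp .snd) (Primrec.not.comp (Primrec.snd.comp .snd))).to₂
  have h₃ : Primrec fun l : List (Fin k × Bool) =>
    ((FreeGroup.invRev l).map .inl : List (Letter k)) := h₁.comp h₂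
  exact Primrec.list_append.comp h₁ <| Primrec.list_cons.comp (.const _) <|
    Primrec.list_append.comp h₃ <| Primrec.list_cons.comp (.const _) <|
    Primrec.list_append.comp h₁ <| Primrec.list_cons.comp (.const _) <|
    Primrec.list_append.comp h₃ (.const _)

section

variable {G : Type*} [Group G] {φ : Letter k → G}

theorem prod_map_inl (hφ : ∀ w ∈ basicWords k, (w.map φ).prod = 1) (l : List (Fin k × Bool)) :
    ((l.map Sum.inl).map φ).prod =
      FreeGroup.lift (fun i => φ (.inl (i, true))) (FreeGroup.mk l) := by
  rw [FreeGroup.lift_mk, List.map_map]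
  congr 1
  refine List.map_congr_left fun p _ => ?_
  obtain ⟨i, _ | _⟩ := p
  · have := hφ [.inl (i, true), .inl (i, false)] (by simp [basicWords])
    simpa using (inv_eq_of_mul_eq_one_right (by simpa using this)).symm
  · rfl

theorem prod_map_separatingWord (hφ : ∀ w ∈ basicWords k, (w.map φ).prod = 1)
    (l : List (Fin k × Bool)) {x : G}
    (hx : FreeGroup.lift (fun i => φ (.inl (i, true))) (FreeGroup.mk l) = x) :
    ((separatingWord l).map φ).prod =
      x * φ (.inr 0) * x⁻¹ * φ (.inr 2) * (x * φ (.inr 0) * x⁻¹)⁻¹ * (φ (.inr 2))⁻¹ *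
        φ (.inr 4) := by
  have h₁ : φ (.inr 1) = (φ (.inr 0))⁻¹ :=
    (inv_eq_of_mul_eq_one_right (by simpa using hφ [.inr 0, .inr 1] (by simp [basicWords]))).symm
  have h₃ : φ (.inr 3) = (φ (.inr 2))⁻¹ :=
    (inv_eq_of_mul_eq_one_right (by simpa using hφ [.inr 2, .inr 3] (by simp [basicWords]))).symm
  have h := prod_map_inl hφ l
  have h' := prod_map_inl hφ (FreeGroup.invRev l)
  rw [← FreeGroup.inv_mk, map_inv, hx] at h'
  rw [hx] at h
  simp only [separatingWord, List.map_append, List.map_cons, List.prod_append, List.prod_cons,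
    h, h', h₁, h₃, List.map_nil, List.prod_nil]
  group

end

section

variable {S : Type*} [Group S] (π : FreeGroup (Fin k) →* S)
  [DecidablePred fun l : List (Fin k × Bool) => π (FreeGroup.mk l) = 1]

/-- The relation attached to a word. -/
def wordRelation (l : List (Fin k × Bool)) : List (Letter k) :=
  bif decide (π (FreeGroup.mk l) = 1) then l.map .inl else separatingWord l

/-- An enumeration of all the relations. -/
def relation (p : ℕ) : List (Letter k) :=
  ((basicWords k)[p]?).getD
    (wordRelation π ((Encodable.decode (p - (basicWords k).length)).getD []))

theorem relation_computable
    (h : Computable fun l : List (Fin k × Bool) => decide (π (FreeGroup.mk l) = 1)) :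
    Computable (relation π) := by
  have h₁ : Computable (wordRelation π) :=
    Computable.cond h (Primrec.list_map .id (Primrec.sumInl.comp .snd).to₂).to_comp
      separatingWord_primrec.to_comp
  have h₂ : Primrec fun p : ℕ => (Encodable.decode (α := List (Fin k × Bool))
      (p - (basicWords k).length)).getD [] :=
    Primrec.option_getD.comp (Primrec.decode.comp (Primrec.nat_sub.comp .id (.const _)))
      (.const _)
  exact Computable.option_getD (Primrec.list_getElem?.comp (.const _) .id).to_comp
    (h₁.comp h₂.to_comp)

theorem forall_relation {P : List (Letter k) → Prop} :
    (∀ p, P (relation π p)) ↔ (∀ w ∈ basicWords k, P w) ∧ ∀ l, P (wordRelation π l) := by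
  refine ⟨fun h => ⟨fun w hw => ?_, fun l => ?_⟩, fun h p => ?_⟩
  · obtain ⟨p, hp⟩ := List.mem_iff_getElem?.1 hw
    simpa [relation, hp] using h p
  · simpa [relation] using h ((basicWords k).length + Encodable.encode l)
  · rcases hp : (basicWords k)[p]? with _ | w
    · simpa [relation, hp] using h.2 _
    · simpa [relation, hp] using h.1 w (List.mem_of_getElem? hp)

theorem exists_relation_model {S : Type u} [Group S] (π : FreeGroup (Fin k) →* S)
    [DecidablePred fun l : List (Fin k × Bool) => π (FreeGroup.mk l) = 1] :
    ∃ (P : Type u) (_ : Group P) (φ : Letter k → P),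
      (∀ p, ((relation π p).map φ).prod = 1) ∧ φ (.inr 4) ≠ 1 := by
  obtain ⟨P, _, ρ, t, κ, c, htκ, hc, hs⟩ := exists_commutator_model S
  let φ : Letter k → P := Sum.elim
    (fun p => cond p.2 (ρ (π (.of p.1))) (ρ (π (.of p.1)))⁻¹) ![t, t⁻¹, κ, κ⁻¹, c]
  have hφ : ∀ w ∈ basicWords k, (w.map φ).prod = 1 := by
    simp [basicWords, φ, ← mul_assoc, htκ]
  have hl : FreeGroup.lift (fun i => φ (.inl (i, true))) = ρ.comp π := by
    ext i
    simp [φ]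
  refine ⟨P, _, φ, (forall_relation π).2 ⟨hφ, fun l => ?_⟩, hc⟩
  by_cases h : π (FreeGroup.mk l) = 1
  · simp only [wordRelation, h, decide_true, cond_true]
    rw [prod_map_inl hφ, hl, MonoidHom.comp_apply, h, map_one]
  · simp only [wordRelation, h, decide_false, cond_false]
    rw [prod_map_separatingWord hφ l (DFunLike.congr_fun hl _)]
    exact hs _ h

theorem exists_embedding {G : Type*} [Group G] (hπ : Function.Surjective π) {φ : Letter k → G}
    (hφ : ∀ p, ((relation π p).map φ).prod = 1) (hc : φ (.inr 4) ≠ 1) :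
    ∃ f : S →* G, Function.Injective f := by
  replace hφ := (forall_relation π (P := fun w => (w.map φ).prod = 1)).1 hφ
  set b := FreeGroup.lift fun i => φ (.inl (i, true)) with hb
  have hker (w : FreeGroup (Fin k)) : b w = 1 ↔ π w = 1 := by
    have hw := hφ.2 w.toWord
    by_cases h : π w = 1
    · simp only [wordRelation, FreeGroup.mk_toWord, h, decide_true, cond_true] at hw
      rw [prod_map_inl hφ.1, FreeGroup.mk_toWord] at hw
      exact iff_of_true hw h
    · simp only [wordRelation, FreeGroup.mk_toWord, h, decide_false, cond_false] at hw
      refine iff_of_false (fun h1 => hc ?_) h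
      rw [prod_map_separatingWord hφ.1 _ (x := 1) (by rw [FreeGroup.mk_toWord, ← h1])] at hw
      have h₁ := hφ.1 [.inr 0, .inr 1] (by simp [basicWords])
      have h₂ := hφ.1 [.inr 2, .inr 3] (by simp [basicWords])
      have h₃ := hφ.1 [.inr 0, .inr 2, .inr 1, .inr 3] (by simp [basicWords])
      simp only [List.map_cons, List.map_nil, List.prod_cons, List.prod_nil, mul_one] at h₁ h₂ h₃
      rw [← inv_eq_of_mul_eq_one_right h₁, ← inv_eq_of_mul_eq_one_right h₂] at h₃
      have h₄ : φ (.inr 0) * φ (.inr 2) * (φ (.inr 0))⁻¹ * (φ (.inr 2))⁻¹ = 1 := by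
        simpa [mul_assoc] using h₃
      simpa [h₄] using hw
  let f : S →* G := π.liftOfSurjective hπ ⟨b, fun w hw => (hker w).2 hw⟩
  have hf (w : FreeGroup (Fin k)) : f (π w) = b w :=
    MonoidHom.liftOfRightInverse_comp_apply _ _ _ _ _
  refine ⟨f, (injective_iff_map_eq_one f).2 fun s hs => ?_⟩
  obtain ⟨w, rfl⟩ := hπ s
  rw [hf] at hs
  exact (hker w).1 hs

end

end WordProblem

/-- Every finitely generated group with solvable word problem embeds into every existentially
closed group. -/
theorem solvable_word_problem_embeds_into_ec
    {S : Type u} [Group S] (hS : HasSolvableWordProblem S)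
    {G : Type u} [Group G] (hG : IsEC G) :
    ∃ f : S →* G, Function.Injective f := by
  obtain ⟨k, π, hπ, hdec, hcomp⟩ := hS
  let n := (Finset.univ : Finset (WordProblem.Letter k)).sup Encodable.encode + 1
  have hn (a : WordProblem.Letter k) : Encodable.encode a < n :=
    Nat.lt_succ_of_le (Finset.le_sup (f := Encodable.encode) (Finset.mem_univ a))
  let g : ℕ → List ℕ := fun p => (WordProblem.relation π p).map Encodable.encode
  have hg : Computable g :=
    (Primrec.list_map .id (Primrec.encode.comp .snd).to₂).to_comp.comp (WordProblem.relation_computable π hcomp)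
  have hgn : ∀ p, ∀ i ∈ g p, i < n := by
    intro p i hi
    obtain ⟨a, -, rfl⟩ := List.mem_map.1 hi
    exact hn a
  obtain ⟨s, c₀, c₁, hs, hbal, hout, hp, hV⟩ := AffineRule.StackSim.exists_rules.{u} hg hgn
  obtain ⟨X, β, E, h₁, h₂⟩ := AffineRule.exists_relations.{u} n hs hbal hout (W := Set.range g)
    (by rintro _ ⟨p, rfl⟩; exact hp p)
    (fun H _ h hh => hV H h fun p => hh _ ⟨p, rfl⟩)
  obtain ⟨P, _, φ, hφ, hc⟩ := WordProblem.exists_relation_model π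
  let h : ℕ → P := fun j => (Encodable.decode j).elim 1 φ
  have hh : h ∘ Encodable.encode = φ := by
    ext a
    change (Encodable.decode (Encodable.encode a)).elim 1 φ = φ a
    rw [Encodable.encodek]
    rfl
  obtain ⟨H, _, i, y, hi, hyE, hy⟩ := h₂ P h (by
    rintro _ ⟨p, rfl⟩
    rw [List.map_map, hh, hφ])
  obtain ⟨z, hzE, hz⟩ := hG.exists_solution E (β (Encodable.encode (.inr 4 : WordProblem.Letter k))) y hyE (by
    rw [hy, ← Function.comp_apply (f := h), hh]
    exact fun h => hc (hi (h.trans (map_one i).symm)))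
  refine WordProblem.exists_embedding π hπ (φ := fun a => z (β (Encodable.encode a))) (fun p => ?_) hz
  simpa [g, Function.comp_def] using h₁ G z hzE _ ⟨p, rfl⟩
end

section
/- The free group on two generators embeds into every locally universal group: if G is a locally universal group, then there is an injective group homomorphism from the free group F₂ on two generators into G. -/
open Filter

universe u

/-- `G` is locally universal: every group embeds into some ultrapower of `G`
(realized as the group of germs of functions `I → G` with respect to an ultrafilter on `I`). -/
def IsLocallyUniversal (G : Type u) [Group G] : Prop :=
  ∀ (H : Type u) [Group H], ∃ (I : Type u) (UU : Ultrafilter I)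
    (f : H →* Filter.Germ (UU : Filter I) G), Function.Injective f

/-- If `n` divides `2 ^ n - 1` then `n = 1`. -/
theorem eq_one_of_dvd_two_pow_self_sub_one {n : ℕ} (hn : 0 < n) (h : n ∣ 2 ^ n - 1) : n = 1 := by
  by_contra hn1
  have hp : n.minFac.Prime := Nat.minFac_prime hn1
  have : Fact n.minFac.Prime := ⟨hp⟩
  have h2 : (2 : ZMod n.minFac) ^ n = 1 := by
    have h3 : ((2 ^ n - 1 : ℕ) : ZMod n.minFac) = 0 :=
      (ZMod.natCast_eq_zero_iff _ _).2 ((Nat.minFac_dvd n).trans h)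
    rw [Nat.cast_sub Nat.one_le_two_pow] at h3
    push_cast at h3
    exact sub_eq_zero.1 h3
  have h20 : (2 : ZMod n.minFac) ≠ 0 := by
    intro h0
    rw [h0, zero_pow hn.ne'] at h2
    exact zero_ne_one h2
  have hcop : Nat.Coprime n (n.minFac - 1) :=
    Nat.coprime_of_lt_minFac (by have := hp.two_le; omega) (by have := hp.two_le; omega)
  have hord : orderOf (2 : ZMod n.minFac) = 1 :=
    Nat.eq_one_of_dvd_coprimes hcop (orderOf_dvd_of_pow_eq_one h2)
      (orderOf_dvd_of_pow_eq_one (ZMod.pow_card_sub_one_eq_one h20))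
  have h21 : (2 : ZMod n.minFac) = 1 := orderOf_eq_one_iff.1 hord
  have h10 : (1 : ZMod n.minFac) = 0 := by linear_combination h21
  exact one_ne_zero h10

/-- If `a` conjugates `b` to `b ^ 2` and `a` is conjugate to `b ≠ 1`, then `b` has infinite order. -/
theorem not_isOfFinOrder_of_semiconjBy_sq {G : Type*} [Group G] {a s b : G}
    (hs : SemiconjBy s a b) (ha : SemiconjBy a b (b ^ 2)) (hb : b ≠ 1) : ¬ IsOfFinOrder b := by
  intro hfin
  have hpow : ∀ k : ℕ, SemiconjBy (a ^ k) b (b ^ 2 ^ k) := by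
    intro k
    induction k with
    | zero => simp
    | succ k ih =>
      have h := (ha.pow_right (2 ^ k)).mul_left ih
      rwa [← pow_succ', ← pow_mul, ← pow_succ'] at h
  have han : a ^ orderOf b = 1 := by
    have h := hs.pow_right (orderOf b)
    rw [pow_orderOf_eq_one] at h
    simpa [SemiconjBy] using h
  have hbb : b = b ^ 2 ^ orderOf b := by
    have h := hpow (orderOf b)
    rw [han] at h
    simpa [SemiconjBy] using h
  have hdvd : orderOf b ∣ 2 ^ orderOf b - 1 := by
    apply orderOf_dvd_of_pow_eq_one
    rw [pow_sub _ Nat.one_le_two_pow, ← hbb]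
    simp
  exact hb (orderOf_eq_one_iff.1 (eq_one_of_dvd_two_pow_self_sub_one hfin.orderOf_pos hdvd))

/-- Two elements of infinite order become conjugate in some overgroup. -/
theorem exists_injective_hom_semiconjBy {K : Type u} [Group K] {g h : K}
    (hg : ¬ IsOfFinOrder g) (hh : ¬ IsOfFinOrder h) :
    ∃ (L : Type u) (_ : Group L) (f : K →* L) (t : L),
      Function.Injective f ∧ SemiconjBy t (f g) (f h) := by
  have hg' : Function.Injective (zpowersHom K g) := fun m n hmn =>
    Multiplicative.toAdd.injective (injective_zpow_iff_not_isOfFinOrder.2 hg hmn)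
  have hh' : Function.Injective (zpowersHom K h) := fun m n hmn =>
    Multiplicative.toAdd.injective (injective_zpow_iff_not_isOfFinOrder.2 hh hmn)
  let φ : (zpowersHom K g).range ≃* (zpowersHom K h).range :=
    (MonoidHom.ofInjective hg').symm.trans (MonoidHom.ofInjective hh')
  refine ⟨HNNExtension K _ _ φ, inferInstance, HNNExtension.of, HNNExtension.t,
    HNNExtension.of_injective φ, ?_⟩
  have key := HNNExtension.t_mul_of (φ := φ)
    (MonoidHom.ofInjective hg' (Multiplicative.ofAdd 1))
  simpa [φ, SemiconjBy, MonoidHom.ofInjective_apply] using key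

/-- A finite system of relations, together with `b ≠ 1`. The relations say that `b` and `e`
commute, that `A` and `B` act on them by conjugation as elementary matrices with entry `2`, and
that `b` is conjugate to an element `a` that conjugates `b` to `b ^ 2`. -/
structure SanovSystem {G : Type*} [Group G] (a s b e A B : G) : Prop where
  conj : SemiconjBy s a b
  sq : SemiconjBy a b (b ^ 2)
  comm : Commute b e
  A_b : SemiconjBy A b b
  A_e : SemiconjBy A e (b ^ 2 * e)
  B_b : SemiconjBy B b (b * e ^ 2)
  B_e : SemiconjBy B e e
  ne_one : b ≠ 1

/-- The map `(x, y) ↦ (x + 2 y, y)` on pairs of odd integers `x = 2 m + 1`, `y = 2 n + 1`,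
in the coordinates `(m, n)`. -/
def shearFst : Equiv.Perm (ℤ × ℤ) where
  toFun v := (v.1 + (2 * v.2 + 1), v.2)
  invFun v := (v.1 - (2 * v.2 + 1), v.2)
  left_inv v := by simp
  right_inv v := by simp

/-- The map `(x, y) ↦ (x, y + 2 x)` on pairs of odd integers `x = 2 m + 1`, `y = 2 n + 1`,
in the coordinates `(m, n)`. -/
def shearSnd : Equiv.Perm (ℤ × ℤ) where
  toFun v := (v.1, v.2 + (2 * v.1 + 1))
  invFun v := (v.1, v.2 - (2 * v.1 + 1))
  left_inv v := by simp
  right_inv v := by simp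

/-- The two shears generate a free group. -/
theorem injective_lift_shears :
    Function.Injective (FreeGroup.lift ![shearFst, shearSnd]) := by
  let X : Fin 2 → Set (ℤ × ℤ) := ![
    {v | (0 ≤ v.2 ∧ v.2 < v.1) ∨ (v.1 < v.2 ∧ v.2 < 0)},
    {v | (0 ≤ v.1 ∧ v.1 ≤ v.2) ∨ (v.2 ≤ v.1 ∧ v.1 < 0)}]
  let Y : Fin 2 → Set (ℤ × ℤ) := ![
    {v | (0 ≤ v.2 ∧ v.1 + v.2 + 1 ≤ 0) ∨ (v.2 < 0 ∧ 0 ≤ v.1 + v.2 + 1)},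
    {v | (0 ≤ v.1 ∧ v.1 + v.2 + 1 < 0) ∨ (v.1 < 0 ∧ 0 < v.1 + v.2 + 1)}]
  refine FreeGroup.injective_lift_of_ping_pong (α := ℤ × ℤ) _ X Y ?_ ?_ ?_ ?_ ?_ ?_
  · intro i
    fin_cases i
    · exact ⟨(1, 0), by simp [X]⟩
    · exact ⟨(0, 0), by simp [X]⟩
  · intro i j hij
    refine Set.disjoint_left.2 fun v hi hj => ?_
    fin_cases i <;> fin_cases j <;> simp [X] at hij hi hj <;> omega
  · intro i j hij
    refine Set.disjoint_left.2 fun v hi hj => ?_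
    fin_cases i <;> fin_cases j <;> simp [Y] at hij hi hj <;> omega
  · intro i j
    refine Set.disjoint_left.2 fun v hi hj => ?_
    fin_cases i <;> fin_cases j <;> simp [X, Y] at hi hj <;> omega
  · rintro i _ ⟨v, hv, rfl⟩
    fin_cases i <;> simp [X, Y, shearFst, shearSnd] at hv ⊢ <;> omega
  · rintro i _ ⟨v, hv, rfl⟩
    fin_cases i <;> simp [X, Y, shearFst, shearSnd, Equiv.Perm.inv_def] at hv ⊢ <;> omega

namespace SanovSystem

variable {G : Type*} [Group G] {a s b e A B : G}

theorem map {L : Type*} [Group L] (h : SanovSystem a s b e A B) (f : G →* L)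
    (hf : Function.Injective f) : SanovSystem (f a) (f s) (f b) (f e) (f A) (f B) where
  conj := h.conj.map f
  sq := by simpa using h.sq.map f
  comm := h.comm.map f
  A_b := h.A_b.map f
  A_e := by simpa using h.A_e.map f
  B_b := by simpa using h.B_b.map f
  B_e := h.B_e.map f
  ne_one := (map_ne_one_iff f hf).2 h.ne_one

theorem semiconjBy_A (h : SanovSystem a s b e A B) (p q : ℤ) :
    SemiconjBy A (b ^ p * e ^ q) (b ^ (p + 2 * q) * e ^ q) := by
  have h1 := (h.A_b.zpow_right p).mul_right (h.A_e.zpow_right q)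
  rwa [(h.comm.pow_left 2).mul_zpow, ← mul_assoc, ← zpow_natCast b 2, ← zpow_mul, ← zpow_add]
    at h1

theorem semiconjBy_B (h : SanovSystem a s b e A B) (p q : ℤ) :
    SemiconjBy B (b ^ p * e ^ q) (b ^ p * e ^ (q + 2 * p)) := by
  have h1 := (h.B_b.zpow_right p).mul_right (h.B_e.zpow_right q)
  rwa [(h.comm.pow_right 2).mul_zpow, mul_assoc, ← zpow_natCast e 2, ← zpow_mul, ← zpow_add,
    add_comm] at h1

theorem zpow_mul_zpow_eq_one (h : SanovSystem a s b e A B) {p q : ℤ}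
    (hpq : b ^ p * e ^ q = 1) : p = 0 ∧ q = 0 := by
  have hb : Function.Injective fun n : ℤ => b ^ n :=
    injective_zpow_iff_not_isOfFinOrder.2 (not_isOfFinOrder_of_semiconjBy_sq h.conj h.sq h.ne_one)
  have h1 : b ^ (p + 2 * q) * e ^ q = 1 := by
    have h2 := h.semiconjBy_A p q
    rw [hpq] at h2
    simpa [SemiconjBy] using h2
  have h3 : p + 2 * q = p := hb (mul_right_cancel (h1.trans hpq.symm))
  have hq : q = 0 := by omega
  subst hq
  refine ⟨hb ?_, rfl⟩
  simpa using hpq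

theorem zpow_mul_zpow_inj (h : SanovSystem a s b e A B) {p q p' q' : ℤ}
    (hpq : b ^ p * e ^ q = b ^ p' * e ^ q') : p = p' ∧ q = q' := by
  have h1 : b ^ (p - p') * e ^ (q - q') = 1 := by
    rw [sub_eq_neg_add p, zpow_add, zpow_sub, mul_assoc, ← mul_assoc (b ^ p), hpq, zpow_neg]
    group
  have := h.zpow_mul_zpow_eq_one h1
  omega

theorem injective_lift (h : SanovSystem a s b e A B) :
    Function.Injective (FreeGroup.lift ![A, B]) := by
  have key : ∀ (w : FreeGroup (Fin 2)) (v : ℤ × ℤ),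
      SemiconjBy (FreeGroup.lift ![A, B] w) (b ^ (2 * v.1 + 1) * e ^ (2 * v.2 + 1))
        (b ^ (2 * (FreeGroup.lift ![shearFst, shearSnd] w v).1 + 1) *
          e ^ (2 * (FreeGroup.lift ![shearFst, shearSnd] w v).2 + 1)) := by
    intro w
    induction w using FreeGroup.induction_on with
    | C1 => simp
    | of i =>
      intro v
      fin_cases i
      · convert h.semiconjBy_A (2 * v.1 + 1) (2 * v.2 + 1) using 3 <;> simp [shearFst]
        ring
      · convert h.semiconjBy_B (2 * v.1 + 1) (2 * v.2 + 1) using 3 <;> simp [shearSnd]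
        ring
    | inv_of i ih =>
      intro v
      have h1 := ih ((FreeGroup.lift ![shearFst, shearSnd] (FreeGroup.of i))⁻¹ v)
      rw [← Equiv.Perm.mul_apply, mul_inv_cancel, Equiv.Perm.one_apply] at h1
      rw [map_inv, map_inv]
      exact h1.inv_symm_left
    | mul x y hx hy =>
      intro v
      rw [map_mul, map_mul, Equiv.Perm.mul_apply]
      exact (hx _).mul_left (hy v)
  refine (injective_iff_map_eq_one _).2 fun w hw => ?_
  refine (injective_iff_map_eq_one _).1 injective_lift_shears w (Equiv.ext fun v => ?_)
  have h1 := key w v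
  rw [hw] at h1
  have h2 := h.zpow_mul_zpow_inj (show _ = _ by simpa [SemiconjBy] using h1)
  ext
  · simp only [Equiv.Perm.one_apply]
    omega
  · simp only [Equiv.Perm.one_apply]
    omega

end SanovSystem

/-- The map `(x, y) ↦ (2 x, y)`, as a permutation of the rational plane. -/
def ratDilation : Equiv.Perm (ℚ × ℚ) where
  toFun v := (2 * v.1, v.2)
  invFun v := (v.1 / 2, v.2)
  left_inv v := by simp
  right_inv v := by ext <;> simp; ring

/-- Some group contains a solution of the system `SanovSystem`. -/
theorem exists_sanovSystem :
    ∃ (H : Type) (_ : Group H) (a s b e A B : H), SanovSystem a s b e A B := by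
  let a : Equiv.Perm (ℚ × ℚ) := ratDilation
  let b : Equiv.Perm (ℚ × ℚ) := Equiv.addRight (1, 0)
  let e : Equiv.Perm (ℚ × ℚ) := Equiv.addRight (0, 1)
  let A : Equiv.Perm (ℚ × ℚ) :=
    ⟨fun v => (v.1 + 2 * v.2, v.2), fun v => (v.1 - 2 * v.2, v.2), fun v => by simp,
      fun v => by simp⟩
  let B : Equiv.Perm (ℚ × ℚ) :=
    ⟨fun v => (v.1, v.2 + 2 * v.1), fun v => (v.1, v.2 - 2 * v.1), fun v => by simp,
      fun v => by simp⟩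
  have ha : ¬ IsOfFinOrder a := by
    have hpow : ∀ n : ℕ, (a ^ n) (1, 0) = (2 ^ n, 0) := by
      intro n
      induction n with
      | zero => simp
      | succ n ih =>
        rw [pow_succ', Equiv.Perm.mul_apply, ih]
        simp [a, ratDilation, pow_succ']
    rw [isOfFinOrder_iff_pow_eq_one]
    rintro ⟨n, hn, h⟩
    have h1 := hpow n
    rw [h, Equiv.Perm.one_apply, Prod.mk.injEq] at h1
    exact (one_lt_pow₀ (one_lt_two : (1 : ℚ) < 2) hn.ne').ne h1.1
  have hb : ¬ IsOfFinOrder b := by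
    have hpow : ∀ n : ℕ, (b ^ n) (0, 0) = ((n : ℚ), 0) := by
      intro n
      induction n with
      | zero => simp
      | succ n ih =>
        rw [pow_succ', Equiv.Perm.mul_apply, ih]
        simp [b]
    rw [isOfFinOrder_iff_pow_eq_one]
    rintro ⟨n, hn, h⟩
    have h1 := hpow n
    rw [h, Equiv.Perm.one_apply, Prod.mk.injEq] at h1
    exact hn.ne (by exact_mod_cast h1.1)
  obtain ⟨L, _, f, t, hf, ht⟩ := exists_injective_hom_semiconjBy ha hb
  have hsq : SemiconjBy a b (b ^ 2) := by
    ext v <;> simp [a, b, ratDilation, pow_two]; ring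
  have hcomm : Commute b e := by
    ext v <;> simp [b, e]
  have hAb : SemiconjBy A b b := by
    ext v <;> simp [A, b]; ring
  have hAe : SemiconjBy A e (b ^ 2 * e) := by
    ext v <;> simp [A, b, e, pow_two]; ring
  have hBb : SemiconjBy B b (b * e ^ 2) := by
    ext v <;> simp [B, b, e, pow_two]; ring
  have hBe : SemiconjBy B e e := by
    ext v <;> simp [B, e]; ring
  exact ⟨L, inferInstance, f a, t, f b, f e, f A, f B,
    { conj := ht
      sq := by simpa using hsq.map f
      comm := hcomm.map f
      A_b := hAb.map f
      A_e := by simpa using hAe.map f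
      B_b := by simpa using hBb.map f
      B_e := hBe.map f
      ne_one := (map_ne_one_iff f hf).2 fun h => hb (h ▸ IsOfFinOrder.one) }⟩

/-- A solution of `SanovSystem` in an ultrapower of `G` yields one in `G`. -/
theorem SanovSystem.exists_of_germ {G I : Type*} [Group G] {U : Ultrafilter I}
    {a s b e A B : Germ (U : Filter I) G} (h : SanovSystem a s b e A B) :
    ∃ a s b e A B : G, SanovSystem a s b e A B := by
  induction a using Germ.inductionOn with | _ a
  induction s using Germ.inductionOn with | _ s
  induction b using Germ.inductionOn with | _ b
  induction e using Germ.inductionOn with | _ e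
  induction A using Germ.inductionOn with | _ A
  induction B using Germ.inductionOn with | _ B
  obtain ⟨h1, h2, h3, h4, h5, h6, h7, h8⟩ := h
  have h8' : ∀ᶠ i in (U : Filter I), b i ≠ 1 :=
    Ultrafilter.eventually_not.2 fun hb => h8 (Germ.coe_eq.2 hb)
  obtain ⟨i, g1, g2, g3, g4, g5, g6, g7, g8⟩ := ((Germ.coe_eq.1 h1).and <|
    (Germ.coe_eq.1 h2).and <| (Germ.coe_eq.1 h3).and <| (Germ.coe_eq.1 h4).and <|
    (Germ.coe_eq.1 h5).and <| (Germ.coe_eq.1 h6).and <| (Germ.coe_eq.1 h7).and h8').exists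
  exact ⟨a i, s i, b i, e i, A i, B i, g1, g2, g3, g4, g5, g6, g7, g8⟩

/-- The free group on two generators embeds into every locally universal group. -/
theorem free_group_embeds_into_locally_universal
    {G : Type u} [Group G] (hG : IsLocallyUniversal G) :
    ∃ f : FreeGroup (Fin 2) →* G, Function.Injective f := by
  obtain ⟨H, _, a, s, b, e, A, B, h⟩ := exists_sanovSystem
  obtain ⟨I, U, f, hf⟩ := hG (ULift.{u} H)
  obtain ⟨a, s, b, e, A, B, h⟩ := ((h.map (MulEquiv.ulift.symm : H ≃* ULift.{u} H).toMonoidHom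
    (MulEquiv.injective _)).map f hf).exists_of_germ
  exact ⟨_, h.injective_lift⟩
end
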